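/- arXiv:math/0612606 — 3 statements merged into one kernel-verified Lean document; each statement's English description precedes it below -/
import Mathlib

section
/- Assume at least one of S, S⁻¹ is bounded. Let M be a multiplier on E and let r > 0 be such that the circle C_r = { z : |z| = r } is contained in spec(S). Then there exists a function ν ∈ L^∞ of the unit circle 𝕋 with ‖ν‖_∞ ≤ ‖M‖ whose n-th Fourier coefficient (1/2π)∫_{−π}^{π} ν(e^{it}) e^{−int} dt equals M̂(n) rⁿ for every n ∈ ℤ; that is, the symbol M̃(z) = Σ_{n∈ℤ} M̂(n) zⁿ restricted to C_r is an L^∞ function essentially bounded by ‖M‖. -/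
open scoped ENNReal
open MeasureTheory intervalIntegral

/-- The spectrum of a (possibly unbounded, partially defined) linear operator on a
Banach space. -/
def pSpec {E : Type*} [NormedAddCommGroup E] [NormedSpace ℂ E]
    (A : E →ₗ.[ℂ] E) : Set ℂ :=
  {lam | ¬ Function.Bijective fun x : A.domain => A x - lam • (x : E)}


namespace MulSym

lemma integral_exp_int (l : ℤ) :
    ∫ t in (-Real.pi)..Real.pi, Complex.exp ((l : ℂ) * Complex.I * (t : ℂ))
      = if l = 0 then ((2 * Real.pi : ℝ) : ℂ) else 0 := by
  split_ifs with h
  · subst h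
    simp
    ring
  · have hc : (l : ℂ) * Complex.I ≠ 0 := by
      simp [h]
    rw [integral_exp_mul_complex hc, div_eq_zero_iff]
    left
    rw [sub_eq_zero, Complex.exp_eq_exp_iff_exists_int]
    refine ⟨l, ?_⟩
    push_cast
    ring

/-- The Fejér kernel. -/
noncomputable def fej (N : ℕ) (t : ℝ) : ℝ :=
  ‖∑ j ∈ Finset.range (N + 1), Complex.exp ((j : ℂ) * Complex.I * (t : ℂ))‖ ^ 2 / (N + 1 : ℝ)

/-- The Fejér coefficients. -/
noncomputable def fejc (N : ℕ) (m : ℤ) : ℝ :=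
  if |m| ≤ N then 1 - |(m : ℝ)| / (N + 1 : ℝ) else 0

lemma fej_continuous (N : ℕ) : Continuous (fej N) := by
  unfold fej; fun_prop

lemma fej_nonneg (N : ℕ) (t : ℝ) : 0 ≤ fej N t := by
  unfold fej; positivity

lemma fej_eq (N : ℕ) (t : ℝ) : (fej N t : ℂ) = (1 / (N + 1 : ℂ)) *
    ∑ j ∈ Finset.range (N + 1), ∑ k ∈ Finset.range (N + 1),
      Complex.exp ((((j : ℤ) - (k : ℤ) : ℤ) : ℂ) * Complex.I * (t : ℂ)) := by
  unfold fej
  push_cast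
  rw [← Complex.mul_conj', map_sum, Finset.sum_mul_sum, div_eq_mul_inv, mul_comm, one_div]
  congr 1
  refine Finset.sum_congr rfl fun j _ => Finset.sum_congr rfl fun k _ => ?_
  rw [← Complex.exp_conj, ← Complex.exp_add]
  congr 1
  simp
  ring

lemma count (N : ℕ) (m : ℤ) :
    (∑ j ∈ Finset.range (N + 1), ∑ k ∈ Finset.range (N + 1),
      if ((j : ℤ) - (k : ℤ) + m = 0) then (1 : ℝ) else 0) = (N + 1 : ℝ) * fejc N m := by
  have key : ∀ n : ℕ, ∀ a : ℕ, (∑ j ∈ Finset.range (N + 1), ∑ k ∈ Finset.range (N + 1),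
      if ((j : ℤ) + a = k) then (1 : ℝ) else 0) = ((N + 1 - a : ℕ) : ℝ) := by
    intro _ a
    have : ∀ j ∈ Finset.range (N + 1), (∑ k ∈ Finset.range (N + 1),
      if ((j : ℤ) + a = k) then (1 : ℝ) else 0) = if j < N + 1 - a then 1 else 0 := by
      intro j _
      have : ∀ k : ℕ, ((j : ℤ) + a = k) ↔ (j + a = k) := by intro k; omega
      simp only [this, Finset.sum_ite_eq, Finset.mem_range]
      congr 1
      simp only [eq_iff_iff]; omega
    rw [Finset.sum_congr rfl this, Finset.sum_ite, Finset.sum_const_zero, Finset.sum_const, add_zero]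
    rw [nsmul_eq_mul, mul_one]
    congr 1
    have : (Finset.range (N + 1)).filter (fun j => j < N + 1 - a) = Finset.range (N + 1 - a) := by
      ext j; simp; omega
    rw [this, Finset.card_range]
  have hv : ∀ a : ℕ, (m = a ∨ m = -a) → ((N + 1 - a : ℕ) : ℝ) = (N + 1 : ℝ) * fejc N m := by
    intro a ha
    have h1 : |m| = a := by rcases ha with h | h <;> simp [h]
    have h2 : |(m : ℝ)| = a := by rcases ha with h | h <;> simp [h]
    unfold fejc
    rw [h1, h2]
    split_ifs with h
    · have : a ≤ N + 1 := by omega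
      rw [Nat.cast_sub this]
      have : (N + 1 : ℝ) ≠ 0 := by positivity
      field_simp
      push_cast; ring
    · have : N + 1 - a = 0 := by omega
      rw [this]; simp
  rcases Int.eq_nat_or_neg m with ⟨a, ha⟩
  rw [← hv a ha, ← key 0 a]
  rcases ha with ha | ha
  · refine Finset.sum_congr rfl fun j _ => Finset.sum_congr rfl fun k _ => ?_
    congr 1; simp only [eq_iff_iff]; omega
  · rw [Finset.sum_comm]
    refine Finset.sum_congr rfl fun j _ => Finset.sum_congr rfl fun k _ => ?_
    congr 1; simp only [eq_iff_iff]; omega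

lemma fej_coeff (N : ℕ) (m : ℤ) :
    ∫ t in (-Real.pi)..Real.pi, (fej N t : ℂ) * Complex.exp ((m : ℂ) * Complex.I * (t : ℂ))
      = ((2 * Real.pi * fejc N m : ℝ) : ℂ) := by
  have h0 : (N + 1 : ℂ) ≠ 0 := by exact_mod_cast Nat.succ_ne_zero N
  have h1 : ∀ t : ℝ, (fej N t : ℂ) * Complex.exp ((m : ℂ) * Complex.I * (t : ℂ)) =
      (1 / (N + 1 : ℂ)) *
    ∑ j ∈ Finset.range (N + 1), ∑ k ∈ Finset.range (N + 1),
      Complex.exp ((((j : ℤ) - (k : ℤ) + m : ℤ) : ℂ) * Complex.I * (t : ℂ)) := by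
    intro t
    rw [fej_eq, mul_assoc, Finset.sum_mul]
    congr 1
    refine Finset.sum_congr rfl fun j _ => ?_
    rw [Finset.sum_mul]
    refine Finset.sum_congr rfl fun k _ => ?_
    rw [← Complex.exp_add]
    congr 1
    push_cast; ring
  simp_rw [h1]
  rw [intervalIntegral.integral_const_mul, intervalIntegral.integral_finsetSum]
  swap
  · intro j _
    apply Continuous.intervalIntegrable
    fun_prop
  have : ∀ j ∈ Finset.range (N + 1), (∫ t in (-Real.pi)..Real.pi, ∑ k ∈ Finset.range (N + 1),
      Complex.exp ((((j : ℤ) - (k : ℤ) + m : ℤ) : ℂ) * Complex.I * (t : ℂ))) =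
      ∑ k ∈ Finset.range (N + 1), if ((j : ℤ) - (k : ℤ) + m = 0) then ((2 * Real.pi : ℝ) : ℂ) else 0 := by
    intro j _
    rw [intervalIntegral.integral_finsetSum]
    · exact Finset.sum_congr rfl fun k _ => integral_exp_int _
    · intro k _
      apply Continuous.intervalIntegrable
      fun_prop
  rw [Finset.sum_congr rfl this]
  have h2 := congrArg (fun x : ℝ => ((2 * Real.pi * x : ℝ) : ℂ)) (count N m)
  simp only [Finset.mul_sum, mul_ite, mul_one, mul_zero] at h2
  have h3 : ∀ p : Prop, ∀ [Decidable p], ((if p then 2 * Real.pi else 0 : ℝ) : ℂ)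
      = if p then ((2 * Real.pi : ℝ) : ℂ) else 0 := by
    intro p _; split_ifs <;> simp
  rw [Complex.ofReal_sum] at h2
  simp_rw [Complex.ofReal_sum, h3] at h2
  rw [h2]
  push_cast
  field_simp

lemma fejc_zero (N : ℕ) : fejc N 0 = 1 := by simp [fejc]

lemma fejc_nonneg (N : ℕ) (m : ℤ) : 0 ≤ fejc N m := by
  unfold fejc
  split_ifs with h
  · have h' : |(m : ℝ)| ≤ N := by exact_mod_cast h
    rw [sub_nonneg, div_le_one (by positivity)]
    linarith
  · exact le_rfl

lemma fejc_le_one (N : ℕ) (m : ℤ) : fejc N m ≤ 1 := by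
  unfold fejc
  split_ifs with h
  · have : 0 ≤ |(m : ℝ)| / (N + 1 : ℝ) := by positivity
    linarith
  · exact zero_le_one

lemma fejc_of_lt (N : ℕ) (m : ℤ) (h : (N : ℤ) < |m|) : fejc N m = 0 := by
  unfold fejc; rw [if_neg]; omega

lemma fejc_tendsto (m : ℤ) : Filter.Tendsto (fun N => fejc N m) Filter.atTop (nhds 1) := by
  have h : Filter.Tendsto (fun N : ℕ => 1 - |(m : ℝ)| * (1 / ((N : ℝ) + 1))) Filter.atTop
      (nhds (1 - |(m : ℝ)| * 0)) :=
    tendsto_const_nhds.sub (tendsto_const_nhds.mul tendsto_one_div_add_atTop_nhds_zero_nat)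
  rw [mul_zero, sub_zero] at h
  refine h.congr' ?_
  filter_upwards [Filter.eventually_ge_atTop m.natAbs] with N hN
  unfold fejc
  rw [if_pos (by rw [Int.abs_eq_natAbs]; omega)]
  ring

/-- A sequence whose Fejér means are uniformly bounded by `C` is the sequence of Fourier
coefficients of a bounded measurable function. -/
lemma exists_symbol (a : ℤ → ℂ) (C : ℝ) (hC : 0 ≤ C)
    (hb : ∀ N : ℕ, ∀ t : ℝ, ‖∑ m ∈ Finset.Icc (-(N : ℤ)) N,
      (fejc N m : ℂ) * a m * Complex.exp ((m : ℂ) * Complex.I * (t : ℂ))‖ ≤ C) :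
    ∃ ν : ℝ → ℂ, Measurable ν ∧ Function.Periodic ν (2 * Real.pi) ∧
      (∀ t : ℝ, ‖ν t‖ ≤ C) ∧
      ∀ n : ℤ, ((1 / (2 * Real.pi) : ℝ) : ℂ) *
          (∫ t in (-Real.pi)..Real.pi, ν t * Complex.exp (-(n : ℂ) * Complex.I * (t : ℂ)))
        = a n := by
  have hT : Fact (0 < 2 * Real.pi) := ⟨Real.two_pi_pos⟩
  have hfou : ∀ (m : ℤ) (t : ℝ), fourier m (t : AddCircle (2 * Real.pi)) =
      Complex.exp ((m : ℂ) * Complex.I * (t : ℂ)) := by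
    intro m t
    rw [fourier_coe_apply]
    congr 1
    have : (Real.pi : ℂ) ≠ 0 := by exact_mod_cast Real.pi_ne_zero
    push_cast
    field_simp
  let μ : Measure (AddCircle (2 * Real.pi)) := AddCircle.haarAddCircle
  -- Fejér means in `L²`
  let f : ℕ → Lp ℂ 2 μ := fun N => ∑ m ∈ Finset.Icc (-(N : ℤ)) N,
      ((fejc N m : ℂ) * a m) • fourierLp 2 m
  have hfae : ∀ N, (f N : AddCircle (2 * Real.pi) → ℂ) =ᵐ[μ]
      fun x => ∑ m ∈ Finset.Icc (-(N : ℤ)) N, (fejc N m : ℂ) * a m * fourier m x := by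
    intro N
    have h1 : ∀ᵐ x ∂μ, ∀ m : ℤ, (fourierLp (T := 2 * Real.pi) 2 m) x = fourier m x :=
      ae_all_iff.2 fun m => coeFn_fourierLp 2 m
    have h2 : ∀ᵐ x ∂μ, ∀ m : ℤ, (((fejc N m : ℂ) * a m) • fourierLp (T := 2 * Real.pi) 2 m : Lp ℂ 2 μ) x
        = ((fejc N m : ℂ) * a m) • (fourierLp (T := 2 * Real.pi) 2 m) x :=
      ae_all_iff.2 fun m => Lp.coeFn_smul _ _
    have h3 := Lp.coeFn_finsetSum (μ := μ) (p := 2) (Finset.Icc (-(N : ℤ)) N)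
      (fun m => (((fejc N m : ℂ) * a m) • fourierLp (T := 2 * Real.pi) 2 m : Lp ℂ 2 μ))
    filter_upwards [h1, h2, h3] with x h1 h2 h3
    rw [h3, Finset.sum_apply]
    refine Finset.sum_congr rfl fun m _ => ?_
    rw [h2, h1, smul_eq_mul]
  have hfb : ∀ N, ∀ᵐ x ∂μ, ‖f N x‖ ≤ C := by
    intro N
    filter_upwards [hfae N] with x hx
    rw [hx]
    induction x using QuotientAddGroup.induction_on with
    | H t =>
      have := hb N t
      simp_rw [← hfou] at this
      exact this
  have hfn : ∀ N, ‖f N‖ ≤ C := by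
    intro N
    have := Lp.norm_le_of_ae_bound (p := 2) hC (hfb N)
    simpa [measureUnivNNReal] using this
  have hrepr : ∀ N m, fourierBasis.repr (f N) m = (fejc N m : ℂ) * a m := by
    intro N m
    have horth : Orthonormal ℂ (fourierLp (T := 2 * Real.pi) 2) := orthonormal_fourier
    rw [HilbertBasis.repr_apply_apply, coe_fourierBasis]
    by_cases hm : m ∈ Finset.Icc (-(N : ℤ)) N
    · exact horth.inner_right_sum _ hm
    · have h0 : fejc N m = 0 := by
        apply fejc_of_lt
        rw [Finset.mem_Icc, ← abs_le] at hm
        omega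
      rw [h0, inner_sum]
      simp only [Complex.ofReal_zero, zero_mul]
      refine Finset.sum_eq_zero fun k hk => ?_
      rw [inner_smul_right, horth.inner_eq_zero, mul_zero]
      rintro rfl
      exact hm hk
  have hmem : Memℓp a 2 := by
    refine lp.memℓp_of_tendsto (F := fun N => fourierBasis.repr (f N)) (l := Filter.atTop) ?_ ?_
    · rw [isBounded_iff_forall_norm_le]
      refine ⟨C, ?_⟩
      rintro _ ⟨N, rfl⟩
      rw [LinearIsometryEquiv.norm_map]
      exact hfn N
    · rw [tendsto_pi_nhds]
      intro m
      have h1 := (Complex.continuous_ofReal.tendsto 1).comp (fejc_tendsto m)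
      have h2 := h1.mul_const (a m)
      rw [Complex.ofReal_one, one_mul] at h2
      exact h2.congr fun N => (hrepr N m).symm
  let g : Lp ℂ 2 μ := fourierBasis.repr.symm ⟨a, hmem⟩
  have hg : ∀ m, fourierBasis.repr g m = a m := by
    intro m; simp [g]
  have hlim : Filter.Tendsto f Filter.atTop (nhds g) := by
    have hsum : Summable fun m => ‖a m‖ ^ 2 := by
      have := (memℓp_gen_iff (p := 2) (by norm_num)).1 hmem
      simpa using this
    have hn : ∀ N, ‖f N - g‖ ^ 2 = ∑' m, ‖(fejc N m : ℂ) * a m - a m‖ ^ 2 := by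
      intro N
      rw [← fourierBasis.repr.norm_map]
      have := lp.norm_rpow_eq_tsum (p := 2) (by norm_num) (fourierBasis.repr (f N - g))
      simp only [ENNReal.toReal_ofNat, Real.rpow_ofNat] at this
      rw [this]
      refine tsum_congr fun m => ?_
      rw [map_sub, lp.coeFn_sub, Pi.sub_apply, hrepr, hg]
    have h0 : Filter.Tendsto (fun N => ‖f N - g‖ ^ 2) Filter.atTop (nhds 0) := by
      simp_rw [hn]
      have := tendsto_tsum_of_dominated_convergence (𝓕 := Filter.atTop)
        (f := fun N m => ‖(fejc N m : ℂ) * a m - a m‖ ^ 2) (g := fun _ => (0 : ℝ)) hsum ?_ ?_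
      · simpa using this
      · intro m
        have h1 := (Complex.continuous_ofReal.tendsto 1).comp (fejc_tendsto m)
        have h2 := (((h1.mul_const (a m)).sub_const (a m)).norm).pow 2
        simpa using h2
      · refine Filter.Eventually.of_forall fun N m => ?_
        rw [norm_pow, norm_norm]
        gcongr
        have : (fejc N m : ℂ) * a m - a m = -(((1 - fejc N m : ℝ) : ℂ) * a m) := by
          push_cast; ring
        rw [this, norm_neg, norm_mul, Complex.norm_real, Real.norm_eq_abs,
          abs_of_nonneg (by linarith [fejc_le_one N m])]
        exact mul_le_of_le_one_left (norm_nonneg _) (by linarith [fejc_nonneg N m])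
    rw [tendsto_iff_norm_sub_tendsto_zero]
    have := h0.sqrt
    simpa [Real.sqrt_sq] using this
  have hgb : ∀ᵐ x ∂μ, ‖g x‖ ≤ C := by
    obtain ⟨ns, -, hns⟩ := (tendstoInMeasure_of_tendsto_Lp hlim).exists_seq_tendsto_ae
    have : ∀ᵐ x ∂μ, ∀ N, ‖f N x‖ ≤ C := ae_all_iff.2 hfb
    filter_upwards [hns, this] with x h1 h2
    exact le_of_tendsto h1.norm (Filter.Eventually.of_forall fun i => h2 _)
  have hgm : Measurable (g : AddCircle (2 * Real.pi) → ℂ) := (Lp.stronglyMeasurable g).measurable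
  let s : Set (AddCircle (2 * Real.pi)) := {x | ‖g x‖ ≤ C}
  have hs : MeasurableSet s := measurableSet_le hgm.norm measurable_const
  let h : AddCircle (2 * Real.pi) → ℂ := s.indicator g
  have hhg : h =ᵐ[μ] g := by
    filter_upwards [hgb] with x hx
    exact Set.indicator_of_mem (s := s) hx _
  refine ⟨fun t => h t, ?_, ?_, ?_, ?_⟩
  · exact (hgm.indicator hs).comp AddCircle.measurable_mk'
  · intro t
    simp
  · intro t
    by_cases ht : (t : AddCircle (2 * Real.pi)) ∈ s
    · simp only [h, Set.indicator_of_mem ht]; exact ht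
    · simp only [h, Set.indicator_of_notMem ht]; simpa using hC
  · intro n
    have h1 : fourierCoeff h n = a n := by
      rw [← hg n, fourierBasis_repr]
      unfold fourierCoeff
      apply MeasureTheory.integral_congr_ae
      filter_upwards [hhg] with x hx
      rw [hx]
    rw [← h1, fourierCoeff_eq_intervalIntegral h n (-Real.pi)]
    rw [show -Real.pi + 2 * Real.pi = Real.pi by ring, Complex.real_smul]
    congr 1
    apply intervalIntegral.integral_congr
    intro t _
    simp only [hfou, smul_eq_mul]
    rw [mul_comm]
    push_cast
    rfl


lemma fej_integral (N : ℕ) : ∫ t in (-Real.pi)..Real.pi, fej N t = 2 * Real.pi := by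
  have h := fej_coeff N 0
  simp only [Int.cast_zero, zero_mul, Complex.exp_zero, mul_one, fejc_zero] at h
  rw [intervalIntegral.integral_ofReal] at h
  exact_mod_cast h

section
variable {E : Type*} [NormedAddCommGroup E] [NormedSpace ℂ E]

/-- Strong continuity of a uniformly bounded family can be tested on a total set. -/
lemma strong_cont (e : ℤ → E) (hdense : Dense (Submodule.span ℂ (Set.range e) : Set E))
    (A : ℝ → E →L[ℂ] E) (C : ℝ) (hC : 0 ≤ C) (hA : ∀ t, ‖A t‖ ≤ C)
    (hc : ∀ k, Continuous fun t => A t (e k)) (x : E) : Continuous fun t => A t x := by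
  have hspan : ∀ y ∈ Submodule.span ℂ (Set.range e), Continuous fun t => A t y := by
    intro y hy
    induction hy using Submodule.span_induction with
    | mem y hy => obtain ⟨k, rfl⟩ := hy; exact hc k
    | zero => simpa using continuous_const
    | add y z _ _ h1 h2 => simp only [map_add]; exact h1.add h2
    | smul c y _ h => simp only [map_smul]; exact h.const_smul c
  apply continuous_of_uniform_approx_of_continuous
  intro u hu
  obtain ⟨ε, hε, hu⟩ := Metric.mem_uniformity_dist.1 hu
  obtain ⟨y, hy, hxy⟩ := hdense.exists_dist_lt x (ε := ε / (C + 1)) (by positivity)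
  refine ⟨fun t => A t y, hspan y hy, fun t => hu ?_⟩
  rw [dist_eq_norm, ← map_sub]
  rw [dist_eq_norm, lt_div_iff₀ (by positivity)] at hxy
  calc ‖A t (x - y)‖ ≤ C * ‖x - y‖ := (A t).le_of_opNorm_le (hA t) _
    _ ≤ ‖x - y‖ * (C + 1) := by nlinarith [norm_nonneg (x - y)]
    _ < ε := hxy

/-- Averaging a strongly continuous family against the Fejér kernel. -/
lemma exists_average [CompleteSpace E] (A : ℝ → E →L[ℂ] E) (C : ℝ) (hC : 0 ≤ C) (hA : ∀ t, ‖A t‖ ≤ C)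
    (hc : ∀ x, Continuous fun t => A t x) (N : ℕ) :
    ∃ B : E →L[ℂ] E, ‖B‖ ≤ C ∧ ∀ x, B x = ((1 / (2 * Real.pi) : ℝ) : ℂ) •
      ∫ t in (-Real.pi)..Real.pi, (fej N t : ℂ) • A t x := by
  have hfc := fej_continuous N
  have hcc : ∀ x, Continuous fun t => (fej N t : ℂ) • A t x := fun x =>
    (Complex.continuous_ofReal.comp hfc).smul (hc x)
  let L : E →ₗ[ℂ] E :=
    { toFun := fun x => ((1 / (2 * Real.pi) : ℝ) : ℂ) •
        ∫ t in (-Real.pi)..Real.pi, (fej N t : ℂ) • A t x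
      map_add' := by
        intro x y
        rw [← smul_add, ← intervalIntegral.integral_add ((hcc x).intervalIntegrable _ _)
          ((hcc y).intervalIntegrable _ _)]
        simp
      map_smul' := by
        intro c x
        rw [RingHom.id_apply, smul_comm c]
        congr 1
        rw [← intervalIntegral.integral_smul]
        congr 1
        funext t
        rw [map_smul, smul_comm c] }
  have hL : ∀ x, ‖L x‖ ≤ C * ‖x‖ := by
    intro x
    have h1 : ‖∫ t in (-Real.pi)..Real.pi, (fej N t : ℂ) • A t x‖ ≤ 2 * Real.pi * (C * ‖x‖) := by
      have hle : -Real.pi ≤ Real.pi := by linarith [Real.pi_pos]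
      rw [← fej_integral N, ← intervalIntegral.integral_mul_const]
      refine (intervalIntegral.norm_integral_le_integral_norm hle).trans ?_
      apply intervalIntegral.integral_mono_on hle
      · exact (hcc x).norm.intervalIntegrable _ _
      · exact (hfc.mul continuous_const).intervalIntegrable _ _
      · intro t _
        rw [norm_smul, Complex.norm_real, Real.norm_of_nonneg (fej_nonneg N t)]
        exact mul_le_mul_of_nonneg_left ((A t).le_of_opNorm_le (hA t) _) (fej_nonneg N t)
    have h2 : L x = ((1 / (2 * Real.pi) : ℝ) : ℂ) •
        ∫ t in (-Real.pi)..Real.pi, (fej N t : ℂ) • A t x := rfl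
    rw [h2]
    rw [norm_smul, Complex.norm_real, Real.norm_of_nonneg (by positivity)]
    calc _ ≤ 1 / (2 * Real.pi) * (2 * Real.pi * (C * ‖x‖)) := by gcongr
      _ = C * ‖x‖ := by
        have := Real.pi_ne_zero
        field_simp
  exact ⟨L.mkContinuous C hL, L.mkContinuous_norm_le hC hL, fun x => rfl⟩

/-- The algebraic heart: if `S ^ N B = P(S)` then `P(lam)/lam^N` is bounded by `‖B‖`. -/
lemma alg_bound [CompleteSpace E] [Nontrivial E] (S B : E →L[ℂ] E) (hSB : Commute S B)
    (N : ℕ) (p : Polynomial ℂ) (hp : S ^ N * B = Polynomial.aeval S p) (lam : ℂ) (hlam : lam ≠ 0)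
    (hspec : ¬ IsUnit (S - algebraMap ℂ (E →L[ℂ] E) lam)) (c : ℂ)
    (hc : lam ^ N * c = p.eval lam) : ‖c‖ ≤ ‖B‖ := by
  by_contra! hlt
  apply hspec
  have hu : IsUnit (algebraMap ℂ (E →L[ℂ] E) c - B) := spectrum.mem_resolventSet_of_norm_lt hlt
  obtain ⟨q, hq⟩ := Polynomial.X_sub_C_dvd_sub_C_eval (a := lam) (p := p)
  obtain ⟨q', hq'⟩ := Polynomial.X_sub_C_dvd_sub_C_eval (a := lam) (p := (Polynomial.X ^ N : Polynomial ℂ))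
  have h1 := congrArg (Polynomial.aeval S) hq
  have h2 := congrArg (Polynomial.aeval S) hq'
  simp only [map_sub, map_mul, Polynomial.aeval_X, Polynomial.aeval_C, Polynomial.eval_pow,
    Polynomial.eval_X, map_pow] at h1 h2
  rw [← hp, ← hc, map_mul, map_pow] at h1
  set z := algebraMap ℂ (E →L[ℂ] E) lam with hz
  set d := algebraMap ℂ (E →L[ℂ] E) c with hd
  have hS : ∀ f : Polynomial ℂ, Commute S (Polynomial.aeval S f) := by
    intro f
    have := (Polynomial.commute_X f).map (Polynomial.aeval S)
    simpa using this
  have hz' : ∀ T : E →L[ℂ] E, Commute z T := fun T => Algebra.commutes lam T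
  have hR : (S - z) * (Polynomial.aeval S q' * B - Polynomial.aeval S q) = z ^ N * (d - B) := by
    rw [mul_sub, ← mul_assoc, ← h1, ← h2]
    noncomm_ring
  have hcomm : Commute (S - z) (Polynomial.aeval S q' * B - Polynomial.aeval S q) :=
    Commute.sub_left (Commute.sub_right ((hS q').mul_right hSB) (hS q)) (hz' _)
  have hzu : IsUnit z := (IsUnit.mk0 lam hlam).map (algebraMap ℂ (E →L[ℂ] E))
  exact ((hcomm.isUnit_mul_iff).1 (hR ▸ (hzu.pow N).mul hu)).1

lemma core [CompleteSpace E]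
    (ι : E →ₗ[ℂ] (ℤ → ℂ)) (hι : Function.Injective ι)
    (e : ℤ → E) (he : ∀ k : ℤ, ι (e k) = Pi.single k 1)
    (hdense : Dense (Submodule.span ℂ (Set.range e) : Set E))
    (hcoord : ∀ n : ℤ, Continuous fun x : E => ι x n)
    (Ψ : ℂ → E → E)
    (hΨ : ∀ z : ℂ, ‖z‖ = 1 → ∀ x : E, ∀ n : ℤ, ι (Ψ z x) n = ι x n * z ^ n)
    (hΨiso : ∀ z : ℂ, ‖z‖ = 1 → ∀ x : E, ‖Ψ z x‖ = ‖x‖)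
    (S : E →L[ℂ] E) (hS : ∀ x n, ι (S x) n = ι x (n - 1))
    (M : E →L[ℂ] E)
    (hM : ∀ k n : ℤ, ι (M (e (k + 1))) n = ι (M (e k)) (n - 1))
    (r : ℝ) (hr : 0 < r)
    (hCr : ∀ z : ℂ, ‖z‖ = r → ¬ IsUnit (S - algebraMap ℂ (E →L[ℂ] E) z)) :
    ∃ ν : ℝ → ℂ, Measurable ν ∧ Function.Periodic ν (2 * Real.pi) ∧
      (∀ t : ℝ, ‖ν t‖ ≤ ‖M‖) ∧
      ∀ n : ℤ, ((1 / (2 * Real.pi) : ℝ) : ℂ) *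
          (∫ t in (-Real.pi)..Real.pi, ν t * Complex.exp (-(n : ℂ) * Complex.I * (t : ℂ)))
        = ι (M (e 0)) n * (r : ℂ) ^ n := by
  have hext : ∀ x y : E, (∀ n, ι x n = ι y n) → x = y := fun x y h => hι (funext h)
  have hnt : Nontrivial E := by
    refine ⟨⟨e 0, 0, fun h => ?_⟩⟩
    have := congrFun (he 0) 0
    simp [h] at this
  have hez : ∀ t : ℝ, ‖Complex.exp (Complex.I * t)‖ = 1 := by
    intro t; rw [mul_comm]; exact Complex.norm_exp_ofReal_mul_I t
  have hezp : ∀ (t : ℝ) (n : ℤ), Complex.exp (Complex.I * t) ^ n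
      = Complex.exp ((n : ℂ) * Complex.I * t) := by
    intro t n; rw [← Complex.exp_int_mul]; congr 1; ring
  -- the isometries as operators
  have hψ : ∀ t : ℝ, ∃ U : E →L[ℂ] E, ‖U‖ ≤ 1 ∧ ∀ x n,
      ι (U x) n = Complex.exp ((n : ℂ) * Complex.I * t) * ι x n := by
    intro t
    let z := Complex.exp (Complex.I * t)
    let L : E →ₗ[ℂ] E :=
      { toFun := Ψ z
        map_add' := by
          intro x y
          apply hext
          intro n
          simp only [map_add, Pi.add_apply, hΨ z (hez t)]
          ring
        map_smul' := by
          intro c x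
          apply hext
          intro n
          simp only [map_smul, Pi.smul_apply, hΨ z (hez t), smul_eq_mul, RingHom.id_apply]
          ring }
    have hL : ∀ x, ‖L x‖ ≤ 1 * ‖x‖ := fun x => by rw [one_mul]; exact (hΨiso z (hez t) x).le
    refine ⟨L.mkContinuous 1 hL, L.mkContinuous_norm_le zero_le_one hL, fun x n => ?_⟩
    rw [← hezp, mul_comm]
    exact hΨ z (hez t) x n
  choose U hU1 hU using hψ
  have hUe : ∀ t k, U t (e k) = Complex.exp ((k : ℂ) * Complex.I * t) • e k := by
    intro t k
    apply hext
    intro n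
    rw [hU, map_smul, Pi.smul_apply, he, smul_eq_mul]
    by_cases h : n = k
    · subst h; rfl
    · simp [h]
  have hUc : ∀ x, Continuous fun t => U t x := by
    apply strong_cont e hdense U 1 zero_le_one hU1
    intro k
    simp only [hUe]
    fun_prop
  have hMe : ∀ (k n : ℤ), ι (M (e k)) n = ι (M (e 0)) (n - k) := by
    intro k
    induction k using Int.induction_on with
    | zero => simp
    | succ i ih => intro n; rw [hM, ih]; congr 1; ring
    | pred i ih =>
      intro n
      have := hM (-(i : ℤ) - 1) (n + 1)
      rw [sub_add_cancel, add_sub_cancel_right] at this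
      rw [← this, ih]; congr 1; ring
  let A : ℝ → E →L[ℂ] E := fun t => (U t).comp (M.comp (U (-t)))
  have hA : ∀ t, ‖A t‖ ≤ ‖M‖ := by
    intro t
    calc ‖A t‖ ≤ ‖U t‖ * (‖M‖ * ‖U (-t)‖) :=
          ((U t).opNorm_comp_le _).trans
            (mul_le_mul_of_nonneg_left (M.opNorm_comp_le _) (norm_nonneg _))
      _ ≤ 1 * (‖M‖ * 1) := by
          gcongr
          · exact hU1 t
          · exact hU1 _
      _ = ‖M‖ := by ring
  have hAc : ∀ x, Continuous fun t => A t x := by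
    apply strong_cont e hdense A ‖M‖ (norm_nonneg _) hA
    intro k
    have h : (fun t => A t (e k)) = fun t : ℝ => Complex.exp ((k : ℂ) * Complex.I * ((-t : ℝ) : ℂ)) •
        U t (M (e k)) := by
      funext t
      simp only [A, ContinuousLinearMap.comp_apply, hUe, map_smul]
    rw [h]
    have := hUc (M (e k))
    fun_prop
  have hAe : ∀ t k n, ι (A t (e k)) n
      = ι (M (e 0)) (n - k) * Complex.exp (((n - k : ℤ) : ℂ) * Complex.I * t) := by
    intro t k n
    simp only [A, ContinuousLinearMap.comp_apply, hUe, map_smul, Pi.smul_apply, smul_eq_mul, hU]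
    rw [hMe, ← mul_assoc, ← Complex.exp_add, mul_comm]
    congr 2
    push_cast; ring
  have hSe : ∀ k, S (e k) = e (k + 1) := by
    intro k
    apply hext
    intro n
    rw [hS, he, he]
    by_cases h : n = k + 1
    · subst h; simp
    · rw [Pi.single_eq_of_ne (by omega), Pi.single_eq_of_ne h]
  have hSpow : ∀ (j : ℕ) x n, ι ((S ^ j) x) n = ι x (n - j) := by
    intro j
    induction j with
    | zero => intro x n; simp
    | succ j ih =>
      intro x n
      rw [pow_succ, mul_apply_eq_comp, ih, hS]; congr 1; push_cast; ring
  apply exists_symbol _ _ (norm_nonneg M)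
  intro N t
  obtain ⟨B, hB, hBx⟩ := exists_average A ‖M‖ (norm_nonneg _) hA hAc N
  have hBe : ∀ k n, ι (B (e k)) n = (fejc N (n - k) : ℂ) * ι (M (e 0)) (n - k) := by
    intro k n
    let φ : E →L[ℂ] ℂ := ⟨(LinearMap.proj n).comp ι, hcoord n⟩
    have hφ : ∀ x, φ x = ι x n := fun x => rfl
    rw [← hφ, hBx, map_smul, ← ContinuousLinearMap.intervalIntegral_comp_comm]
    swap
    · exact Continuous.intervalIntegrable
        ((Complex.continuous_ofReal.comp (fej_continuous N)).smul (hAc _)) _ _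
    have : ∀ t : ℝ, φ ((fej N t : ℂ) • A t (e k)) = ι (M (e 0)) (n - k) *
        ((fej N t : ℂ) * Complex.exp (((n - k : ℤ) : ℂ) * Complex.I * t)) := by
      intro t; rw [map_smul, hφ, hAe, smul_eq_mul]; ring
    simp_rw [this]
    rw [intervalIntegral.integral_const_mul, fej_coeff, smul_eq_mul]
    have : (Real.pi : ℂ) ≠ 0 := by exact_mod_cast Real.pi_ne_zero
    push_cast
    field_simp
  have hcomm : Commute S B := by
    apply ContinuousLinearMap.ext_on hdense
    rintro _ ⟨k, rfl⟩
    apply hext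
    intro n
    simp only [mul_apply_eq_comp, hS, hBe, hSe]
    rw [show n - 1 - k = n - (k + 1) by ring]
  let b : ℤ → ℂ := fun m => (fejc N m : ℂ) * ι (M (e 0)) m
  let p : Polynomial ℂ := ∑ j ∈ Finset.range (2 * N + 1),
    Polynomial.C (b ((j : ℤ) - N)) * Polynomial.X ^ j
  have hp : S ^ N * B = Polynomial.aeval S p := by
    apply ContinuousLinearMap.ext_on hdense
    rintro _ ⟨k, rfl⟩
    apply hext
    intro n
    simp only [mul_apply_eq_comp, hSpow, hBe, p, map_sum, map_mul, Polynomial.aeval_C,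
      map_pow, Polynomial.aeval_X, sum_apply, Finset.sum_apply,
      ContinuousLinearMap.algebraMap_apply, map_smul, Pi.smul_apply, smul_eq_mul, he]
    change b (n - N - k) = _
    by_cases h : 0 ≤ n - k ∧ n - k ≤ 2 * N
    · rw [Finset.sum_eq_single (n - k).toNat]
      · have h' : (((n - k).toNat : ℕ) : ℤ) = n - k := Int.toNat_of_nonneg h.1
        rw [h']
        simp only [sub_sub_cancel, Pi.single_eq_same, mul_one]
        congr 1; ring
      · intro j _ hj
        rw [Pi.single_eq_of_ne (by omega), mul_zero]
      · intro hj
        rw [Finset.mem_range] at hj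
        omega
    · have h0 : b (n - N - k) = 0 := by
        simp only [b]
        rw [fejc_of_lt]
        · simp
        · rw [lt_abs]; omega
      rw [h0]
      symm
      refine Finset.sum_eq_zero fun j hj => ?_
      rw [Finset.mem_range] at hj
      rw [Pi.single_eq_of_ne (by omega), mul_zero]
  have hrc : (r : ℂ) ≠ 0 := by exact_mod_cast hr.ne'
  let lam : ℂ := r * Complex.exp (Complex.I * t)
  have hlam0 : lam ≠ 0 := mul_ne_zero hrc (Complex.exp_ne_zero _)
  have hlamn : ‖lam‖ = r := by
    simp only [lam]
    rw [norm_mul, hez, mul_one, Complex.norm_real, Real.norm_of_nonneg hr.le]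
  refine le_trans ?_ hB
  refine alg_bound S B hcomm N p hp lam hlam0 (hCr lam hlamn) _ ?_
  have hsum : ∑ m ∈ Finset.Icc (-(N : ℤ)) N, (fejc N m : ℂ) * (ι (M (e 0)) m * (r : ℂ) ^ m) *
      Complex.exp ((m : ℂ) * Complex.I * (t : ℂ)) =
      ∑ j ∈ Finset.range (2 * N + 1), b ((j : ℤ) - N) * lam ^ ((j : ℤ) - N) := by
    symm
    refine Finset.sum_bij (fun j _ => (j : ℤ) - N) ?_ ?_ ?_ ?_
    · intro j hj
      rw [Finset.mem_range] at hj
      rw [Finset.mem_Icc]; omega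
    · intro i _ j _ h
      simpa using h
    · intro m hm
      rw [Finset.mem_Icc] at hm
      refine ⟨(m + N).toNat, ?_, ?_⟩
      · rw [Finset.mem_range]; omega
      · omega
    · intro j _
      simp only [lam, b]
      rw [mul_zpow, hezp]
      ring
  rw [hsum, Finset.mul_sum]
  simp only [p, Polynomial.eval_finsetSum, Polynomial.eval_mul, Polynomial.eval_C,
    Polynomial.eval_pow, Polynomial.eval_X]
  refine Finset.sum_congr rfl fun j _ => ?_
  rw [zpow_sub₀ hlam0, zpow_natCast, zpow_natCast]
  field_simp

/-- Identification of the closure of a partial operator through its graph. -/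
lemma closure_graph (S0 : E →ₗ.[ℂ] E) (G : Submodule ℂ (E × E))
    (hcl : IsClosed (G : Set (E × E))) (h1 : S0.graph ≤ G)
    (h2 : (G : Set (E × E)) ⊆ closure (S0.graph : Set (E × E)))
    (hf : ∀ x ∈ G, x.1 = 0 → x.2 = 0) : S0.closure.graph = G := by
  have h3 : S0.graph.topologicalClosure = G :=
    le_antisymm (S0.graph.topologicalClosure_minimal h1 hcl) h2
  have h4 : S0.IsClosable := ⟨G.toLinearPMap, by rw [h3, Submodule.toLinearPMap_graph_eq G hf]⟩
  rw [← h4.graph_closure_eq_closure_graph, h3]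

/-- An everywhere defined coordinate shift is a bounded operator. -/
lemma exists_shift [CompleteSpace E]
    (ι : E →ₗ[ℂ] (ℤ → ℂ)) (hι : Function.Injective ι)
    (hcoord : ∀ n : ℤ, Continuous fun x : E => ι x n) (d : ℤ)
    (h : ∀ x : E, ∃ y : E, ∀ n : ℤ, ι y n = ι x (n + d)) :
    ∃ S : E →L[ℂ] E, ∀ x n, ι (S x) n = ι x (n + d) := by
  have hext : ∀ x y : E, (∀ n, ι x n = ι y n) → x = y := fun x y h => hι (funext h)
  choose f hf using h
  let L : E →ₗ[ℂ] E :=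
    { toFun := f
      map_add' := fun x y => hext _ _ fun n => by simp [hf]
      map_smul' := fun c x => hext _ _ fun n => by simp [hf] }
  have hL : Continuous L := by
    apply L.continuous_of_seq_closed_graph
    intro u x y hu hv
    apply hext
    intro n
    have h1 : Filter.Tendsto (fun i => ι (L (u i)) n) Filter.atTop (nhds (ι y n)) :=
      ((hcoord n).tendsto y).comp hv
    have h2 : Filter.Tendsto (fun i => ι (u i) (n + d)) Filter.atTop (nhds (ι x (n + d))) :=
      ((hcoord (n + d)).tendsto x).comp hu
    have h3 : ι (L x) n = ι x (n + d) := hf x n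
    rw [h3]
    refine tendsto_nhds_unique h1 (h2.congr fun i => ?_)
    exact (hf (u i) n).symm
  exact ⟨⟨L, hL⟩, hf⟩

end

end MulSym

/-- Every multiplier `M` on `E` has, on every circle `C_r` contained in `spec(S)`, a
symbol given by an `L^∞` function `ν` on the unit circle (parametrized by
`t ↦ ν(e^{it})`), essentially bounded by `‖M‖`, whose `n`-th Fourier coefficient is
`M̂(n) rⁿ`. -/
theorem stmt2
    {E : Type*} [NormedAddCommGroup E] [NormedSpace ℂ E] [CompleteSpace E]
    (ι : E →ₗ[ℂ] (ℤ → ℂ)) (hι : Function.Injective ι)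
    (e : ℤ → E) (he : ∀ k : ℤ, ι (e k) = Pi.single k 1)
    (hdense : Dense (Submodule.span ℂ (Set.range e) : Set E))
    (hcoord : ∀ n : ℤ, Continuous fun x : E => ι x n)
    -- (H3), strengthened so that each `ψ_z` is an isometry of `E`:
    (Ψ : ℂ → E → E)
    (hΨ : ∀ z : ℂ, ‖z‖ = 1 → ∀ x : E, ∀ n : ℤ, ι (Ψ z x) n = ι x n * z ^ n)
    (hΨiso : ∀ z : ℂ, ‖z‖ = 1 → ∀ x : E, ‖Ψ z x‖ = ‖x‖)
    -- `S0` is the restriction of `S` to `F(ℤ)`: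
    (S0 : E →ₗ.[ℂ] E)
    (hS0dom : S0.domain = Submodule.span ℂ (Set.range e))
    (hS0 : ∀ x : S0.domain, ∀ n : ℤ, ι (S0 x) n = ι (x : E) (n - 1))
    -- at least one of `S`, `S⁻¹` is bounded:
    (hb : (∀ x : E, ∃ y : E, ∀ n : ℤ, ι y n = ι x (n - 1)) ∨
      (∀ x : E, ∃ y : E, ∀ n : ℤ, ι y n = ι x (n + 1)))
    -- `M` is a multiplier on `E` (commutes with `S` on `F(ℤ)`):
    (M : E →L[ℂ] E)
    (hM : ∀ k n : ℤ, ι (M (e (k + 1))) n = ι (M (e k)) (n - 1))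
    -- `r > 0` is such that the circle `C_r` is contained in `spec(S)`:
    (r : ℝ) (hr : 0 < r)
    (hCr : {z : ℂ | ‖z‖ = r} ⊆ pSpec S0.closure) :
    ∃ ν : ℝ → ℂ, Measurable ν ∧ Function.Periodic ν (2 * Real.pi) ∧
      (∀ᵐ t : ℝ, ‖ν t‖ ≤ ‖M‖) ∧
      ∀ n : ℤ, ((1 / (2 * Real.pi) : ℝ) : ℂ) *
          (∫ t in (-Real.pi)..Real.pi, ν t * Complex.exp (-(n : ℂ) * Complex.I * (t : ℂ)))
        = ι (M (e 0)) n * (r : ℂ) ^ n := by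
  have hext : ∀ x y : E, (∀ n, ι x n = ι y n) → x = y := fun x y h => hι (funext h)
  rcases hb with hb | hb
  · obtain ⟨S, hS⟩ := MulSym.exists_shift ι hι hcoord (-1) hb
    have hS0S : ∀ x : S0.domain, S0 x = S x := fun x => hext _ _ fun n => by
      rw [hS0, hS]; rfl
    have hG : S0.closure.graph = (S : E →ₗ[ℂ] E).graph := by
      apply MulSym.closure_graph
      · have : (((S : E →ₗ[ℂ] E).graph : Submodule ℂ (E × E)) : Set (E × E))
            = {x | x.2 = S x.1} := by
          ext x; simp [LinearMap.mem_graph_iff]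
        rw [this]
        exact isClosed_eq continuous_snd (S.continuous.comp continuous_fst)
      · intro x hx
        obtain ⟨y, hy1, hy2⟩ := (S0.mem_graph_iff).1 hx
        rw [LinearMap.mem_graph_iff, ← hy1, ← hy2]
        exact hS0S y
      · rintro ⟨x, y⟩ hx
        rw [SetLike.mem_coe, LinearMap.mem_graph_iff] at hx
        simp only at hx
        subst hx
        have hc : Continuous fun x : E => (x, S x) := by fun_prop
        refine map_mem_closure (f := fun x : E => (x, S x)) hc (hdense x) ?_
        intro y hy
        rw [SetLike.mem_coe, ← hS0dom] at hy
        exact (S0.mem_graph_iff).2 ⟨⟨y, hy⟩, rfl, hS0S _⟩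
      · intro x hx h0
        rw [LinearMap.mem_graph_iff] at hx
        rw [hx, h0, map_zero]
    have hmem : ∀ x : E, (x, S x) ∈ S0.closure.graph := fun x => by
      rw [hG, LinearMap.mem_graph_iff]; rfl
    have hval : ∀ x : S0.closure.domain, S0.closure x = S x := fun x => by
      have := S0.closure.mem_graph x
      rw [hG, LinearMap.mem_graph_iff] at this
      exact this
    obtain ⟨ν, h1, h2, h3, h4⟩ := MulSym.core ι hι e he hdense hcoord Ψ hΨ hΨiso S
      (fun x n => by rw [hS]; rfl) M hM r hr (by
        intro z hz hu
        refine hCr hz ?_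
        have hbij := ContinuousLinearMap.isUnit_iff_bijective.1 hu
        constructor
        · intro x y hxy
          simp only [hval] at hxy
          apply Subtype.ext
          apply hbij.1
          simpa [ContinuousLinearMap.algebraMap_apply] using hxy
        · intro w
          obtain ⟨x, hx⟩ := hbij.2 w
          obtain ⟨y, hy1, -⟩ := (S0.closure.mem_graph_iff).1 (hmem x)
          refine ⟨y, ?_⟩
          simp only [hval]
          rw [hy1, ← hx]
          simp [ContinuousLinearMap.algebraMap_apply])
    exact ⟨ν, h1, h2, Filter.Eventually.of_forall h3, h4⟩
  · obtain ⟨T, hT⟩ := MulSym.exists_shift ι hι hcoord 1 hb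
    have hS0T : ∀ x : S0.domain, T (S0 x) = x := fun x => hext _ _ fun n => by
      rw [hT, hS0, add_sub_cancel_right]
    have hTinj : ∀ y, T y = 0 → y = 0 := by
      intro y hy
      apply hext
      intro n
      have := hT y (n - 1)
      rw [sub_add_cancel, hy] at this
      rw [← this]; simp
    have hTe : ∀ k, T (e k) = e (k - 1) := by
      intro k
      apply hext
      intro n
      rw [hT, he, he]
      by_cases h : n = k - 1
      · subst h; simp
      · rw [Pi.single_eq_of_ne (by omega), Pi.single_eq_of_ne h]
    let G : Submodule ℂ (E × E) := LinearMap.ker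
      ((LinearMap.fst ℂ E E) - (T : E →ₗ[ℂ] E).comp (LinearMap.snd ℂ E E))
    have hGm : ∀ x : E × E, x ∈ G ↔ x.1 = T x.2 := by
      intro x; simp [G, sub_eq_zero]
    have hG : S0.closure.graph = G := by
      apply MulSym.closure_graph
      · have : (G : Set (E × E)) = {x | x.1 = T x.2} := by
          ext x; exact hGm x
        rw [this]
        exact isClosed_eq continuous_fst (T.continuous.comp continuous_snd)
      · intro x hx
        obtain ⟨y, hy1, hy2⟩ := (S0.mem_graph_iff).1 hx
        rw [hGm, ← hy1, ← hy2]
        exact (hS0T y).symm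
      · rintro ⟨x, y⟩ hx
        rw [SetLike.mem_coe, hGm] at hx
        simp only at hx
        subst hx
        have hc : Continuous fun x : E => (T x, x) := by fun_prop
        refine map_mem_closure (f := fun x : E => (T x, x)) hc (hdense y) ?_
        intro y hy
        have hTy : T y ∈ S0.domain := by
          rw [hS0dom]
          rw [SetLike.mem_coe] at hy
          induction hy using Submodule.span_induction with
          | mem y hy =>
            obtain ⟨k, rfl⟩ := hy
            rw [hTe]; exact Submodule.subset_span ⟨_, rfl⟩
          | zero => simp
          | add y z _ _ h1 h2 => rw [map_add]; exact Submodule.add_mem _ h1 h2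
          | smul c y _ h => rw [map_smul]; exact Submodule.smul_mem _ _ h
        refine (S0.mem_graph_iff).2 ⟨⟨T y, hTy⟩, rfl, ?_⟩
        apply hext
        intro n
        rw [hS0]
        simp only [hT, sub_add_cancel]
      · intro x hx h0
        rw [hGm, h0] at hx
        exact hTinj _ hx.symm
    have hmem : ∀ y : E, (T y, y) ∈ S0.closure.graph := fun y => by
      rw [hG, hGm]
    have hval : ∀ x : S0.closure.domain, (x : E) = T (S0.closure x) := fun x => by
      have := S0.closure.mem_graph x
      rw [hG, hGm] at this
      exact this
    -- reflect
    let ι' : E →ₗ[ℂ] (ℤ → ℂ) := (LinearMap.funLeft ℂ ℂ (fun n : ℤ => -n)).comp ι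
    have hι'v : ∀ x n, ι' x n = ι x (-n) := fun x n => rfl
    have hι' : Function.Injective ι' := by
      intro x y h
      apply hext
      intro n
      have := congrFun h (-n)
      simpa [hι'v] using this
    have hrange : Set.range (fun k => e (-k)) = Set.range e := by
      ext x; constructor
      · rintro ⟨k, rfl⟩; exact ⟨-k, rfl⟩
      · rintro ⟨k, rfl⟩; exact ⟨-k, by simp⟩
    obtain ⟨ν, h1, h2, h3, h4⟩ := MulSym.core ι' hι' (fun k => e (-k)) (by
        intro k
        funext n
        rw [hι'v, he]
        by_cases h : n = k
        · subst h; simp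
        · rw [Pi.single_eq_of_ne (by omega), Pi.single_eq_of_ne h])
      (by rw [hrange]; exact hdense) (fun n => hcoord (-n)) (fun z => Ψ z⁻¹)
      (by
        intro z hz x n
        rw [hι'v, hι'v, hΨ _ (by rw [norm_inv, hz, inv_one]), inv_zpow', neg_neg])
      (fun z hz x => hΨiso _ (by rw [norm_inv, hz, inv_one]) x) T
      (fun x n => by rw [hι'v, hι'v, hT]; congr 1; ring) M
      (by
        intro k n
        have := hM (-(k + 1)) (-n + 1)
        rw [hι'v, hι'v]
        rw [add_sub_cancel_right, show -(k + 1) + 1 = -k by ring] at this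
        rw [← this]
        congr 1; ring)
      r⁻¹ (inv_pos.2 hr) (by
        intro z hz hu
        have hz0 : z ≠ 0 := by
          rintro rfl
          rw [norm_zero] at hz
          exact (inv_pos.2 hr).ne hz
        have hz' : z⁻¹ ∈ {z : ℂ | ‖z‖ = r} := by
          simp [norm_inv, hz]
        refine hCr hz' ?_
        have hbij := ContinuousLinearMap.isUnit_iff_bijective.1 hu
        have hval2 : ∀ y, (T - algebraMap ℂ (E →L[ℂ] E) z) y = T y - z • y := fun y => by
          simp [ContinuousLinearMap.algebraMap_apply]
        constructor
        · intro x y hxy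
          simp only at hxy
          have hxy' : S0.closure x = S0.closure y := by
            apply hbij.1
            rw [hval2, hval2, ← hval, ← hval]
            have := congrArg (fun v => -(z • v)) hxy
            simpa [smul_sub, smul_smul, hz0] using this
          apply Subtype.ext
          rw [hval x, hval y, hxy']
        · intro w
          obtain ⟨y, hy⟩ := hbij.2 (-(z • w))
          obtain ⟨x, hx1, hx2⟩ := (S0.closure.mem_graph_iff).1 (hmem y)
          refine ⟨x, ?_⟩
          simp only at hx1 hx2
          simp only [hx1, hx2]
          rw [hval2] at hy
          have := congrArg (fun v => -(z⁻¹ • v)) hy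
          simpa [smul_sub, smul_smul, hz0] using this)
    refine ⟨fun t => ν (-t), h1.comp measurable_neg, ?_, Filter.Eventually.of_forall fun t => h3 _, ?_⟩
    · intro t
      have := h2 (-(t + 2 * Real.pi))
      simp only
      rw [← this]
      congr 1; ring
    · intro n
      have h5 := h4 (-n)
      rw [hι'v, neg_neg, neg_zero] at h5
      have h6 : ((r⁻¹ : ℝ) : ℂ) ^ (-n) = (r : ℂ) ^ n := by
        push_cast
        rw [inv_zpow', neg_neg]
      rw [h6] at h5
      rw [← h5]
      congr 1
      have h7 := intervalIntegral.integral_comp_neg (a := -Real.pi) (b := Real.pi)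
        (fun t : ℝ => ν t * Complex.exp (-((-n : ℤ) : ℂ) * Complex.I * (t : ℂ)))
      rw [neg_neg] at h7
      rw [← h7]
      apply intervalIntegral.integral_congr
      intro t _
      simp only
      congr 2
      push_cast; ring
end

section
/- Assume at least one of 𝐒, 𝐒₋₁ is bounded. Let T be a Toeplitz operator on 𝐄 and let r > 0 satisfy 1/ρ(𝐒₋₁) ≤ r ≤ ρ(𝐒) if ρ(𝐒) < +∞, or 1/ρ(𝐒₋₁) ≤ r < +∞ if ρ(𝐒) = +∞. Then there exists a function ν ∈ L^∞ of the unit circle 𝕋 with ‖ν‖_∞ ≤ ‖T‖ whose n-th Fourier coefficient (1/2π)∫_{−π}^{π} ν(e^{it}) e^{−int} dt equals T̂(n) rⁿ for every n ∈ ℤ; that is, the symbol T̃(z) = Σ_{n∈ℤ} T̂(n) zⁿ restricted to the circle of radius r is an L^∞ function essentially bounded by ‖T‖. -/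
open scoped ENNReal
open MeasureTheory

/-- The spectral radius (in `ℝ≥0∞`) of a possibly unbounded operator. -/
noncomputable def pRad {E : Type*} [NormedAddCommGroup E] [NormedSpace ℂ E]
    (A : E →ₗ.[ℂ] E) : ℝ≥0∞ :=
  ⨆ lam ∈ pSpec A, (‖lam‖₊ : ℝ≥0∞)

section Aux

theorem sup_bound {X : Type*} [MeasurableSpace X] {P : Measure X} [IsProbabilityMeasure P]
    (C : ℝ) (f : Lp ℂ 2 P) (hC0 : 0 ≤ C)
    (hfb : ∀ g : Lp ℂ 2 P, ‖inner ℂ g f‖ ≤ C * ∫ x, ‖g x‖ ∂P) : ∀ᵐ x ∂P, ‖f x‖ ≤ C := by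
  have hfm : Measurable (fun x => f x) := (Lp.stronglyMeasurable f).measurable
  have hA : MeasurableSet {x | C < ‖f x‖} := measurableSet_lt measurable_const hfm.norm
  set A := {x | C < ‖f x‖} with hAdef
  have hg2 : MemLp (A.indicator f) 2 P :=
    (Lp.memLp f).indicator hA
  have h1 := hfb (hg2.toLp (A.indicator f))
  have hgae := hg2.coeFn_toLp
  have hi2 : Integrable (fun x => ‖f x‖ ^ 2) P :=
    (Lp.memLp f).integrable_norm_pow (by norm_num)
  have hi1 : Integrable (fun x => ‖f x‖) P :=
    ((Lp.memLp f).integrable (by norm_num)).norm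
  have e1 : inner ℂ (hg2.toLp (A.indicator f)) f =
      ((∫ x in A, ‖f x‖ ^ 2 ∂P : ℝ) : ℂ) := by
    rw [L2.inner_def, ← integral_complex_ofReal, ← integral_indicator hA]
    apply integral_congr_ae
    filter_upwards [hgae] with x hx
    rw [hx]
    by_cases hxA : x ∈ A
    · simp only [Set.indicator_of_mem hxA]
      rw [inner_self_eq_norm_sq_to_K]
      norm_cast
    · simp [Set.indicator_of_notMem hxA]
  have e2 : ∫ x, ‖(hg2.toLp (A.indicator f) : Lp ℂ 2 P) x‖ ∂P =
      ∫ x in A, ‖f x‖ ∂P := by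
    rw [← integral_indicator hA]
    apply integral_congr_ae
    filter_upwards [hgae] with x hx
    rw [hx, ← norm_indicator_eq_indicator_norm]
  rw [e1, e2] at h1
  have h2 : ∫ x in A, ‖f x‖ ^ 2 ∂P ≤
      C * ∫ x in A, ‖f x‖ ∂P := by
    refine le_trans ?_ h1
    rw [Complex.norm_real]; exact le_abs_self _
  rw [← integral_const_mul, ← sub_nonpos, ← integral_sub hi2.integrableOn
    (hi1.const_mul C).integrableOn] at h2
  have h3 : 0 ≤ᵐ[P.restrict A] fun x => ‖f x‖ ^ 2 - C * ‖f x‖ := by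
    filter_upwards [ae_restrict_mem hA] with x hx
    have : C < ‖f x‖ := hx
    simp only [Pi.zero_apply]
    nlinarith [norm_nonneg (f x)]
  have h4 := (integral_eq_zero_iff_of_nonneg_ae h3
    (hi2.sub (hi1.const_mul C)).integrableOn).mp
    (le_antisymm h2 (integral_nonneg_of_ae h3))
  have h5 := (ae_restrict_iff' hA).mp h4
  filter_upwards [h5] with x hx
  by_contra hcon
  push Not at hcon
  have h6 := hx hcon
  simp only [Pi.zero_apply] at h6
  nlinarith [norm_nonneg (f x)]

open Filter Topology in
set_option maxHeartbeats 800000 in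
theorem fourier_limit (C : ℝ) (a : ℤ → ℂ) (F : ℕ → ℝ → ℂ) (hc : ∀ N, Continuous (F N))
    (hp : ∀ N, Function.Periodic (F N) (2 * Real.pi)) (hC : ∀ N t, ‖F N t‖ ≤ C)
    (hlim : ∀ m : ℤ, Tendsto (fun N => ((1 / (2 * Real.pi) : ℝ) : ℂ) *
      (∫ t in (-Real.pi)..Real.pi, F N t * Complex.exp (-(m : ℂ) * Complex.I * (t : ℂ))))
      atTop (𝓝 (a m))) :
    ∃ ν : ℝ → ℂ, Measurable ν ∧ Function.Periodic ν (2 * Real.pi) ∧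
      (∀ᵐ t : ℝ, ‖ν t‖ ≤ C) ∧
      ∀ n : ℤ, ((1 / (2 * Real.pi) : ℝ) : ℂ) *
          (∫ t in (-Real.pi)..Real.pi, ν t * Complex.exp (-(n : ℂ) * Complex.I * (t : ℂ)))
        = a n := by
  have : Fact (0 < 2 * Real.pi) := ⟨Real.two_pi_pos⟩
  have hC0 : 0 ≤ C := (norm_nonneg _).trans (hC 0 0)
  -- relation of fourierCoeff with the interval integral
  have key : ∀ (g : AddCircle (2 * Real.pi) → ℂ) (n : ℤ), fourierCoeff g n =
      ((1 / (2 * Real.pi) : ℝ) : ℂ) * (∫ t in (-Real.pi)..Real.pi,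
        g (t : AddCircle (2 * Real.pi)) * Complex.exp (-(n : ℂ) * Complex.I * (t : ℂ))) := by
    intro g n
    rw [fourierCoeff_eq_intervalIntegral g n (-Real.pi)]
    rw [show -Real.pi + 2 * Real.pi = Real.pi by ring, Complex.real_smul]
    congr 1
    apply intervalIntegral.integral_congr
    intro t _
    simp only [smul_eq_mul]
    rw [fourier_coe_apply, mul_comm]
    congr 2
    have : (Real.pi : ℂ) ≠ 0 := by exact_mod_cast Real.pi_ne_zero
    push_cast
    field_simp
  -- lift F
  let G : ℕ → C(AddCircle (2 * Real.pi), ℂ) := fun N =>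
    ⟨(hp N).lift, continuous_coinduced_dom.mpr (hc N)⟩
  have hG : ∀ N (t : ℝ), G N (t : AddCircle (2 * Real.pi)) = F N t := fun N t => rfl
  have hGC : ∀ N x, ‖G N x‖ ≤ C := by
    intro N x
    induction x using QuotientAddGroup.induction_on with
    | H t => exact hC N t
  let H : ℕ → Lp ℂ 2 (@AddCircle.haarAddCircle (2 * Real.pi) _) := fun N =>
    ContinuousMap.toLp 2 AddCircle.haarAddCircle ℂ (G N)
  have hHae : ∀ N, (H N) =ᵐ[AddCircle.haarAddCircle] G N := fun N =>
    ContinuousMap.coeFn_toLp _ _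
  have hHcoef : ∀ m, Tendsto (fun N => fourierCoeff (H N) m) atTop (𝓝 (a m)) := by
    intro m
    refine (hlim m).congr fun N => ?_
    have : fourierCoeff (H N) m = fourierCoeff (G N) m := by
      rw [fourierCoeff, fourierCoeff]
      apply integral_congr_ae
      filter_upwards [hHae N] with x hx
      rw [hx]
    rw [this, key]
    rfl
  have hHn : ∀ N, ‖H N‖ ≤ C := by
    intro N
    refine (Lp.norm_le_of_ae_bound (C := C) hC0 ?_).trans ?_
    · filter_upwards [hHae N] with x hx
      rw [hx]; exact hGC N x
    · have : measureUnivNNReal (@AddCircle.haarAddCircle (2 * Real.pi) _) = 1 := by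
        simp [measureUnivNNReal]
      simp [this]
  have hbes : ∀ s : Finset ℤ, ∑ m ∈ s, ‖a m‖ ^ 2 ≤ C ^ 2 := by
    intro s
    refine le_of_tendsto (tendsto_finsetSum s fun m _ => ((hHcoef m).norm.pow 2)) ?_
    refine Eventually.of_forall fun N => ?_
    have h1 := (fourierBasis (T := 2 * Real.pi)).orthonormal.sum_inner_products_le (H N) (s := s)
    refine (le_trans (le_of_eq ?_) h1).trans (pow_le_pow_left₀ (norm_nonneg _) (hHn N) 2)
    refine Finset.sum_congr rfl fun m _ => ?_
    rw [← fourierBasis_repr, HilbertBasis.repr_apply_apply]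
  have hmem : Memℓp a 2 := by
    apply memℓp_gen
    simp only [ENNReal.toReal_ofNat]
    norm_cast
    exact summable_of_sum_le (fun _ => by positivity) hbes
  let f : Lp ℂ 2 (@AddCircle.haarAddCircle (2 * Real.pi) _) :=
    fourierBasis.repr.symm ⟨a, hmem⟩
  have hf : ∀ m, fourierCoeff f m = a m := by
    intro m
    rw [← fourierBasis_repr]
    simp [f]
  -- weak convergence
  have hweak : ∀ g : Lp ℂ 2 (@AddCircle.haarAddCircle (2 * Real.pi) _),
      Tendsto (fun N => inner ℂ g (H N)) atTop (𝓝 (inner ℂ g f)) := by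
    have h0 : ∀ g ∈ Submodule.span ℂ (Set.range (fourierBasis (T := 2 * Real.pi))),
        Tendsto (fun N => inner ℂ g (H N)) atTop (𝓝 (inner ℂ g f)) := by
      intro g hg
      induction hg using Submodule.span_induction with
      | mem x hx =>
        obtain ⟨m, rfl⟩ := hx
        simp only [← HilbertBasis.repr_apply_apply, fourierBasis_repr]
        rw [hf]; exact hHcoef m
      | zero => simp
      | add x y _ _ hx hy => simp only [inner_add_left]; exact hx.add hy
      | smul c x _ hx => simp only [inner_smul_left]; exact hx.const_mul _
    intro g
    rw [Metric.tendsto_atTop]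
    intro ε hε
    have hd : g ∈ closure (Submodule.span ℂ (Set.range (fourierBasis (T := 2 * Real.pi))) :
        Set (Lp ℂ 2 (@AddCircle.haarAddCircle (2 * Real.pi) _))) := by
      have := (fourierBasis (T := 2 * Real.pi)).dense_span
      rw [← Submodule.topologicalClosure_coe, this]; trivial
    obtain ⟨h, hh, hgh⟩ := Metric.mem_closure_iff.mp hd (ε / (2 * (C + ‖f‖ + 1)))
      (by positivity)
    obtain ⟨N0, hN0⟩ := (Metric.tendsto_atTop.mp (h0 h hh)) (ε / 2) (by positivity)
    refine ⟨N0, fun N hN => ?_⟩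
    have e1 := hN0 N hN
    rw [dist_eq_norm, ← inner_sub_right] at e1 ⊢
    have e2 : inner ℂ g (H N - f) = inner ℂ h (H N - f) + inner ℂ (g - h) (H N - f) := by
      rw [inner_sub_left]; ring
    rw [e2]
    have e3 : ‖inner ℂ (g - h) (H N - f)‖ ≤ ‖g - h‖ * ‖H N - f‖ := norm_inner_le_norm _ _
    have e4 : ‖H N - f‖ ≤ C + ‖f‖ + 1 := by
      have := norm_sub_le (H N) f
      linarith [hHn N]
    rw [dist_eq_norm] at hgh
    have e5 : ‖g - h‖ * ‖H N - f‖ ≤ ε / 2 := by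
      calc ‖g - h‖ * ‖H N - f‖ ≤ (ε / (2 * (C + ‖f‖ + 1))) * (C + ‖f‖ + 1) := by gcongr
        _ = ε / 2 := by field_simp
    calc _ ≤ _ := norm_add_le _ _
      _ < ε := by linarith
  have hfb : ∀ g : Lp ℂ 2 (@AddCircle.haarAddCircle (2 * Real.pi) _),
      ‖inner ℂ g f‖ ≤ C * ∫ x, ‖g x‖ ∂AddCircle.haarAddCircle := by
    intro g
    refine le_of_tendsto (hweak g).norm (Eventually.of_forall fun N => ?_)
    rw [L2.inner_def, ← integral_const_mul]
    refine norm_integral_le_of_norm_le ?_ ?_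
    · exact (((Lp.memLp g).integrable (by norm_num)).norm).const_mul C
    · filter_upwards [hHae N] with x hx
      rw [hx]
      refine (norm_inner_le_norm _ _).trans ?_
      rw [mul_comm]
      gcongr
      exact hGC N x
  -- sup bound
  have hfae : ∀ᵐ x ∂(@AddCircle.haarAddCircle (2 * Real.pi) _), ‖f x‖ ≤ C := by
    exact sup_bound C f hC0 hfb
  have hfm : Measurable (fun x => f x) := (Lp.stronglyMeasurable f).measurable
  classical
  let f' : AddCircle (2 * Real.pi) → ℂ := fun x => if ‖f x‖ ≤ C then f x else 0
  have hf'm : Measurable f' :=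
    Measurable.ite (measurableSet_le hfm.norm measurable_const) hfm measurable_const
  have hf'ae : f' =ᵐ[AddCircle.haarAddCircle] f := by
    filter_upwards [hfae] with x hx
    simp [f', hx]
  refine ⟨fun t => f' (t : AddCircle (2 * Real.pi)), hf'm.comp (AddCircle.measurable_mk'), ?_, ?_, ?_⟩
  · intro t
    simp
  · refine Eventually.of_forall fun t => ?_
    simp only [f']
    split_ifs with h
    · exact h
    · simpa using hC0
  · intro n
    rw [← key f' n, ← hf n, fourierCoeff, fourierCoeff]
    apply integral_congr_ae
    filter_upwards [hf'ae] with x hx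
    rw [hx]

open Filter Topology

structure Ctx (E : Type*) [NormedAddCommGroup E] [NormedSpace ℂ E] where
  ι : E →ₗ[ℂ] (ℕ → ℂ)
  hι : Function.Injective ι
  e : ℕ → E
  he : ∀ k : ℕ, ι (e k) = Pi.single k 1
  hdense : Dense (Submodule.span ℂ (Set.range e) : Set E)
  hcoord : ∀ n : ℕ, Continuous fun x : E => ι x n
  γ : ℝ → E →L[ℂ] E
  hγ : ∀ t x n, ι (γ t x) n = Complex.exp ((n : ℂ) * Complex.I * t) * ι x n
  hγn : ∀ t x, ‖γ t x‖ = ‖x‖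

namespace Ctx

variable {E : Type*} [NormedAddCommGroup E] [NormedSpace ℂ E] (Q : Ctx E)

theorem gamma_e (t : ℝ) (k : ℕ) :
    Q.γ t (Q.e k) = Complex.exp ((k : ℂ) * Complex.I * t) • Q.e k := by
  apply Q.hι
  funext n
  rw [Q.hγ, map_smul, Q.he]
  by_cases h : n = k
  · subst h; simp
  · simp [Pi.single_eq_of_ne h]

noncomputable def X : (ℕ →₀ ℂ) →ₗ[ℂ] E := Finsupp.linearCombination ℂ Q.e

noncomputable def ez (j : ℤ) : E := if 0 ≤ j then Q.e j.toNat else 0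

noncomputable def sh (m : ℤ) : (ℕ →₀ ℂ) →ₗ[ℂ] E :=
  Finsupp.linearCombination ℂ (fun k : ℕ => Q.ez (k + m))

noncomputable def coef (j : ℤ) (x : E) : ℂ := if 0 ≤ j then Q.ι x j.toNat else 0

@[simp] theorem ez_nat (k : ℕ) : Q.ez k = Q.e k := by simp [ez]

theorem ez_neg {j : ℤ} (h : j < 0) : Q.ez j = 0 := by simp [ez, not_le.mpr h]

@[simp] theorem coef_nat (k : ℕ) (x : E) : Q.coef k x = Q.ι x k := by simp [coef]

theorem coef_neg {j : ℤ} (h : j < 0) (x : E) : Q.coef j x = 0 := by simp [coef, not_le.mpr h]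

theorem coef_add (j : ℤ) (x y : E) : Q.coef j (x + y) = Q.coef j x + Q.coef j y := by
  unfold coef; split_ifs <;> simp

theorem coef_smul (j : ℤ) (a : ℂ) (y : E) : Q.coef j (a • y) = a * Q.coef j y := by
  unfold coef; split_ifs <;> simp

theorem coef_zero (j : ℤ) : Q.coef j 0 = 0 := by
  unfold coef; split_ifs <;> simp

theorem coef_cont (j : ℤ) : Continuous (Q.coef j) := by
  unfold coef
  split_ifs
  · exact Q.hcoord _
  · exact continuous_const

theorem coef_e (j : ℤ) (k : ℕ) : Q.coef j (Q.e k) = if j = k then 1 else 0 := by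
  unfold coef
  rw [Q.he]
  split_ifs with h1 h2 h2
  · subst h2; simp
  · rw [Pi.single_eq_of_ne]; omega
  · omega
  · rfl

theorem coef_ez (n : ℕ) (j : ℤ) : Q.coef n (Q.ez j) = if (n : ℤ) = j then 1 else 0 := by
  rcases lt_or_ge j 0 with h | h
  · rw [ez_neg _ h, coef_zero, if_neg]; omega
  · obtain ⟨k, rfl⟩ := Int.eq_ofNat_of_zero_le h
    rw [ez_nat, coef_e]

theorem coef_ext {x y : E} (h : ∀ n : ℕ, Q.coef n x = Q.coef n y) : x = y := by
  apply Q.hι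
  funext n
  simpa using h n

@[simp] theorem X_single (k : ℕ) (a : ℂ) : Q.X (Finsupp.single k a) = a • Q.e k := by
  simp [X]

@[simp] theorem sh_single (m : ℤ) (k : ℕ) (a : ℂ) :
    Q.sh m (Finsupp.single k a) = a • Q.ez (k + m) := by
  simp [sh]

theorem sh_zero (c : ℕ →₀ ℂ) : Q.sh 0 c = Q.X c := by
  simp [sh, X]

theorem dense_X : DenseRange Q.X := by
  have := Q.hdense
  rw [← Finsupp.range_linearCombination] at this
  exact this

theorem dense_ind {p : E → Prop} (hp : IsClosed {x | p x}) (h : ∀ c, p (Q.X c)) (x : E) : p x :=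
  Q.dense_X.induction_on x hp h

theorem gamma_cont (x : E) : Continuous fun t => Q.γ t x := by
  refine continuous_of_uniform_approx_of_continuous fun u hu => ?_
  obtain ⟨ε, hε, hu⟩ := Metric.mem_uniformity_dist.mp hu
  obtain ⟨c, hc⟩ := Metric.denseRange_iff.mp Q.dense_X x ε hε
  refine ⟨fun t => Q.γ t (Q.X c), ?_, fun t => hu ?_⟩
  · clear hc
    induction c using Finsupp.induction_linear with
    | zero => simpa using continuous_const
    | add f g hf hg => simp only [map_add]; exact hf.add hg
    | single k a =>
      simp only [X_single, map_smul, gamma_e]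
      fun_prop
  · rw [dist_eq_norm, ← map_sub, Q.hγn, ← dist_eq_norm]; exact hc

theorem gamma_joint : Continuous fun p : ℝ × E => Q.γ p.1 p.2 := by
  rw [continuous_iff_continuousAt]
  rintro ⟨t, x⟩
  rw [ContinuousAt, tendsto_iff_norm_sub_tendsto_zero]
  have h1 : Tendsto (fun p : ℝ × E => ‖p.2 - x‖ + ‖Q.γ p.1 x - Q.γ t x‖) (𝓝 (t, x)) (𝓝 0) := by
    have : Continuous (fun p : ℝ × E => ‖p.2 - x‖ + ‖Q.γ p.1 x - Q.γ t x‖) := by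
      have := (Q.gamma_cont x).comp (continuous_fst (X := ℝ) (Y := E))
      simp only [Function.comp_def] at this
      fun_prop
    simpa using this.tendsto (t, x)
  refine squeeze_zero (fun _ => norm_nonneg _) (fun p => ?_) h1
  calc ‖Q.γ p.1 p.2 - Q.γ t x‖ = ‖Q.γ p.1 (p.2 - x) + (Q.γ p.1 x - Q.γ t x)‖ := by
        rw [map_sub]; congr 1; abel
    _ ≤ _ := (norm_add_le _ _).trans (by rw [Q.hγn])

theorem exp_int (m : ℤ) : ((1 / (2 * Real.pi) : ℝ) : ℂ) *
    (∫ t in (-Real.pi)..Real.pi, Complex.exp ((m : ℂ) * Complex.I * (t : ℂ))) =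
      if m = 0 then 1 else 0 := by
  have hpi : (Real.pi : ℂ) ≠ 0 := by exact_mod_cast Real.pi_ne_zero
  split_ifs with h
  · subst h
    simp
    field_simp
    norm_num
  · rw [integral_exp_mul_complex (by simp [h])]
    have : Complex.exp ((m : ℂ) * Complex.I * (Real.pi : ℝ)) =
        Complex.exp ((m : ℂ) * Complex.I * ((-Real.pi : ℝ) : ℂ)) := by
      rw [Complex.exp_eq_exp_iff_exists_int]
      refine ⟨m, ?_⟩
      push_cast; ring
    rw [this]; simp

theorem int_basic (y : E →L[ℂ] ℂ) (n : ℤ) (u : E) : ((1 / (2 * Real.pi) : ℝ) : ℂ) *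
    (∫ t in (-Real.pi)..Real.pi, y (Q.γ t u) * Complex.exp (-(n : ℂ) * Complex.I * (t : ℂ))) =
      Q.coef n u * y (Q.ez n) := by
  have hj := Q.gamma_joint
  have hcont : ∀ u, Continuous fun t : ℝ =>
      y (Q.γ t u) * Complex.exp (-(n : ℂ) * Complex.I * (t : ℂ)) := by
    intro u
    have := Q.gamma_cont u
    fun_prop
  refine Q.dense_ind (p := fun u => ((1 / (2 * Real.pi) : ℝ) : ℂ) *
    (∫ t in (-Real.pi)..Real.pi, y (Q.γ t u) * Complex.exp (-(n : ℂ) * Complex.I * (t : ℂ))) =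
      Q.coef n u * y (Q.ez n)) ?_ ?_ u
  · refine isClosed_eq (continuous_const.mul ?_) ((Q.coef_cont n).mul continuous_const)
    apply intervalIntegral.continuous_parametric_intervalIntegral_of_continuous'
    have h2 : Continuous fun p : E × ℝ => Q.γ p.2 p.1 := hj.comp continuous_swap
    simp only [Function.uncurry_def]
    fun_prop
  · intro c
    induction c using Finsupp.induction_linear with
    | zero => simp [coef_zero]
    | add f g hf hg =>
      simp only [map_add, add_mul, coef_add]
      rw [intervalIntegral.integral_add ((hcont _).intervalIntegrable _ _)
        ((hcont _).intervalIntegrable _ _), mul_add, hf, hg]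
    | single k a =>
      simp only [X_single, map_smul, gamma_e, coef_smul, coef_e, smul_eq_mul]
      have : ∀ t : ℝ, a * (Complex.exp ((k : ℂ) * Complex.I * t) * y (Q.e k)) *
          Complex.exp (-(n : ℂ) * Complex.I * (t : ℂ)) =
          (a * y (Q.e k)) * Complex.exp ((((k : ℤ) - n : ℤ) : ℂ) * Complex.I * t) := by
        intro t
        rw [show (((k : ℤ) - n : ℤ) : ℂ) * Complex.I * t =
          (k : ℂ) * Complex.I * t + -(n : ℂ) * Complex.I * (t : ℂ) by push_cast; ring,
          Complex.exp_add]
        ring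
      simp only [this]
      rw [intervalIntegral.integral_const_mul, mul_left_comm, exp_int]
      by_cases h : n = k
      · subst h; simp
      · rw [if_neg h, if_neg (by omega)]; simp

/-- Matrix Toeplitz condition with symbol `b`. -/
def Toep (B : E →L[ℂ] E) (b : ℤ → ℂ) : Prop :=
  ∀ k n : ℕ, Q.ι (B (Q.e k)) n = b ((n : ℤ) - k)

theorem F_cont (B : E →L[ℂ] E) (y : E →L[ℂ] ℂ) (x : E) :
    Continuous fun t : ℝ => y (Q.γ t (B (Q.γ (-t) x))) := by
  have h1 : Continuous fun t : ℝ => B (Q.γ (-t) x) :=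
    B.continuous.comp ((Q.gamma_cont x).comp continuous_neg)
  exact y.continuous.comp (Q.gamma_joint.comp (continuous_id.prodMk h1))

theorem F_bound (B : E →L[ℂ] E) (y : E →L[ℂ] ℂ) (x : E) (t : ℝ) :
    ‖y (Q.γ t (B (Q.γ (-t) x)))‖ ≤ ‖y‖ * (‖B‖ * ‖x‖) := by
  refine (y.le_opNorm _).trans ?_
  rw [Q.hγn]
  gcongr
  refine (B.le_opNorm _).trans ?_
  rw [Q.hγn]

theorem F_periodic (B : E →L[ℂ] E) (y : E →L[ℂ] ℂ) (x : E) :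
    Function.Periodic (fun t : ℝ => y (Q.γ t (B (Q.γ (-t) x)))) (2 * Real.pi) := by
  have h1 : ∀ t x, Q.γ (t + 2 * Real.pi) x = Q.γ t x := by
    intro t x
    apply Q.hι
    funext n
    rw [Q.hγ, Q.hγ]
    congr 1
    rw [Complex.exp_eq_exp_iff_exists_int]
    refine ⟨n, ?_⟩
    push_cast; ring
  have h2 : ∀ t x, Q.γ (-(t + 2 * Real.pi)) x = Q.γ (-t) x := by
    intro t x
    rw [← h1 (-(t + 2 * Real.pi))]
    congr 2; ring
  intro t
  simp only [h1, h2]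

theorem int_toep {B : E →L[ℂ] E} {b : ℤ → ℂ} (hB : Q.Toep B b) (y : E →L[ℂ] ℂ) (m : ℤ)
    (c : ℕ →₀ ℂ) : ((1 / (2 * Real.pi) : ℝ) : ℂ) *
    (∫ t in (-Real.pi)..Real.pi, y (Q.γ t (B (Q.γ (-t) (Q.X c)))) *
      Complex.exp (-(m : ℂ) * Complex.I * (t : ℂ))) = b m * y (Q.sh m c) := by
  have hcont : ∀ u, Continuous fun t : ℝ =>
      y (Q.γ t (B (Q.γ (-t) u))) * Complex.exp (-(m : ℂ) * Complex.I * (t : ℂ)) := by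
    intro u
    exact (Q.F_cont B y u).mul (by fun_prop)
  induction c using Finsupp.induction_linear with
  | zero => simp
  | add f g hf hg =>
    simp only [map_add, add_mul]
    rw [intervalIntegral.integral_add ((hcont _).intervalIntegrable _ _)
        ((hcont _).intervalIntegrable _ _), mul_add, hf, hg, mul_add]
  | single k a =>
    have : ∀ t : ℝ, y (Q.γ t (B (Q.γ (-t) (Q.X (Finsupp.single k a))))) *
        Complex.exp (-(m : ℂ) * Complex.I * (t : ℂ)) =
        a * (y (Q.γ t (B (Q.e k))) * Complex.exp (-((k + m : ℤ) : ℂ) * Complex.I * t)) := by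
      intro t
      simp only [X_single, map_smul, gamma_e, smul_eq_mul]
      rw [show -((k + m : ℤ) : ℂ) * Complex.I * t = (k : ℂ) * Complex.I * ((-t : ℝ) : ℂ) +
        -(m : ℂ) * Complex.I * (t : ℂ) by push_cast; ring, Complex.exp_add]
      ring
    simp only [this]
    rw [intervalIntegral.integral_const_mul, mul_left_comm, int_basic, sh_single, map_smul,
      smul_eq_mul]
    rcases lt_or_ge ((k : ℤ) + m) 0 with h | h
    · rw [ez_neg _ h]; simp
    · obtain ⟨n, hn⟩ := Int.eq_ofNat_of_zero_le h
      rw [hn, coef_nat, hB, ← hn]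
      rw [show (k : ℤ) + m - k = m by ring]
      ring

theorem toep_bound {B : E →L[ℂ] E} {b : ℤ → ℂ} (hB : Q.Toep B b) (m : ℤ) (c : ℕ →₀ ℂ) :
    ‖b m‖ * ‖Q.sh m c‖ ≤ ‖B‖ * ‖Q.X c‖ := by
  obtain ⟨y, hy1, hy2⟩ := exists_dual_vector'' ℂ (Q.sh m c)
  have h := Q.int_toep hB y m c
  rw [hy2] at h
  have h2 : ‖b m‖ * ‖Q.sh m c‖ = ‖b m * ((‖Q.sh m c‖ : ℝ) : ℂ)‖ := by simp
  have h3 : ‖∫ t in (-Real.pi)..Real.pi, y (Q.γ t (B (Q.γ (-t) (Q.X c)))) *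
      Complex.exp (-(m : ℂ) * Complex.I * (t : ℂ))‖ ≤
      (‖B‖ * ‖Q.X c‖) * |Real.pi - (-Real.pi)| := by
    apply intervalIntegral.norm_integral_le_of_norm_le_const
    intro t _
    rw [norm_mul]
    have : ‖Complex.exp (-(m : ℂ) * Complex.I * (t : ℂ))‖ = 1 := by
      rw [show -(m : ℂ) * Complex.I * (t : ℂ) = ((-m * t : ℝ) : ℂ) * Complex.I by push_cast; ring]
      exact Complex.norm_exp_ofReal_mul_I _
    rw [this, mul_one]
    refine (Q.F_bound B y _ t).trans ?_
    have : 0 ≤ ‖B‖ * ‖Q.X c‖ := by positivity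
    nlinarith
  rw [h2]
  have h' : b m * ((‖Q.sh m c‖ : ℝ) : ℂ) = _ := h.symm
  rw [h', norm_mul, Complex.norm_real, Real.norm_of_nonneg (by positivity)]
  have hpi := Real.pi_pos
  rw [show |Real.pi - (-Real.pi)| = 2 * Real.pi by rw [abs_of_pos] <;> linarith] at h3
  calc _ ≤ 1 / (2 * Real.pi) * (‖B‖ * ‖Q.X c‖ * (2 * Real.pi)) := by gcongr
    _ = _ := by field_simp


theorem clm_of_rel [CompleteSpace E] (G : Submodule ℂ (E × E)) (hG : IsClosed (G : Set (E × E)))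
    (h : ∀ x, ∃! u, (x, u) ∈ G) : ∃ A : E →L[ℂ] E, ∀ x, (x, A x) ∈ G := by
  choose f hf hu using h
  let g : E →ₗ[ℂ] E :=
    { toFun := f
      map_add' := fun x y => ((hu (x + y) (f x + f y)) (G.add_mem (hf x) (hf y))).symm
      map_smul' := fun a x => ((hu (a • x) (a • f x)) (G.smul_mem a (hf x))).symm }
  have hg : (g.graph : Set (E × E)) = G := by
    ext ⟨x, u⟩
    constructor
    · intro h
      have h' : u = f x := (LinearMap.mem_graph_iff _ _).mp h
      rw [h']; exact hf x
    · intro h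
      exact (LinearMap.mem_graph_iff _ _).mpr (hu x u h)
  exact ⟨⟨g, g.continuous_of_isClosed_graph (hg ▸ hG)⟩, hf⟩

/-- formal relation `(s - 𝐒^σ) v = x` -/
def rel (σ : ℤ) (s : ℝ) : Submodule ℂ (E × E) where
  carrier := {p | ∀ n : ℕ, s * Q.coef n p.2 - Q.coef (n - σ) p.2 = Q.coef n p.1}
  add_mem' := by
    intro p q hp hq n
    have h1 := hp n
    have h2 := hq n
    simp only [Prod.fst_add, Prod.snd_add, coef_add]
    linear_combination h1 + h2
  zero_mem' := by intro n; simp [coef_zero, -coef_nat]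
  smul_mem' := by
    intro a p hp n
    have h1 := hp n
    simp only [Prod.smul_fst, Prod.smul_snd, coef_smul]
    linear_combination a * h1

theorem mem_rel {σ : ℤ} {s : ℝ} {x v : E} : (x, v) ∈ Q.rel σ s ↔
    ∀ n : ℕ, s * Q.coef n v - Q.coef (n - σ) v = Q.coef n x := Iff.rfl

theorem rel_closed (σ : ℤ) (s : ℝ) : IsClosed (Q.rel σ s : Set (E × E)) := by
  have : (Q.rel σ s : Set (E × E)) = ⋂ n : ℕ, {p : E × E |
      s * Q.coef n p.2 - Q.coef (n - σ) p.2 = Q.coef n p.1} := by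
    ext p; simp only [Set.mem_iInter]; rfl
  rw [this]
  refine isClosed_iInter fun n => ?_
  have h1 := Q.coef_cont n
  have h2 := Q.coef_cont (n - σ)
  exact isClosed_eq (by fun_prop) (by fun_prop)

def Solv (σ : ℤ) (s : ℝ) : Prop := ∀ x, ∃! u, (x, u) ∈ Q.rel σ s

noncomputable def symb (σ : ℤ) (s : ℝ) (m : ℤ) : ℂ :=
  if 0 ≤ σ * m then ((s : ℂ)⁻¹) ^ ((σ * m).toNat + 1) else 0

theorem symb_one_rec {s : ℝ} (hs : 0 < s) (m : ℤ) :
    s * symb 1 s m - symb 1 s (m - 1) = if m = 0 then 1 else 0 := by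
  have hs' : (s : ℂ) ≠ 0 := by exact_mod_cast hs.ne'
  unfold symb
  rcases lt_trichotomy m 0 with h | h | h
  · rw [if_neg (by omega), if_neg (by omega), if_neg (by omega)]; simp
  · subst h; simp [hs']
  · rw [if_pos (by omega), if_pos (by omega), if_neg (by omega)]
    obtain ⟨j, rfl⟩ : ∃ j : ℕ, m = j + 1 := ⟨(m - 1).toNat, by omega⟩
    rw [show (1 * ((j : ℤ) + 1)).toNat = j + 1 by omega,
      show (1 * ((j : ℤ) + 1 - 1)).toNat = j by omega, pow_succ _ (j + 1)]
    field_simp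
    simp

theorem symb_neg_rec {s : ℝ} (hs : 0 < s) (m : ℤ) :
    (s : ℂ)⁻¹ * ((if m = 1 then 1 else 0) + symb (-1) s m) = symb (-1) s (m - 1) := by
  have hs' : (s : ℂ) ≠ 0 := by exact_mod_cast hs.ne'
  unfold symb
  rcases lt_trichotomy m 1 with h | h | h
  · rw [if_neg (by omega), if_pos (by omega), if_pos (by omega)]
    rw [show (-1 * (m - 1)).toNat = (-1 * m).toNat + 1 by omega]
    rw [zero_add, ← pow_succ']
  · subst h; simp
  · rw [if_neg (by omega), if_neg (by omega), if_neg (by omega)]; simp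

theorem solv_toep [CompleteSpace E] {σ : ℤ} (hσ : σ = 1 ∨ σ = -1) {s : ℝ} (hs : 0 < s)
    (h : Q.Solv σ s) : ∃ R : E →L[ℂ] E, Q.Toep R (symb σ s) := by
  obtain ⟨R, hR⟩ := clm_of_rel (Q.rel σ s) (Q.rel_closed σ s) h
  have hs' : (s : ℂ) ≠ 0 := by exact_mod_cast hs.ne'
  refine ⟨R, ?_⟩
  rcases hσ with rfl | rfl
  · intro k n
    have h1 := Q.mem_rel.mp (hR (Q.e k))
    induction n with
    | zero =>
      have h2 := h1 0
      have h3 := symb_one_rec hs ((0 : ℕ) - k)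
      rw [Q.coef_neg (j := ((0 : ℕ) : ℤ) - 1) (by norm_num), coef_e] at h2
      rw [coef_nat] at h2
      have h4 : symb 1 s ((0 : ℕ) - (k : ℤ) - 1) = 0 := by
        unfold symb; rw [if_neg]; omega
      rw [h4] at h3
      apply mul_left_cancel₀ hs'
      have h5 : (((0 : ℕ) : ℤ) = k) = (((0 : ℕ) : ℤ) - k = 0) := by
        apply propext; omega
      simp only [h5] at h2
      linear_combination h2 - h3
    | succ n ih =>
      have h2 := h1 (n + 1)
      have h3 := symb_one_rec hs ((n + 1 : ℕ) - k)
      rw [show ((n + 1 : ℕ) : ℤ) - 1 = n by push_cast; ring, coef_nat, coef_nat, ih, coef_e] at h2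
      rw [show ((n + 1 : ℕ) : ℤ) - k - 1 = n - k by push_cast; ring] at h3
      apply mul_left_cancel₀ hs'
      have h5 : (((n + 1 : ℕ) : ℤ) = k) = (((n + 1 : ℕ) : ℤ) - k = 0) := by
        apply propext; omega
      simp only [h5] at h2
      linear_combination h2 - h3
  · have key : ∀ k : ℕ, ∃ v, (Q.e k, v) ∈ Q.rel (-1) s ∧
        ∀ n : ℕ, Q.ι v n = symb (-1) s ((n : ℤ) - k) := by
      intro k
      induction k with
      | zero =>
        refine ⟨(s : ℂ)⁻¹ • Q.e 0, ?_, ?_⟩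
        · rw [mem_rel]
          intro n
          simp only [coef_smul, coef_e]
          rw [if_neg (show ¬ ((n : ℤ) - -1 = (0 : ℕ)) by omega)]
          field_simp; simp
        · intro n
          rw [← coef_nat, coef_smul, coef_e]
          unfold symb
          rcases n with _ | n
          · simp
          · rw [if_neg (by omega), if_neg (by omega)]; simp
      | succ k ih =>
        obtain ⟨v, hv1, hv2⟩ := ih
        refine ⟨(s : ℂ)⁻¹ • (Q.e (k + 1) + v), ?_, ?_⟩
        · rw [mem_rel] at hv1 ⊢
          intro n
          have := hv1 n
          simp only [coef_smul, coef_e, coef_add] at this ⊢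
          simp only [show (((n : ℤ) - -1 = (k + 1 : ℕ)) = ((n : ℤ) = k)) by apply propext; omega]
          field_simp
          linear_combination this
        · intro n
          rw [← coef_nat, coef_smul, coef_add, coef_e, coef_nat, hv2]
          have := symb_neg_rec hs ((n : ℤ) - k)
          rw [show ((n : ℤ) - (k + 1 : ℕ)) = n - k - 1 by push_cast; ring, ← this]
          simp only [show (((n : ℤ) = (k + 1 : ℕ)) = ((n : ℤ) - k = 1)) by apply propext; omega]
    intro k n
    obtain ⟨v, hv1, hv2⟩ := key k
    rw [(h (Q.e k)).unique (hR (Q.e k)) hv1, hv2]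

theorem solv_bound [CompleteSpace E] {σ : ℤ} (hσ : σ = 1 ∨ σ = -1) {s : ℝ} (hs : 0 < s)
    (h : Q.Solv σ s) : ∃ C, 0 ≤ C ∧ ∀ (j : ℕ) c, ‖Q.sh (σ * j) c‖ ≤ C * s ^ (j + 1) * ‖Q.X c‖ := by
  obtain ⟨R, hR⟩ := Q.solv_toep hσ hs h
  refine ⟨‖R‖, norm_nonneg _, fun j c => ?_⟩
  have h1 := Q.toep_bound hR (σ * j) c
  have h2 : ‖symb σ s (σ * j)‖ = (s ^ (j + 1))⁻¹ := by
    unfold symb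
    have : σ * (σ * j) = j := by rcases hσ with rfl | rfl <;> ring
    rw [this, if_pos (by omega)]
    simp [abs_of_pos hs]
  rw [h2, inv_mul_le_iff₀ (by positivity)] at h1
  calc _ ≤ _ := h1
    _ = _ := by ring

/-- `A` is the shift of degree σ. -/
def IsSh (σ : ℤ) (A : E →L[ℂ] E) : Prop := ∀ k : ℕ, A (Q.e k) = Q.ez (k + σ)

variable {Q}

theorem IsSh.X {σ : ℤ} {A : E →L[ℂ] E} (h : Q.IsSh σ A) (c : ℕ →₀ ℂ) : A (Q.X c) = Q.sh σ c := by
  induction c using Finsupp.induction_linear with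
  | zero => simp
  | add f g hf hg => simp only [map_add, hf, hg]
  | single k a => simp [h k]

theorem IsSh.ez {σ : ℤ} {A : E →L[ℂ] E} (h : Q.IsSh σ A)
    {j : ℤ} (hj : σ = -1 ∨ 0 ≤ j) : A (Q.ez j) = Q.ez (j + σ) := by
  rcases lt_or_ge j 0 with h0 | h0
  · rw [Q.ez_neg h0, Q.ez_neg (by omega), map_zero]
  · obtain ⟨k, rfl⟩ := Int.eq_ofNat_of_zero_le h0
    rw [Q.ez_nat, h k]

theorem IsSh.pow_ez {σ : ℤ} (hσ : σ = 1 ∨ σ = -1) {A : E →L[ℂ] E} (h : Q.IsSh σ A)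
    {j : ℤ} (hj : σ = -1 ∨ 0 ≤ j) (i : ℕ) : (A ^ i) (Q.ez j) = Q.ez (j + σ * i) := by
  induction i with
  | zero => simp
  | succ i ih =>
    rw [pow_succ', mul_apply_eq_comp, ih, h.ez]
    · congr 1; push_cast; ring
    · rcases hσ with rfl | rfl
      · right; omega
      · left; rfl

theorem IsSh.pow_X {σ : ℤ} (hσ : σ = 1 ∨ σ = -1) {A : E →L[ℂ] E} (h : Q.IsSh σ A)
    (i : ℕ) (c : ℕ →₀ ℂ) : (A ^ i) (Q.X c) = Q.sh (σ * i) c := by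
  induction c using Finsupp.induction_linear with
  | zero => simp
  | add f g hf hg => simp only [map_add, hf, hg]
  | single k a =>
    rw [Q.X_single, Q.sh_single, map_smul, ← Q.ez_nat, h.pow_ez hσ (by right; omega)]

theorem IsSh.coef {σ : ℤ} {A : E →L[ℂ] E} (h : Q.IsSh σ A) (n : ℕ) (x : E) :
    Q.coef n (A x) = Q.coef (n - σ) x := by
  refine Q.dense_ind (p := fun x => Q.coef n (A x) = Q.coef (n - σ) x) ?_ ?_ x
  · exact isClosed_eq ((Q.coef_cont _).comp A.continuous) (Q.coef_cont _)
  · intro c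
    induction c using Finsupp.induction_linear with
    | zero => simp [coef_zero, -coef_nat]
    | add f g hf hg => simp only [map_add, coef_add, hf, hg]
    | single k a =>
      rw [Q.X_single, map_smul, coef_smul, h k, coef_ez, coef_smul, coef_e]
      congr 1
      have : ((n : ℤ) = k + σ) = ((n : ℤ) - σ = k) := by apply propext; omega
      simp only [this]

theorem IsSh.of_coef {σ : ℤ} {A : E →L[ℂ] E}
    (h : ∀ (n : ℕ) x, Q.coef n (A x) = Q.coef (n - σ) x) : Q.IsSh σ A := by
  intro k
  apply Q.coef_ext
  intro n
  rw [h, coef_e, coef_ez]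
  have : ((n : ℤ) = k + σ) = ((n : ℤ) - σ = k) := by apply propext; omega
  simp only [this]

theorem IsSh.mem_rel {σ : ℤ} {A : E →L[ℂ] E} (h : Q.IsSh σ A) {s : ℝ} {x v : E} :
    (x, v) ∈ Q.rel σ s ↔ (algebraMap ℂ (E →L[ℂ] E) s - A) v = x := by
  rw [Q.mem_rel]
  have : ∀ n : ℕ, Q.coef n ((algebraMap ℂ (E →L[ℂ] E) s - A) v) =
      s * Q.coef n v - Q.coef (n - σ) v := by
    intro n
    rw [← h.coef, Algebra.algebraMap_eq_smul_one]
    simp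
  constructor
  · intro h'
    apply Q.coef_ext
    intro n
    rw [this, h']
  · rintro rfl n
    rw [this]

theorem IsSh.solv_iff [CompleteSpace E] {σ : ℤ} {A : E →L[ℂ] E} (h : Q.IsSh σ A) {s : ℝ} :
    Q.Solv σ s ↔ IsUnit (algebraMap ℂ (E →L[ℂ] E) s - A) := by
  rw [ContinuousLinearMap.isUnit_iff_bijective, Function.bijective_iff_existsUnique]
  simp only [Solv, h.mem_rel]

theorem solv_isSh [CompleteSpace E] {σ : ℤ} (hσ : σ = 1 ∨ σ = -1) {s : ℝ} (hs : 0 < s)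
    (h : Q.Solv σ s) : ∃ A : E →L[ℂ] E, Q.IsSh σ A := by
  obtain ⟨C, hC0, hC⟩ := Q.solv_bound hσ hs h
  refine ⟨(Q.sh σ).extendOfNorm Q.X, fun k => ?_⟩
  have := LinearMap.extendOfNorm_eq (f := Q.sh σ) Q.dense_X
    ⟨C * s ^ (1 + 1), fun c => by simpa using hC 1 c⟩ (Finsupp.single k 1)
  simpa using this

theorem solv_rad [CompleteSpace E] {σ : ℤ} (hσ : σ = 1 ∨ σ = -1) {s : ℝ} (hs : 0 < s)
    (h : Q.Solv σ s) : ∃ A : E →L[ℂ] E, Q.IsSh σ A ∧ ∃ s', 0 < s' ∧ s' < s ∧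
      ∀ l ∈ spectrum ℂ A, ‖l‖ ≤ s' := by
  obtain ⟨A, hA⟩ := solv_isSh hσ hs h
  refine ⟨A, hA, ?_⟩
  have hopen : IsOpen {t : ℝ | IsUnit (algebraMap ℂ (E →L[ℂ] E) t - A)} := by
    refine Units.isOpen.preimage (f := fun t : ℝ => algebraMap ℂ (E →L[ℂ] E) t - A) ?_
    have : Continuous fun t : ℝ => algebraMap ℂ (E →L[ℂ] E) t :=
      (algebraMapCLM ℂ (E →L[ℂ] E)).continuous.comp Complex.continuous_ofReal
    exact this.sub continuous_const
  have hmem : s ∈ {t : ℝ | IsUnit (algebraMap ℂ (E →L[ℂ] E) t - A)} := hA.solv_iff.mp h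
  obtain ⟨ε, hε, hball⟩ := Metric.isOpen_iff.mp hopen s hmem
  let s' := s - min (ε / 2) (s / 2)
  have hm : 0 < min (ε / 2) (s / 2) := by positivity
  have hs'0 : 0 < s' := by
    have := min_le_right (ε / 2) (s / 2)
    simp only [s']; linarith
  refine ⟨s', hs'0, by simp only [s']; linarith, ?_⟩
  have hs' : Q.Solv σ s' := by
    rw [hA.solv_iff]
    apply hball
    rw [Metric.mem_ball, Real.dist_eq]
    have := min_le_left (ε / 2) (s / 2)
    simp only [s', sub_sub_cancel_left, abs_neg, abs_of_pos hm]
    linarith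
  obtain ⟨C, hC0, hC⟩ := Q.solv_bound hσ hs'0 hs'
  have hpow : ∀ j : ℕ, ‖A ^ j‖ ≤ C * s' ^ (j + 1) := by
    intro j
    refine ContinuousLinearMap.opNorm_le_bound _ (by positivity) fun x => ?_
    refine Q.dense_ind (p := fun x => ‖(A ^ j) x‖ ≤ C * s' ^ (j + 1) * ‖x‖) ?_ ?_ x
    · exact isClosed_le (by fun_prop) (by fun_prop)
    · intro c
      rw [hA.pow_X hσ]; exact hC j c
  intro l hl
  by_contra hcon
  push Not at hcon
  have h1 : ∀ j : ℕ, (‖l‖ / s') ^ j ≤ C * s' := by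
    intro j
    have h2 := spectrum.norm_le_norm_mul_of_mem (spectrum.pow_mem_pow A j hl)
    have h3 : ‖(1 : E →L[ℂ] E)‖ ≤ 1 := ContinuousLinearMap.norm_id_le
    rw [norm_pow] at h2
    rw [div_pow, div_le_iff₀ (by positivity)]
    calc _ ≤ _ := h2
      _ ≤ ‖A ^ j‖ * 1 := by gcongr
      _ ≤ C * s' ^ (j + 1) := by rw [mul_one]; exact hpow j
      _ = _ := by ring
  have h4 := tendsto_pow_atTop_atTop_of_one_lt (r := ‖l‖ / s') (by rwa [one_lt_div hs'0])
  obtain ⟨j, hj⟩ := (h4.eventually_gt_atTop (C * s')).exists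
  exact absurd (h1 j) (not_le.mpr hj)

theorem pRad_le [CompleteSpace E] {σ : ℤ} {A : E →L[ℂ] E} (hA : Q.IsSh σ A) (A0 : E →ₗ.[ℂ] E)
    (hdom : A0.domain = Submodule.span ℂ (Set.range Q.e))
    (hA0 : ∀ x : A0.domain, ∀ n : ℕ, Q.coef n (A0 x) = Q.coef (n - σ) (x : E))
    {s : ℝ} (hs : ∀ l ∈ spectrum ℂ A, ‖l‖ ≤ s) : pRad A0.closure ≤ ENNReal.ofReal s := by
  have heq : ∀ x : A0.domain, A0 x = A x := by
    intro x
    apply Q.coef_ext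
    intro n
    rw [hA0, hA.coef]
  have hcg : IsClosed {p : E × E | p.2 = A p.1} :=
    isClosed_eq continuous_snd (A.continuous.comp continuous_fst)
  have hsub : (A0.graph : Set (E × E)) ⊆ {p : E × E | p.2 = A p.1} := by
    rintro ⟨x, y⟩ hp
    obtain ⟨z, hz1, hz2⟩ := (LinearPMap.mem_graph_iff _).mp hp
    simp only at hz1 hz2
    change y = A x
    rw [← hz2, heq, hz1]
  have hgr : A0.graph.topologicalClosure = (A : E →ₗ[ℂ] E).graph := by
    apply le_antisymm
    · intro p hp
      have := closure_minimal hsub hcg hp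
      exact (LinearMap.mem_graph_iff _ _).mpr this
    · rintro ⟨x, y⟩ hp
      have hy : y = A x := (LinearMap.mem_graph_iff _ _).mp hp
      subst hy
      refine Q.dense_ind (p := fun x => (x, A x) ∈ A0.graph.topologicalClosure) ?_ ?_ x
      · exact (A0.graph.isClosed_topologicalClosure).preimage
          (continuous_id.prodMk A.continuous)
      · intro c
        apply A0.graph.le_topologicalClosure
        have hc : Q.X c ∈ A0.domain := by
          rw [hdom, ← Finsupp.range_linearCombination]
          exact LinearMap.mem_range_self _ _
        rw [← heq ⟨Q.X c, hc⟩]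
        exact A0.mem_graph ⟨Q.X c, hc⟩
  have hcl : A0.IsClosable := by
    refine ⟨(A : E →ₗ[ℂ] E).toPMap ⊤, ?_⟩
    rw [hgr]
    ext ⟨x, y⟩
    simp [LinearMap.mem_graph_iff, LinearPMap.mem_graph_iff, eq_comm]
  have hgr2 : A0.closure.graph = (A : E →ₗ[ℂ] E).graph := by
    rw [← hcl.graph_closure_eq_closure_graph, hgr]
  have hmem : ∀ x, x ∈ A0.closure.domain := by
    intro x
    have : (x, A x) ∈ A0.closure.graph := by
      rw [hgr2]; exact (LinearMap.mem_graph_iff _ _).mpr rfl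
    exact LinearPMap.mem_domain_of_mem_graph this
  have hval : ∀ x : A0.closure.domain, A0.closure x = A x := by
    intro x
    have := A0.closure.mem_graph x
    rw [hgr2] at this
    exact (LinearMap.mem_graph_iff _ _).mp this
  unfold pRad
  refine iSup₂_le fun l hl => ?_
  have hl' : l ∈ spectrum ℂ A := by
    intro hu
    apply hl
    have hu' : IsUnit (A - algebraMap ℂ (E →L[ℂ] E) l) := by
      rw [← neg_sub]; exact hu.neg
    rw [ContinuousLinearMap.isUnit_iff_bijective] at hu'
    have hap : ∀ x, (A - algebraMap ℂ (E →L[ℂ] E) l) x = A x - l • x := by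
      intro x; rw [Algebra.algebraMap_eq_smul_one]; simp
    constructor
    · intro x y hxy
      simp only [hval] at hxy
      rw [← hap, ← hap] at hxy
      exact Subtype.ext (hu'.1 hxy)
    · intro y
      obtain ⟨x, hx⟩ := hu'.2 y
      refine ⟨⟨x, hmem x⟩, ?_⟩
      simp only [hval]
      rw [← hap]; exact hx
  have := hs l hl'
  rw [← enorm_eq_nnnorm, ← ofReal_norm]
  exact ENNReal.ofReal_le_ofReal this

theorem surj_of_dual [CompleteSpace E] (D : E →L[ℂ] E) (δ : ℝ) (hδ : 0 < δ)
    (h : ∀ y : E →L[ℂ] ℂ, δ * ‖y‖ ≤ ‖y.comp D‖) : Function.Surjective D := by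
  have step : ∀ x : E, ∃ a : E, ‖a‖ ≤ δ⁻¹ * ‖x‖ ∧ ‖x - D a‖ ≤ 1 / 2 * ‖x‖ := by
    intro x
    rcases eq_or_ne x 0 with rfl | hx
    · exact ⟨0, by simp⟩
    have hxp : 0 < ‖x‖ := norm_pos_iff.mpr hx
    set ρ := δ⁻¹ * ‖x‖ with hρ
    have hρp : 0 < ρ := by positivity
    have hmem : x ∈ closure (D '' Metric.closedBall 0 ρ) := by
      by_contra hcon
      have hconv : Convex ℝ (closure (D '' Metric.closedBall 0 ρ)) :=
        ((convex_closedBall (0 : E) ρ).is_linear_image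
          (D.restrictScalars ℝ).toLinearMap.isLinear).closure
      obtain ⟨f, u, hfu, hux⟩ := RCLike.geometric_hahn_banach_closed_point (𝕜 := ℂ)
        hconv isClosed_closure hcon
      have h1 : ∀ a, ‖a‖ ≤ ρ → ‖f (D a)‖ ≤ u := by
        intro a ha
        rcases eq_or_ne (f (D a)) 0 with h0 | h0
        · rw [h0, norm_zero]
          have := hfu (D 0) (subset_closure ⟨0, by simp [hρp.le], rfl⟩)
          simp at this
          exact this.le
        · let w : ℂ := (starRingEnd ℂ) (f (D a)) / ‖f (D a)‖
          have hn : (‖f (D a)‖ : ℂ) ≠ 0 := by exact_mod_cast (norm_ne_zero_iff.mpr h0)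
          have hw : ‖w‖ = 1 := by
            simp [w, h0]
          have := hfu (D (w • a)) (subset_closure ⟨w • a, by simp [norm_smul, hw, ha], rfl⟩)
          rw [map_smul, map_smul, smul_eq_mul] at this
          have h2 : w * f (D a) = (‖f (D a)‖ : ℂ) := by
            simp only [w]
            rw [div_mul_eq_mul_div, mul_comm, Complex.mul_conj, Complex.normSq_eq_norm_sq]
            field_simp
            norm_cast
          rw [h2] at this
          simpa using this.le
      have hu0 : 0 ≤ u := (norm_nonneg _).trans (h1 0 (by simp [hρp.le]))
      have h3 : ‖f.comp D‖ ≤ u / ρ := by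
        refine ContinuousLinearMap.opNorm_le_bound _ (by positivity) fun z => ?_
        rcases eq_or_ne z 0 with rfl | hz
        · simp
        have hzp : 0 < ‖z‖ := norm_pos_iff.mpr hz
        have h4 := h1 (((ρ / ‖z‖ : ℝ) : ℂ) • z) (by
          rw [norm_smul, Complex.norm_real, Real.norm_of_nonneg (by positivity)]
          field_simp; rfl)
        rw [map_smul, map_smul, norm_smul, Complex.norm_real,
          Real.norm_of_nonneg (by positivity)] at h4
        rw [ContinuousLinearMap.comp_apply, div_mul_eq_mul_div, le_div_iff₀ hρp]
        rw [div_mul_eq_mul_div, div_le_iff₀ hzp] at h4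
        linarith
      have h5 := (h f).trans h3
      rw [le_div_iff₀ hρp] at h5
      have h6 : RCLike.re (f x) ≤ ‖f‖ * ‖x‖ := (RCLike.re_le_norm _).trans (f.le_opNorm x)
      have h7 : δ * ‖f‖ * ρ = ‖f‖ * ‖x‖ := by rw [hρ]; field_simp
      linarith
    obtain ⟨_, ⟨a, ha, rfl⟩, hd⟩ := Metric.mem_closure_iff.mp hmem (1 / 2 * ‖x‖) (by positivity)
    exact ⟨a, by simpa using ha, by rw [← dist_eq_norm]; exact hd.le⟩
  choose g hg1 hg2 using step
  intro x
  let q : ℕ → E := fun n => (fun z => z - D (g z))^[n] x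
  have hq0 : q 0 = x := rfl
  have hq : ∀ n, q (n + 1) = q n - D (g (q n)) := fun n => Function.iterate_succ_apply' _ _ _
  have hqn : ∀ n, ‖q n‖ ≤ (1 / 2) ^ n * ‖x‖ := by
    intro n
    induction n with
    | zero => simp [hq0]
    | succ n ih =>
      rw [hq]
      refine (hg2 _).trans ?_
      rw [pow_succ]; nlinarith
  have hsum : Summable fun n => g (q n) := by
    refine Summable.of_norm_bounded (g := fun n => δ⁻¹ * ‖x‖ * (1 / 2 : ℝ) ^ n)
      ((summable_geometric_of_lt_one (by norm_num) (by norm_num)).mul_left _) fun n => ?_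
    refine (hg1 _).trans ?_
    have := hqn n
    calc δ⁻¹ * ‖q n‖ ≤ δ⁻¹ * ((1 / 2) ^ n * ‖x‖) := by gcongr
      _ = _ := by ring
  refine ⟨∑' n, g (q n), ?_⟩
  have h1 : Tendsto (fun n => ∑ i ∈ Finset.range n, g (q i)) atTop (𝓝 (∑' n, g (q n))) :=
    hsum.hasSum.tendsto_sum_nat
  have h2 := (D.continuous.tendsto _).comp h1
  have h3 : ∀ n, D (∑ i ∈ Finset.range n, g (q i)) = x - q n := by
    intro n
    induction n with
    | zero => simp [hq0]
    | succ n ih => rw [Finset.sum_range_succ, map_add, ih, hq]; abel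
  have h4 : Tendsto q atTop (𝓝 0) := by
    refine squeeze_zero_norm hqn ?_
    have := (tendsto_pow_atTop_nhds_zero_of_lt_one (r := (1 / 2 : ℝ)) (by norm_num)
      (by norm_num)).mul_const ‖x‖
    simpa using this
  have h5 : Tendsto (fun n => x - q n) atTop (𝓝 x) := by
    simpa using (tendsto_const_nhds (x := x)).sub h4
  refine tendsto_nhds_unique h2 (h5.congr fun n => (h3 n).symm)

variable (Q) in
def Approx (r : ℝ) : Prop := ∀ K : ℕ, ∃ (c : ℕ → ℕ →₀ ℂ) (y : ℕ → E →L[ℂ] ℂ),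
  (∀ N, ‖y N‖ * ‖Q.X (c N)‖ ≤ 1) ∧
  ∀ m : ℤ, |m| ≤ K → Tendsto (fun N => y N (Q.sh m (c N))) atTop (𝓝 ((r : ℂ) ^ m))

theorem approx_final {r : ℝ} (h : Q.Approx r) {T : E →L[ℂ] E} {Th : ℤ → ℂ} (hT : Q.Toep T Th) :
    ∃ ν : ℝ → ℂ, Measurable ν ∧ Function.Periodic ν (2 * Real.pi) ∧
      (∀ᵐ t : ℝ, ‖ν t‖ ≤ ‖T‖) ∧
      ∀ n : ℤ, ((1 / (2 * Real.pi) : ℝ) : ℂ) *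
          (∫ t in (-Real.pi)..Real.pi, ν t * Complex.exp (-(n : ℂ) * Complex.I * (t : ℂ)))
        = Th n * (r : ℂ) ^ n := by
  have h1 : ∀ K : ℕ, ∃ (c : ℕ →₀ ℂ) (y : E →L[ℂ] ℂ), ‖y‖ * ‖Q.X c‖ ≤ 1 ∧
      ∀ m : ℤ, |m| ≤ K → dist (y (Q.sh m c)) ((r : ℂ) ^ m) < 1 / ((K : ℝ) + 1) := by
    intro K
    obtain ⟨c, y, hy, hlim⟩ := h K
    have : ∀ᶠ N in atTop, ∀ m ∈ Finset.Icc (-(K : ℤ)) K,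
        dist (y N (Q.sh m (c N))) ((r : ℂ) ^ m) < 1 / ((K : ℝ) + 1) := by
      rw [Filter.eventually_all_finset]
      intro m hm
      rw [Finset.mem_Icc] at hm
      exact (Metric.tendsto_nhds.mp (hlim m (abs_le.mpr hm))) _ (by positivity)
    obtain ⟨N, hN⟩ := this.exists
    exact ⟨c N, y N, hy N, fun m hm => hN m (Finset.mem_Icc.mpr (abs_le.mp hm))⟩
  choose c y hy hd using h1
  refine fourier_limit ‖T‖ (fun n => Th n * (r : ℂ) ^ n)
    (fun N t => y N (Q.γ t (T (Q.γ (-t) (Q.X (c N)))))) (fun N => Q.F_cont T _ _)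
    (fun N => Q.F_periodic T _ _) (fun N t => (Q.F_bound T _ _ t).trans ?_) (fun m => ?_)
  · have := hy N
    nlinarith [norm_nonneg T]
  · simp only [Q.int_toep hT]
    refine Tendsto.const_mul _ ?_
    rw [tendsto_iff_dist_tendsto_zero]
    refine squeeze_zero' (Eventually.of_forall fun _ => dist_nonneg) ?_
      (tendsto_one_div_add_atTop_nhds_zero_nat (𝕜 := ℝ))
    filter_upwards [eventually_ge_atTop m.natAbs] with N hN
    exact (hd N m (by rw [abs_le]; omega)).le

theorem pow_approx {V : Type*} [NormedAddCommGroup V] [NormedSpace ℂ V] (D : V →L[ℂ] V)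
    (s : ℂ) (x : ℕ → V) (h : Tendsto (fun N => D (x N) - s • x N) atTop (𝓝 0)) (j : ℕ) :
    Tendsto (fun N => (D ^ j) (x N) - s ^ j • x N) atTop (𝓝 0) := by
  induction j with
  | zero => simp
  | succ j ih =>
    have h1 := ((D.continuous.tendsto _).comp ih).add (h.const_smul (s ^ j))
    simp only [map_zero, smul_zero, add_zero] at h1
    refine h1.congr fun N => ?_
    simp only [Function.comp_apply, map_sub, map_smul, pow_succ' D, mul_apply_eq_comp]
    rw [smul_sub, smul_smul, ← pow_succ]
    abel

theorem pow_approx_norm {V : Type*} [NormedAddCommGroup V] [NormedSpace ℂ V] (D : V →L[ℂ] V)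
    {s : ℝ} (hs : 0 < s) (x : ℕ → V) (hx : ∀ N, ‖x N‖ = 1)
    (h : Tendsto (fun N => D (x N) - (s : ℂ) • x N) atTop (𝓝 0)) (j : ℕ) :
    Tendsto (fun N => ‖(D ^ j) (x N)‖) atTop (𝓝 (s ^ j)) := by
  have h1 := pow_approx D s x h j
  rw [tendsto_iff_norm_sub_tendsto_zero]
  refine squeeze_zero (fun _ => norm_nonneg _) (fun N => ?_) (tendsto_zero_iff_norm_tendsto_zero.mp h1)
  have : s ^ j = ‖(s : ℂ) ^ j • x N‖ := by
    rw [norm_smul, hx, norm_pow, Complex.norm_real, Real.norm_of_nonneg hs.le, mul_one]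
  rw [this]
  exact abs_norm_sub_norm_le _ _

/-- from sequence of unit vectors which are approximate eigenvectors -/
theorem approx_seq {V : Type*} [NormedAddCommGroup V] [NormedSpace ℂ V] (D : V →L[ℂ] V)
    (s : ℝ) (h : ¬ ∃ δ > 0, ∀ x, δ * ‖x‖ ≤ ‖D x - (s : ℂ) • x‖) (η : ℝ) (hη : 0 < η) :
    ∃ x, ‖D x - (s : ℂ) • x‖ < η * ‖x‖ := by
  push Not at h
  exact h η hη

theorem approx_unit {V : Type*} [NormedAddCommGroup V] [NormedSpace ℂ V] (D : V →L[ℂ] V)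
    (s : ℝ) (h : ¬ ∃ δ > 0, ∀ x, δ * ‖x‖ ≤ ‖D x - (s : ℂ) • x‖) (η : ℝ) (hη : 0 < η) :
    ∃ x, ‖x‖ = 1 ∧ ‖D x - (s : ℂ) • x‖ ≤ η := by
  obtain ⟨y, hy⟩ := approx_seq D s h _ hη
  have hp : 0 < ‖y‖ := by
    by_contra hcon
    have := (norm_nonneg _).trans_lt hy
    nlinarith
  refine ⟨((‖y‖⁻¹ : ℝ) : ℂ) • y, ?_, ?_⟩
  · rw [norm_smul, Complex.norm_real, norm_inv, norm_norm, inv_mul_cancel₀ hp.ne']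
  · rw [map_smul, smul_comm, ← smul_sub, norm_smul, Complex.norm_real, norm_inv,
      norm_norm, inv_mul_le_iff₀ hp, mul_comm]
    exact hy.le

theorem case1a {r : ℝ} (hr : 0 < r) {S : E →L[ℂ] E} (hS : Q.IsSh 1 S)
    (h : ¬ ∃ δ > 0, ∀ x, δ * ‖x‖ ≤ ‖S x - (r : ℂ) • x‖) : Q.Approx r := by
  have h1 : ∀ N : ℕ, ∃ c, ‖Q.X c‖ = 1 ∧ ‖S (Q.X c) - (r : ℂ) • Q.X c‖ ≤ 1 / ((N : ℝ) + 1) := by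
    intro N
    have hN : 0 < 1 / ((N : ℝ) + 1) := by positivity
    obtain ⟨x, hx⟩ := approx_seq S r h _ hN
    have hopen : IsOpen {x | ‖S x - (r : ℂ) • x‖ < 1 / ((N : ℝ) + 1) * ‖x‖} :=
      isOpen_lt (by fun_prop) (by fun_prop)
    obtain ⟨c, hc⟩ := Q.dense_X.exists_mem_open hopen ⟨x, hx⟩
    have hc' : ‖S (Q.X c) - (r : ℂ) • Q.X c‖ < 1 / ((N : ℝ) + 1) * ‖Q.X c‖ := hc
    have hp : 0 < ‖Q.X c‖ := by
      by_contra hcon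
      have := (norm_nonneg _).trans_lt hc'
      nlinarith
    refine ⟨((‖Q.X c‖⁻¹ : ℝ) : ℂ) • c, ?_, ?_⟩
    · rw [map_smul, norm_smul, Complex.norm_real, norm_inv, norm_norm, inv_mul_cancel₀ hp.ne']
    · rw [map_smul, map_smul, smul_comm, ← smul_sub, norm_smul, Complex.norm_real, norm_inv,
        norm_norm, inv_mul_le_iff₀ hp, mul_comm]
      exact hc'.le
  choose c hc1 hc2 using h1
  have hlim : Tendsto (fun N => S (Q.X (c N)) - (r : ℂ) • Q.X (c N)) atTop (𝓝 0) :=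
    squeeze_zero_norm hc2 (tendsto_one_div_add_atTop_nhds_zero_nat (𝕜 := ℝ))
  have hy : ∀ N, ∃ y : E →L[ℂ] ℂ, ‖y‖ ≤ 1 ∧ y (Q.X (c N)) = 1 := by
    intro N
    obtain ⟨y, hy1, hy2⟩ := exists_dual_vector'' ℂ (Q.X (c N))
    exact ⟨y, hy1, by rw [hy2, hc1]; simp⟩
  choose y hy1 hy2 using hy
  intro K
  have hn := pow_approx_norm S hr _ hc1 hlim K
  have hsh : ∀ N (m : ℤ), |m| ≤ K → Q.sh m ((c N).mapDomain (· + K)) =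
      (S ^ (K + m).toNat) (Q.X (c N)) := by
    intro N m hm
    rw [hS.pow_X (Or.inl rfl)]
    have := abs_le.mp hm
    unfold sh
    rw [Finsupp.linearCombination_mapDomain]
    congr 2
    funext k
    simp only [Function.comp_apply]
    congr 1
    push_cast
    omega
  have hX : ∀ N, Q.X ((c N).mapDomain (· + K)) = (S ^ K) (Q.X (c N)) := by
    intro N
    rw [← Q.sh_zero, hsh N 0 (by simp)]
    simp
  refine ⟨fun N => (c N).mapDomain (· + K),
    fun N => ((‖(S ^ K) (Q.X (c N))‖⁻¹ : ℝ) : ℂ) • y N, fun N => ?_, fun m hm => ?_⟩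
  · rw [hX, norm_smul, Complex.norm_real, norm_inv, norm_norm]
    calc _ ≤ ‖(S ^ K) (Q.X (c N))‖⁻¹ * 1 * ‖(S ^ K) (Q.X (c N))‖ := by gcongr; exact hy1 N
      _ ≤ 1 := by rw [mul_one]; exact inv_mul_le_one
  · have hm' := abs_le.mp hm
    simp only [hsh _ m hm]
    set j := (K + m).toNat with hj
    have h2 := pow_approx S (r : ℂ) _ hlim j
    have h3 : Tendsto (fun N => y N ((S ^ j) (Q.X (c N)))) atTop (𝓝 ((r : ℂ) ^ j)) := by
      rw [tendsto_iff_norm_sub_tendsto_zero]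
      refine squeeze_zero (fun _ => norm_nonneg _) (fun N => ?_)
        (tendsto_zero_iff_norm_tendsto_zero.mp h2)
      have : y N ((S ^ j) (Q.X (c N))) - (r : ℂ) ^ j =
          y N ((S ^ j) (Q.X (c N)) - (r : ℂ) ^ j • Q.X (c N)) := by
        rw [map_sub, map_smul, hy2]; simp
      rw [this]
      refine ((y N).le_opNorm _).trans ?_
      have := hy1 N
      nlinarith [norm_nonneg ((S ^ j) (Q.X (c N)) - (r : ℂ) ^ j • Q.X (c N))]
    have hrc : (r : ℂ) ≠ 0 := by exact_mod_cast hr.ne'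
    have h4 := ((Complex.continuous_ofReal.tendsto _).comp (hn.inv₀ (by positivity))).mul h3
    have h5 : (((r ^ K)⁻¹ : ℝ) : ℂ) * (r : ℂ) ^ j = (r : ℂ) ^ m := by
      push_cast
      rw [← zpow_natCast, ← zpow_natCast, ← zpow_neg, ← zpow_add₀ hrc]
      congr 1; omega
    rw [h5] at h4
    exact h4

set_option synthInstance.maxHeartbeats 200000 in
set_option maxHeartbeats 1000000 in
theorem case2a {r : ℝ} (hr : 0 < r) {L : E →L[ℂ] E} (hL : Q.IsSh (-1) L)
    (h : ¬ ∃ δ > 0, ∀ y : E →L[ℂ] ℂ, δ * ‖y‖ ≤ ‖y.comp L - ((r⁻¹ : ℝ) : ℂ) • y‖) :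
    Q.Approx r := by
  let D : (E →L[ℂ] ℂ) →L[ℂ] (E →L[ℂ] ℂ) := (ContinuousLinearMap.compL ℂ E E ℂ).flip L
  have hD : ∀ y, D y = y.comp L := fun y => rfl
  have hDp : ∀ j y, (D ^ j) y = y.comp (L ^ j) := by
    intro j
    induction j with
    | zero => intro y; ext; simp
    | succ j ih => intro y; rw [pow_succ, mul_apply_eq_comp, ih, hD, pow_succ']; rfl
  have hri : 0 < r⁻¹ := by positivity
  have h1 : ∀ N : ℕ, ∃ y : E →L[ℂ] ℂ, ‖y‖ = 1 ∧
      ‖D y - ((r⁻¹ : ℝ) : ℂ) • y‖ ≤ 1 / ((N : ℝ) + 1) := by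
    intro N
    have hN : 0 < 1 / ((N : ℝ) + 1) := by positivity
    exact approx_unit D (r⁻¹) h _ hN
  choose y hy1 hy2 using h1
  have hlim : Tendsto (fun N => D (y N) - ((r⁻¹ : ℝ) : ℂ) • y N) atTop (𝓝 0) :=
    squeeze_zero_norm hy2 (tendsto_one_div_add_atTop_nhds_zero_nat (𝕜 := ℝ))
  have hx : ∀ N : ℕ, ∃ c, ‖Q.X c‖ ≤ 1 ∧ ‖y N (Q.X c) - 1‖ ≤ 1 / ((N : ℝ) + 1) := by
    intro N
    have hN : 0 < 1 / ((N : ℝ) + 1) := by positivity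
    have hN1 : 1 / ((N : ℝ) + 1) ≤ 1 := by
      rw [div_le_one (by positivity)]; linarith [(Nat.cast_nonneg N : (0 : ℝ) ≤ N)]
    obtain ⟨x, hx1, hx2⟩ := (y N).exists_lt_apply_of_lt_opNorm
      (show 1 - 1 / ((N : ℝ) + 1) < ‖y N‖ by rw [hy1]; linarith)
    have ho1 : IsOpen {x : E | ‖x‖ < 1} := isOpen_lt continuous_norm continuous_const
    have ho2 : IsOpen {x : E | 1 - 1 / ((N : ℝ) + 1) < ‖y N x‖} :=
      isOpen_lt continuous_const (y N).continuous.norm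
    have hopen : IsOpen {x : E | ‖x‖ < 1 ∧ 1 - 1 / ((N : ℝ) + 1) < ‖y N x‖} := ho1.inter ho2
    obtain ⟨c, hc1, hc2⟩ := Q.dense_X.exists_mem_open hopen ⟨x, hx1, hx2⟩
    have h0 : y N (Q.X c) ≠ 0 := by
      rw [← norm_pos_iff]; linarith
    let w : ℂ := (starRingEnd ℂ) (y N (Q.X c)) / ‖y N (Q.X c)‖
    have hn : (‖y N (Q.X c)‖ : ℂ) ≠ 0 := by exact_mod_cast (norm_ne_zero_iff.mpr h0)
    have hw : ‖w‖ = 1 := by simp [w, h0]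
    have h2 : w * y N (Q.X c) = (‖y N (Q.X c)‖ : ℂ) := by
      simp only [w]
      rw [div_mul_eq_mul_div, mul_comm, Complex.mul_conj, Complex.normSq_eq_norm_sq]
      field_simp
      norm_cast
    refine ⟨w • c, ?_, ?_⟩
    · rw [map_smul, norm_smul, hw, one_mul]; exact hc1.le
    · rw [map_smul, map_smul, smul_eq_mul, h2]
      have h3 : ‖y N (Q.X c)‖ ≤ 1 := by
        refine ((y N).le_opNorm _).trans ?_
        rw [hy1, one_mul]; exact hc1.le
      rw [show ((‖y N (Q.X c)‖ : ℂ) - 1) = ((‖y N (Q.X c)‖ - 1 : ℝ) : ℂ) by push_cast; rfl,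
        Complex.norm_real, Real.norm_of_nonpos (by linarith)]
      linarith
  choose c hc1 hc2 using hx
  have hyx : Tendsto (fun N => y N (Q.X (c N))) atTop (𝓝 1) := by
    rw [tendsto_iff_norm_sub_tendsto_zero]
    exact squeeze_zero (fun _ => norm_nonneg _) hc2
      (tendsto_one_div_add_atTop_nhds_zero_nat (𝕜 := ℝ))
  intro K
  have hn := pow_approx_norm D hri _ hy1 hlim K
  have hsh : ∀ N (m : ℤ), |m| ≤ K → (L ^ K) (Q.sh m (c N)) =
      (L ^ (K - m).toNat) (Q.X (c N)) := by
    intro N m hm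
    have := abs_le.mp hm
    rw [hL.pow_X (Or.inr rfl)]
    generalize c N = d
    induction d using Finsupp.induction_linear with
    | zero => simp
    | add f g hf hg => simp only [map_add, hf, hg]
    | single k a =>
      rw [Q.sh_single, Q.sh_single, map_smul, hL.pow_ez (Or.inr rfl) (Or.inl rfl)]
      congr 2
      omega
  refine ⟨c, fun N => ((‖(D ^ K) (y N)‖⁻¹ : ℝ) : ℂ) • (D ^ K) (y N), fun N => ?_, fun m hm => ?_⟩
  · rw [norm_smul, Complex.norm_real, norm_inv, norm_norm]
    have := hc1 N
    calc ‖(D ^ K) (y N)‖⁻¹ * ‖(D ^ K) (y N)‖ * ‖Q.X (c N)‖ ≤ 1 * 1 :=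
          mul_le_mul inv_mul_le_one (hc1 N) (norm_nonneg _) zero_le_one
      _ = 1 := by ring
  · have hm' := abs_le.mp hm
    set j := (K - m).toNat with hj
    have h2 := pow_approx D ((r⁻¹ : ℝ) : ℂ) _ hlim j
    have h3 : Tendsto (fun N => y N ((L ^ j) (Q.X (c N)))) atTop (𝓝 (((r⁻¹ : ℝ) : ℂ) ^ j)) := by
      have h4 : Tendsto (fun N => y N ((L ^ j) (Q.X (c N))) -
          ((r⁻¹ : ℝ) : ℂ) ^ j * y N (Q.X (c N))) atTop (𝓝 0) := by
        refine squeeze_zero_norm (fun N => ?_) (tendsto_zero_iff_norm_tendsto_zero.mp h2)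
        have : y N ((L ^ j) (Q.X (c N))) - ((r⁻¹ : ℝ) : ℂ) ^ j * y N (Q.X (c N)) =
            ((D ^ j) (y N) - ((r⁻¹ : ℝ) : ℂ) ^ j • y N) (Q.X (c N)) := by
          rw [hDp]; rfl
        rw [this]
        refine (ContinuousLinearMap.le_opNorm _ _).trans ?_
        have := hc1 N
        nlinarith [norm_nonneg ((D ^ j) (y N) - ((r⁻¹ : ℝ) : ℂ) ^ j • y N)]
      have h5 := h4.add (hyx.const_mul (((r⁻¹ : ℝ) : ℂ) ^ j))
      simpa using h5
    have hrc : (r : ℂ) ≠ 0 := by exact_mod_cast hr.ne'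
    have h4 := ((Complex.continuous_ofReal.tendsto _).comp (hn.inv₀ (by positivity))).mul h3
    have h5 : ((((r⁻¹) ^ K)⁻¹ : ℝ) : ℂ) * ((r⁻¹ : ℝ) : ℂ) ^ j = (r : ℂ) ^ m := by
      push_cast
      rw [inv_pow, inv_inv, inv_pow, ← zpow_natCast, ← zpow_natCast, ← zpow_neg, ← zpow_add₀ hrc]
      congr 1; omega
    rw [h5] at h4
    refine h4.congr fun N => ?_
    have h6 := hsh N m hm
    rw [← hj] at h6
    have h7 : (y N) ((L ^ K) (Q.sh m (c N))) = ((D ^ K) (y N)) (Q.sh m (c N)) := by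
      rw [hDp]; rfl
    rw [← h6, h7]
    rfl

theorem case1b [CompleteSpace E] {r : ℝ} (hr : 0 < r) {S : E →L[ℂ] E} (hS : Q.IsSh 1 S)
    (h : ∃ δ > 0, ∀ x, δ * ‖x‖ ≤ ‖S x - (r : ℂ) • x‖) (hns : ¬ Q.Solv 1 r) :
    Q.Solv (-1) r⁻¹ := by
  obtain ⟨δ, hδ, h⟩ := h
  have hrc : (r : ℂ) ≠ 0 := by exact_mod_cast hr.ne'
  let D : E →L[ℂ] E := algebraMap ℂ (E →L[ℂ] E) r - S
  have hD : ∀ x, D x = (r : ℂ) • x - S x := by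
    intro x; simp only [D]; rw [Algebra.algebraMap_eq_smul_one]; simp
  have hanti : AntilipschitzWith (Real.toNNReal δ⁻¹) D := by
    refine ContinuousLinearMap.antilipschitz_of_bound D fun x => ?_
    rw [Real.coe_toNNReal _ (by positivity), hD, norm_sub_rev, ← div_eq_inv_mul, le_div_iff₀ hδ,
      mul_comm]
    exact h x
  have hcl : IsClosed (LinearMap.range (D : E →ₗ[ℂ] E) : Set E) := by
    have := hanti.isClosed_range D.uniformContinuous
    exact this
  set W := LinearMap.range (D : E →ₗ[ℂ] E) with hW
  have hDW : ∀ x, D x ∈ W := fun x => LinearMap.mem_range_self _ x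
  have hstep : ∀ n, (r : ℂ) • Q.e n - Q.e (n + 1) ∈ W := by
    intro n
    have := hDW (Q.e n)
    rw [hD, hS n] at this
    rwa [← Q.ez_nat (n + 1)]
  have he0 : Q.e 0 ∉ W := by
    intro he0
    have hall : ∀ n, Q.e n ∈ W := by
      intro n
      induction n with
      | zero => exact he0
      | succ n ih =>
        have := W.sub_mem (W.smul_mem (r : ℂ) ih) (hstep n)
        simpa using this
    have htop : ∀ x, x ∈ W := by
      refine Q.dense_ind hcl fun c => ?_
      rw [X, Finsupp.linearCombination_apply]
      exact W.sum_mem fun k _ => W.smul_mem _ (hall k)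
    apply hns
    rw [hS.solv_iff, ContinuousLinearMap.isUnit_iff_bijective]
    exact ⟨hanti.injective, fun x => htop x⟩
  have hall : ∀ x, x ∈ W ⊔ Submodule.span ℂ {Q.e 0} := by
    have hcl2 : IsClosed ((W ⊔ Submodule.span ℂ {Q.e 0} : Submodule ℂ E) : Set E) :=
      Submodule.isClosed_sup_finiteDimensional _ _ hcl
    have hall : ∀ n, Q.e n ∈ W ⊔ Submodule.span ℂ {Q.e 0} := by
      intro n
      induction n with
      | zero => exact Submodule.mem_sup_right (Submodule.mem_span_singleton_self _)
      | succ n ih =>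
        have := Submodule.sub_mem _ (Submodule.smul_mem _ (r : ℂ) ih)
          (Submodule.mem_sup_left (hstep n))
        simpa using this
    refine Q.dense_ind hcl2 fun c => ?_
    rw [X, Finsupp.linearCombination_apply]
    exact Submodule.sum_mem _ fun k _ => Submodule.smul_mem _ _ (hall k)
  have hcoefD : ∀ (u : E) (n : ℕ), Q.coef (n + 1 : ℕ) (D u) =
      r * Q.coef (n + 1 : ℕ) u - Q.coef n u := by
    intro u n
    have := Q.mem_rel.mp (hS.mem_rel.mpr (rfl : D u = D u)) (n + 1)
    rw [← this]
    congr 2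
    push_cast; ring
  intro x
  refine existsUnique_of_exists_of_unique ?_ ?_
  · obtain ⟨_, ⟨u, rfl⟩, z, hz, huz⟩ := Submodule.mem_sup.mp (hall (S x))
    obtain ⟨a, rfl⟩ := Submodule.mem_span_singleton.mp hz
    refine ⟨(-(r : ℂ)) • u, Q.mem_rel.mpr fun n => ?_⟩
    have h1 := hcoefD u n
    have h2 : Q.coef (n + 1 : ℕ) (S x) = Q.coef n x := by
      rw [hS.coef]; congr 1; push_cast; ring
    rw [← huz, coef_add, coef_smul, coef_e, if_neg (by push_cast; omega)] at h2
    rw [mul_zero, add_zero] at h2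
    have h3 : Q.coef (n + 1 : ℕ) (D u) = Q.coef n x := h2
    rw [h1] at h3
    rw [coef_smul, coef_smul, ← h3, show ((n : ℤ) - -1) = (n + 1 : ℕ) by push_cast; ring]
    push_cast
    field_simp
    ring
  · intro u v hu hv
    have hw := (Q.rel (-1) r⁻¹).sub_mem hu hv
    rw [← sub_eq_zero]
    set w := u - v with hwdef
    have hw' : ∀ n : ℕ, ((r⁻¹ : ℝ) : ℂ) * Q.coef n w - Q.coef (n + 1 : ℕ) w = 0 := by
      intro n
      have := Q.mem_rel.mp hw n
      rw [show ((n : ℤ) - -1) = (n + 1 : ℕ) by push_cast; ring] at this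
      rw [this]; simp
    have hDw : D w = ((r : ℂ) * Q.coef (0 : ℕ) w) • Q.e 0 := by
      apply Q.coef_ext
      intro n
      rw [coef_smul, coef_e]
      rcases n with _ | n
      · have := Q.mem_rel.mp (hS.mem_rel.mpr (rfl : D w = D w)) 0
        rw [← this, Q.coef_neg (j := ((0 : ℕ) : ℤ) - 1) (by norm_num)]
        simp
      · rw [hcoefD, if_neg (by push_cast; omega)]
        have := hw' n
        push_cast at this ⊢
        field_simp at this
        linear_combination (-1 : ℂ) * this
    have h0 : Q.coef (0 : ℕ) w = 0 := by
      by_contra hne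
      apply he0
      have := W.smul_mem ((r : ℂ) * Q.coef (0 : ℕ) w)⁻¹ (hDw ▸ hDW w)
      rwa [smul_smul, inv_mul_cancel₀ (mul_ne_zero hrc hne), one_smul] at this
    rw [h0, mul_zero, zero_smul] at hDw
    exact hanti.injective (by rw [hDw, map_zero])

theorem case2b [CompleteSpace E] {r : ℝ} (hr : 0 < r) {L : E →L[ℂ] E} (hL : Q.IsSh (-1) L)
    (h : ∃ δ > 0, ∀ y : E →L[ℂ] ℂ, δ * ‖y‖ ≤ ‖y.comp L - ((r⁻¹ : ℝ) : ℂ) • y‖)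
    (hns : ¬ Q.Solv (-1) r⁻¹) : Q.Solv 1 r := by
  obtain ⟨δ, hδ, h⟩ := h
  have hrc : (r : ℂ) ≠ 0 := by exact_mod_cast hr.ne'
  let D : E →L[ℂ] E := algebraMap ℂ (E →L[ℂ] E) (r⁻¹ : ℝ) - L
  have hD : ∀ x, D x = ((r⁻¹ : ℝ) : ℂ) • x - L x := by
    intro x; simp only [D]; rw [Algebra.algebraMap_eq_smul_one]; simp
  have hsurj : Function.Surjective D := by
    refine surj_of_dual D δ hδ fun y => ?_
    have : y.comp D = -(y.comp L - ((r⁻¹ : ℝ) : ℂ) • y) := by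
      ext x
      simp [hD]
    rw [this, norm_neg]
    exact h y
  have hD' : ∀ (x : E) (n : ℕ), Q.coef n (D x) =
      ((r⁻¹ : ℝ) : ℂ) * Q.coef n x - Q.coef (n + 1 : ℕ) x := by
    intro x n
    have := Q.mem_rel.mp (hL.mem_rel.mpr (rfl : D x = D x)) n
    rw [← this]
    congr 2
  have hninj : ∃ w, w ≠ 0 ∧ D w = 0 := by
    by_contra hcon
    push Not at hcon
    apply hns
    rw [hL.solv_iff, ContinuousLinearMap.isUnit_iff_bijective]
    refine ⟨(injective_iff_map_eq_zero D).mpr fun w hw => ?_, hsurj⟩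
    by_contra hne
    exact hcon w hne hw
  obtain ⟨w, hw0, hw⟩ := hninj
  have hwn : ∀ n : ℕ, Q.coef (n + 1 : ℕ) w = ((r⁻¹ : ℝ) : ℂ) * Q.coef n w := by
    intro n
    have := hD' w n
    rw [hw, coef_zero] at this
    linear_combination this
  have hw00 : Q.coef (0 : ℕ) w ≠ 0 := by
    intro h0
    apply hw0
    apply Q.coef_ext
    intro n
    rw [coef_zero]
    induction n with
    | zero => exact h0
    | succ n ih => rw [hwn, ih, mul_zero]
  intro x
  refine existsUnique_of_exists_of_unique ?_ ?_
  · obtain ⟨v, hv⟩ := hsurj ((-((r⁻¹ : ℝ) : ℂ)) • L x)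
    let a : ℂ := (((r⁻¹ : ℝ) : ℂ) * Q.coef (0 : ℕ) x - Q.coef (0 : ℕ) v) / Q.coef (0 : ℕ) w
    refine ⟨v + a • w, Q.mem_rel.mpr fun n => ?_⟩
    rcases n with _ | n
    · rw [Q.coef_neg (j := ((0 : ℕ) : ℤ) - 1) (by norm_num), coef_add, coef_smul]
      simp only [a]
      rw [div_mul_cancel₀ _ hw00]
      push_cast
      field_simp
      ring
    · have h1 := hD' v n
      rw [hv, coef_smul, hL.coef, show ((n : ℤ) - -1) = (n + 1 : ℕ) by push_cast; ring] at h1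
      rw [show (((n + 1 : ℕ) : ℤ) - 1) = n by push_cast; ring, coef_add, coef_add, coef_smul,
        coef_smul, hwn]
      push_cast at h1 ⊢
      field_simp at h1 ⊢
      linear_combination h1
  · intro u v hu hv
    have hw := (Q.rel 1 r).sub_mem hu hv
    rw [← sub_eq_zero]
    have hw2 := Q.mem_rel.mp hw
    change ∀ n : ℕ, r * Q.coef n (u - v) - Q.coef (n - 1) (u - v) = Q.coef n (x - x) at hw2
    apply Q.coef_ext
    intro n
    rw [coef_zero]
    induction n with
    | zero =>
      have := hw2 0
      rw [Q.coef_neg (j := ((0 : ℕ) : ℤ) - 1) (by norm_num), sub_self x, coef_zero, sub_zero] at this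
      exact (mul_eq_zero.mp this).resolve_left hrc
    | succ n ih =>
      have := hw2 (n + 1)
      rw [show (((n + 1 : ℕ) : ℤ) - 1) = n by push_cast; ring, ih, sub_self x, coef_zero,
        sub_zero] at this
      exact (mul_eq_zero.mp this).resolve_left hrc

theorem exists_isSh [CompleteSpace E] (σ : ℤ)
    (h : ∀ x, ∃ y, ∀ n : ℕ, Q.coef n y = Q.coef (n - σ) x) : ∃ A : E →L[ℂ] E, Q.IsSh σ A := by
  let G : Submodule ℂ (E × E) :=
    { carrier := {p | ∀ n : ℕ, Q.coef n p.2 = Q.coef (n - σ) p.1}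
      add_mem' := by
        intro p q hp hq n
        simp only [Prod.fst_add, Prod.snd_add, coef_add]
        rw [hp n, hq n]
      zero_mem' := by
        intro n
        rw [Prod.snd_zero, Prod.fst_zero, coef_zero, coef_zero]
      smul_mem' := by
        intro a p hp n
        simp only [Prod.smul_fst, Prod.smul_snd, coef_smul]
        rw [hp n] }
  have hG : IsClosed (G : Set (E × E)) := by
    have : (G : Set (E × E)) = ⋂ n : ℕ, {p : E × E | Q.coef n p.2 = Q.coef (n - σ) p.1} := by
      ext p; simp only [Set.mem_iInter]; rfl
    rw [this]
    refine isClosed_iInter fun n => ?_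
    exact isClosed_eq ((Q.coef_cont n).comp continuous_snd) ((Q.coef_cont _).comp continuous_fst)
  obtain ⟨A, hA⟩ := clm_of_rel G hG fun x => by
    obtain ⟨y, hy⟩ := h x
    refine ⟨y, hy, fun z hz => Q.coef_ext fun n => ?_⟩
    rw [hy n]; exact hz n
  exact ⟨A, IsSh.of_coef fun n x => hA x n⟩

theorem approx_main [CompleteSpace E] {r : ℝ} (hr : 0 < r) (hnS : ¬ Q.Solv 1 r)
    (hnL : ¬ Q.Solv (-1) r⁻¹)
    (hb : (∀ x, ∃ y, ∀ n : ℕ, Q.coef n y = Q.coef (n - 1) x) ∨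
      (∀ x, ∃ y, ∀ n : ℕ, Q.coef n y = Q.coef (n - -1) x)) : Q.Approx r := by
  rcases hb with hb | hb
  · obtain ⟨S, hS⟩ := exists_isSh 1 hb
    by_contra hcon
    have h : ∃ δ > 0, ∀ x, δ * ‖x‖ ≤ ‖S x - (r : ℂ) • x‖ := by
      by_contra h
      exact hcon (case1a hr hS h)
    exact hnL (case1b hr hS h hnS)
  · obtain ⟨L, hL⟩ := exists_isSh (-1) hb
    by_contra hcon
    have h : ∃ δ > 0, ∀ y : E →L[ℂ] ℂ, δ * ‖y‖ ≤ ‖y.comp L - ((r⁻¹ : ℝ) : ℂ) • y‖ := by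
      by_contra h
      exact hcon (case2a hr hL h)
    exact hnS (case2b hr hL h hnL)

end Ctx

/-- The context attached to the data of the theorem. -/
noncomputable def mkCtx {E : Type*} [NormedAddCommGroup E] [NormedSpace ℂ E]
    (ι : E →ₗ[ℂ] (ℕ → ℂ)) (hι : Function.Injective ι)
    (e : ℕ → E) (he : ∀ k : ℕ, ι (e k) = Pi.single k 1)
    (hdense : Dense (Submodule.span ℂ (Set.range e) : Set E))
    (hcoord : ∀ n : ℕ, Continuous fun x : E => ι x n)
    (Γ : ℂ → E → E)
    (hΓ : ∀ z : ℂ, ‖z‖ = 1 → ∀ x : E, ∀ n : ℕ, ι (Γ z x) n = z ^ n * ι x n)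
    (hΓiso : ∀ z : ℂ, ‖z‖ = 1 → ∀ x : E, ‖Γ z x‖ = ‖x‖) : Ctx E where
  ι := ι
  hι := hι
  e := e
  he := he
  hdense := hdense
  hcoord := hcoord
  γ t := LinearMap.mkContinuous
    { toFun := Γ (Complex.exp ((t : ℂ) * Complex.I))
      map_add' := fun x y => hι (by
        funext n
        rw [map_add, Pi.add_apply]
        simp only [hΓ _ (Complex.norm_exp_ofReal_mul_I t)]
        rw [map_add, Pi.add_apply, mul_add])
      map_smul' := fun a x => hι (by
        funext n
        rw [RingHom.id_apply, map_smul, Pi.smul_apply]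
        simp only [hΓ _ (Complex.norm_exp_ofReal_mul_I t)]
        rw [map_smul, Pi.smul_apply, smul_eq_mul, smul_eq_mul]
        ring) } 1 (fun x => by
          rw [one_mul]
          exact (hΓiso _ (Complex.norm_exp_ofReal_mul_I t) x).le)
  hγ := fun t x n => by
    change ι (Γ _ x) n = _
    rw [hΓ _ (Complex.norm_exp_ofReal_mul_I t), ← Complex.exp_nat_mul]
    congr 2
    ring
  hγn := fun t x => hΓiso _ (Complex.norm_exp_ofReal_mul_I t) x

end Aux

/-- For a Toeplitz operator `T` on `𝐄` and `1/ρ(𝐒₋₁) ≤ r ≤ ρ(𝐒)` (upper constraint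
vacuous if `ρ(𝐒) = ∞`), the symbol of `T` on the circle of radius `r` is an `L^∞`
function on the unit circle, essentially bounded by `‖T‖`, with Fourier coefficients
`T̂(n) rⁿ`. -/
theorem stmt4
    {E : Type*} [NormedAddCommGroup E] [NormedSpace ℂ E] [CompleteSpace E]
    (ι : E →ₗ[ℂ] (ℕ → ℂ)) (hι : Function.Injective ι)
    (e : ℕ → E) (he : ∀ k : ℕ, ι (e k) = Pi.single k 1)
    (hdense : Dense (Submodule.span ℂ (Set.range e) : Set E))
    (hcoord : ∀ n : ℕ, Continuous fun x : E => ι x n)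
    -- (ℋ3), strengthened so that each `γ_z` is an isometry of `𝐄`:
    (Γ : ℂ → E → E)
    (hΓ : ∀ z : ℂ, ‖z‖ = 1 → ∀ x : E, ∀ n : ℕ, ι (Γ z x) n = z ^ n * ι x n)
    (hΓiso : ∀ z : ℂ, ‖z‖ = 1 → ∀ x : E, ‖Γ z x‖ = ‖x‖)
    -- `S0` and `T0` are the restrictions of `𝐒` and `𝐒₋₁` to `F(ℤ⁺)`:
    (S0 T0 : E →ₗ.[ℂ] E)
    (hS0dom : S0.domain = Submodule.span ℂ (Set.range e))
    (hS0 : ∀ x : S0.domain, ι (S0 x) 0 = 0 ∧ ∀ n : ℕ, ι (S0 x) (n + 1) = ι (x : E) n)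
    (hT0dom : T0.domain = Submodule.span ℂ (Set.range e))
    (hT0 : ∀ x : T0.domain, ∀ n : ℕ, ι (T0 x) n = ι (x : E) (n + 1))
    -- at least one of `𝐒`, `𝐒₋₁` is bounded:
    (hb : (∀ x : E, ∃ y : E, ι y 0 = 0 ∧ ∀ n : ℕ, ι y (n + 1) = ι x n) ∨
      (∀ x : E, ∃ y : E, ∀ n : ℕ, ι y n = ι x (n + 1)))
    -- `T` is a Toeplitz operator on `𝐄`:
    (T : E →L[ℂ] E)
    (hT : ∀ k n : ℕ, ι (T (e (k + 1))) (n + 1) = ι (T (e k)) n)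
    -- `Th` is the symbol sequence `T̂`:
    (Th : ℤ → ℂ)
    (hTh₁ : ∀ n : ℕ, Th n = ι (T (e 0)) n)
    (hTh₂ : ∀ n : ℕ, Th (-(n : ℤ)) = ι (T (e n)) 0)
    -- `1/ρ(𝐒₋₁) ≤ r ≤ ρ(𝐒)`:
    (r : ℝ) (hr : 0 < r)
    (hr₁ : (pRad T0.closure)⁻¹ ≤ ENNReal.ofReal r)
    (hr₂ : ENNReal.ofReal r ≤ pRad S0.closure) :
    ∃ ν : ℝ → ℂ, Measurable ν ∧ Function.Periodic ν (2 * Real.pi) ∧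
      (∀ᵐ t : ℝ, ‖ν t‖ ≤ ‖T‖) ∧
      ∀ n : ℤ, ((1 / (2 * Real.pi) : ℝ) : ℂ) *
          (∫ t in (-Real.pi)..Real.pi, ν t * Complex.exp (-(n : ℂ) * Complex.I * (t : ℂ)))
        = Th n * (r : ℂ) ^ n := by
  let Q : Ctx E := mkCtx ι hι e he hdense hcoord Γ hΓ hΓiso
  have hQι : Q.ι = ι := rfl
  have hQe : Q.e = e := rfl
  have hToep : Q.Toep T Th := by
    intro k
    rw [hQι, hQe]
    induction k with
    | zero => intro n; rw [← hTh₁]; simp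
    | succ k ih =>
      intro n
      rcases n with _ | n
      · rw [← hTh₂]; simp
      · rw [hT, ih]; congr 1; push_cast; ring
  have hm1 : ((0 : ℕ) : ℤ) - 1 < 0 := by norm_num
  have hsucc : ∀ n : ℕ, ((n + 1 : ℕ) : ℤ) - 1 = n := fun n => by push_cast; ring
  have hneg : ∀ n : ℕ, (n : ℤ) - -1 = ((n + 1 : ℕ) : ℤ) := fun n => by push_cast; ring
  have hnS : ¬ Q.Solv 1 r := by
    intro hs
    obtain ⟨A, hA, s', hs0, hs1, hsp⟩ := Ctx.solv_rad (Or.inl rfl) hr hs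
    have h1 := Ctx.pRad_le hA S0 hS0dom (fun x n => by
      rcases n with _ | n
      · rw [Q.coef_neg hm1, Q.coef_nat]; exact (hS0 x).1
      · rw [hsucc, Q.coef_nat, Q.coef_nat]; exact (hS0 x).2 n) hsp
    exact absurd (hr₂.trans h1) (not_le.mpr ((ENNReal.ofReal_lt_ofReal_iff hr).mpr hs1))
  have hnL : ¬ Q.Solv (-1) r⁻¹ := by
    intro hs
    obtain ⟨A, hA, s', hs0, hs1, hsp⟩ := Ctx.solv_rad (Or.inr rfl) (inv_pos.mpr hr) hs
    have h1 := Ctx.pRad_le hA T0 hT0dom (fun x n => by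
      rw [hneg, Q.coef_nat, Q.coef_nat]; exact hT0 x n) hsp
    have h2 := (ENNReal.inv_le_inv.mpr h1).trans hr₁
    rw [← ENNReal.ofReal_inv_of_pos hs0, ENNReal.ofReal_le_ofReal_iff hr.le] at h2
    have h3 : r < s'⁻¹ := by rwa [lt_inv_comm₀ hr hs0]
    linarith
  refine Ctx.approx_final (Ctx.approx_main (Q := Q) hr hnS hnL ?_) hToep
  rcases hb with hb | hb
  · left
    intro x
    obtain ⟨y, hy0, hy⟩ := hb x
    refine ⟨y, fun n => ?_⟩
    rcases n with _ | n
    · rw [Q.coef_neg hm1, Q.coef_nat]; exact hy0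
    · rw [hsucc, Q.coef_nat, Q.coef_nat]; exact hy n
  · right
    intro x
    obtain ⟨y, hy⟩ := hb x
    refine ⟨y, fun n => ?_⟩
    rw [hneg, Q.coef_nat, Q.coef_nat]; exact hy n
end

section
/- Assume 𝐒 and 𝐒₋₁ are both bounded on 𝐄 and that 1/ρ(𝐒₋₁) < ρ(𝐒). Let T be a Toeplitz operator on 𝐄. Then for every z in the open annulus { z ∈ ℂ : 1/ρ(𝐒₋₁) < |z| < ρ(𝐒) } the series T̃(z) = Σ_{n∈ℤ} T̂(n) zⁿ converges, and T̃ is holomorphic there with |T̃(z)| ≤ ‖T‖. -/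
open scoped ENNReal

section Toe

lemma toe_approx {A : Type*} [NormedRing A] [NormedAlgebra ℂ A] [CompleteSpace A]
    [NormOneClass A] (a : A) (w : ℂ) (hw : w ∈ spectrum ℂ a) (hr : (‖w‖₊ : ℝ≥0∞) = spectralRadius ℂ a)
    (hw0 : w ≠ 0) (ε : ℝ) (hε : 0 < ε) :
    ∃ B : A, 0 < ‖B‖ ∧ ‖(a - algebraMap ℂ A w) * B‖ ≤ ε * ‖B‖ ∧
      ‖B * (a - algebraMap ℂ A w)‖ ≤ ε * ‖B‖ := by
  have hwn : 0 < ‖w‖ := norm_pos_iff.mpr hw0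
  set η : ℝ := ε / (2 * (‖w‖ * (‖(1 : A)‖ + 1))) with hη
  have hηpos : 0 < η := by positivity
  set w' : ℂ := ((1 + η : ℝ) : ℂ) * w with hw'
  have hlt : spectralRadius ℂ a < (‖w'‖₊ : ℝ≥0∞) := by
    rw [← hr, ENNReal.coe_lt_coe, ← NNReal.coe_lt_coe]
    simp only [coe_nnnorm, hw', norm_mul, Complex.norm_real, Real.norm_eq_abs]
    rw [abs_of_pos (by positivity)]
    nlinarith
  have hres := spectrum.mem_resolventSet_of_spectralRadius_lt hlt
  rw [spectrum.mem_resolventSet_iff] at hres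
  obtain ⟨u, hu⟩ := hres
  have hnu : ¬ IsUnit (algebraMap ℂ A w - a) := hw
  set x : A := algebraMap ℂ A w - a with hx
  have hdiff : x - u = algebraMap ℂ A (-(η * w)) := by
    rw [hu, hx, hw']
    rw [sub_sub_sub_cancel_right, ← map_sub]
    congr 1
    push_cast
    ring
  have hd : ‖x - u‖ ≤ ε / 2 := by
    rw [hdiff, norm_algebraMap, norm_neg, norm_mul, Complex.norm_real, Real.norm_eq_abs,
      abs_of_pos hηpos, hη]
    have h1 : 0 ≤ ‖(1 : A)‖ := norm_nonneg _
    rw [div_mul_eq_mul_div, div_mul_eq_mul_div, div_le_div_iff₀ (by positivity) (by positivity)]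
    nlinarith [mul_pos hε hwn]
  have hntA : Nontrivial A := by
    by_contra h
    rw [not_nontrivial_iff_subsingleton] at h
    exact hnu (isUnit_of_subsingleton _)
  have hBpos : 0 < ‖(↑u⁻¹ : A)‖ := norm_pos_iff.mpr (Units.ne_zero _)
  have hge : 1 ≤ ‖x - u‖ * ‖(↑u⁻¹ : A)‖ := by
    by_contra h
    push Not at h
    apply hnu
    have : ‖x - u‖ < ‖(↑u⁻¹ : A)‖⁻¹ := by
      rw [← one_div, lt_div_iff₀ hBpos]; exact h
    exact ⟨Units.ofNearby u x this, rfl⟩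
  have hge2 : 1 ≤ ε / 2 * ‖(↑u⁻¹ : A)‖ := hge.trans (by gcongr)
  have hax : a - algebraMap ℂ A w = -x := by rw [hx]; abel
  refine ⟨↑u⁻¹, hBpos, ?_, ?_⟩
  · have : x * ↑u⁻¹ = 1 + (x - u) * ↑u⁻¹ := by rw [sub_mul x, Units.mul_inv]; abel
    rw [hax, neg_mul, norm_neg, this]
    have h1 := norm_add_le (1 : A) ((x - u) * ↑u⁻¹)
    have h2 := norm_mul_le (x - u) (↑u⁻¹ : A)
    have h3 : ‖x - u‖ * ‖(↑u⁻¹ : A)‖ ≤ ε / 2 * ‖(↑u⁻¹ : A)‖ := by gcongr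
    rw [norm_one] at h1
    linarith
  · have : ↑u⁻¹ * x = 1 + ↑u⁻¹ * (x - u) := by rw [mul_sub _ x, Units.inv_mul]; abel
    rw [hax, mul_neg, norm_neg, this]
    have h1 := norm_add_le (1 : A) (↑u⁻¹ * (x - u))
    have h2 := norm_mul_le (↑u⁻¹ : A) (x - u)
    have h3 : ‖x - u‖ * ‖(↑u⁻¹ : A)‖ ≤ ε / 2 * ‖(↑u⁻¹ : A)‖ := by gcongr
    rw [norm_one] at h1
    linarith

lemma toe_eps {c t K : ℝ} (hK : 0 ≤ K)
    (h : ∀ ε : ℝ, 0 < ε → c ≤ t + K * ε) : c ≤ t := by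
  by_contra hc
  push Not at hc
  have := h ((c - t) / (2 * (K + 1))) (by apply div_pos <;> linarith)
  have h2 : K * ((c - t) / (2 * (K + 1))) ≤ (c - t) / 2 := by
    rw [mul_div_assoc', div_le_div_iff₀ (by positivity) (by positivity)]
    nlinarith
  linarith

lemma toe_left {A : Type*} [NormedRing A] [NormedAlgebra ℂ A] [CompleteSpace A]
    [NormOneClass A] (a : A) (w : ℂ) (hw : w ∈ spectrum ℂ a)
    (hr : (‖w‖₊ : ℝ≥0∞) = spectralRadius ℂ a) (hw0 : w ≠ 0) (x C : A) (c : ℂ)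
    (hx : x - algebraMap ℂ A c = C * (a - algebraMap ℂ A w)) : ‖c‖ ≤ ‖x‖ := by
  refine toe_eps (K := ‖C‖) (norm_nonneg _) fun ε hε => ?_
  obtain ⟨B, hB, h1, -⟩ := toe_approx a w hw hr hw0 ε hε
  have e1 : c • B = x * B - C * ((a - algebraMap ℂ A w) * B) := by
    rw [← mul_assoc, ← hx, sub_mul, Algebra.smul_def]; abel
  have e2 : ‖c‖ * ‖B‖ ≤ (‖x‖ + ‖C‖ * ε) * ‖B‖ := by
    rw [← norm_smul, e1]
    have := norm_sub_le (x * B) (C * ((a - algebraMap ℂ A w) * B))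
    have h2 := norm_mul_le x B
    have h3 := norm_mul_le C ((a - algebraMap ℂ A w) * B)
    have h4 := mul_le_mul_of_nonneg_left h1 (norm_nonneg C)
    nlinarith
  exact le_of_mul_le_mul_right e2 hB

lemma toe_right {A : Type*} [NormedRing A] [NormedAlgebra ℂ A] [CompleteSpace A]
    [NormOneClass A] (a : A) (w : ℂ) (hw : w ∈ spectrum ℂ a)
    (hr : (‖w‖₊ : ℝ≥0∞) = spectralRadius ℂ a) (hw0 : w ≠ 0) (x C : A) (c : ℂ)
    (hx : x - algebraMap ℂ A c = (a - algebraMap ℂ A w) * C) : ‖c‖ ≤ ‖x‖ := by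
  refine toe_eps (K := ‖C‖) (norm_nonneg _) fun ε hε => ?_
  obtain ⟨B, hB, -, h1⟩ := toe_approx a w hw hr hw0 ε hε
  have e1 : c • B = B * x - (B * (a - algebraMap ℂ A w)) * C := by
    rw [mul_assoc, ← hx, mul_sub, Algebra.smul_def, Algebra.commutes]; abel
  have e2 : ‖c‖ * ‖B‖ ≤ (‖x‖ + ‖C‖ * ε) * ‖B‖ := by
    rw [← norm_smul, e1]
    have := norm_sub_le (B * x) ((B * (a - algebraMap ℂ A w)) * C)
    have h2 := norm_mul_le B x
    have h3 := norm_mul_le (B * (a - algebraMap ℂ A w)) C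
    have h4 := mul_le_mul_of_nonneg_right h1 (norm_nonneg C)
    nlinarith
  exact le_of_mul_le_mul_right e2 hB

/-- The shift by `k`: powers of `s` for `k ≥ 0`, powers of `m` for `k < 0`. -/
noncomputable def toeSh {A : Type*} [Ring A] (s m : A) (k : ℤ) : A :=
  if 0 ≤ k then s ^ k.toNat else m ^ (-k).toNat

lemma toe_sh_left {A : Type*} [Ring A] [Algebra ℂ A] (s m : A) (hms : m * s = 1)
    (z : ℂ) (hz : z ≠ 0) (k : ℤ) :
    ∃ C : A, toeSh s m k - algebraMap ℂ A (z ^ k) = C * (s - algebraMap ℂ A z) := by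
  have hpow : ∀ (a : A) (y : ℂ) (n : ℕ), ∃ C : A,
      a ^ n - algebraMap ℂ A (y ^ n) = C * (a - algebraMap ℂ A y) := by
    intro a y n
    rw [map_pow]
    exact ⟨_, (Commute.geom_sum₂_mul (Algebra.commutes y a).symm n).symm⟩
  unfold toeSh
  split_ifs with h
  · obtain ⟨n, rfl⟩ := Int.eq_ofNat_of_zero_le h
    simpa using hpow s z n
  · obtain ⟨n, hn⟩ := Int.eq_ofNat_of_zero_le (show 0 ≤ -k by lia)
    obtain rfl : k = -(n : ℤ) := by lia
    obtain ⟨C, hC⟩ := hpow m z⁻¹ n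
    refine ⟨C * (-(algebraMap ℂ A z⁻¹ * m)), ?_⟩
    have h1 : m - algebraMap ℂ A z⁻¹ = (-(algebraMap ℂ A z⁻¹ * m)) * (s - algebraMap ℂ A z) := by
      rw [mul_sub, neg_mul, mul_assoc, hms, neg_mul, mul_assoc, ← Algebra.commutes z m,
        ← mul_assoc, ← map_mul, inv_mul_cancel₀ hz, map_one]
      simp
      abel
    rw [mul_assoc, ← h1, ← hC]
    simp

lemma toe_sh_right {A : Type*} [Ring A] [Algebra ℂ A] (s m : A) (hms : m * s = 1)
    (z : ℂ) (hz : z ≠ 0) (k : ℤ) :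
    ∃ C : A, toeSh s m k - algebraMap ℂ A ((z⁻¹) ^ k) = (m - algebraMap ℂ A z) * C := by
  have hpow : ∀ (a : A) (y : ℂ) (n : ℕ), ∃ C : A,
      a ^ n - algebraMap ℂ A (y ^ n) = (a - algebraMap ℂ A y) * C := by
    intro a y n
    rw [map_pow]
    exact ⟨_, (Commute.mul_geom_sum₂ (Algebra.commutes y a).symm n).symm⟩
  unfold toeSh
  split_ifs with h
  · obtain ⟨n, rfl⟩ := Int.eq_ofNat_of_zero_le h
    obtain ⟨C, hC⟩ := hpow s z⁻¹ n
    refine ⟨(-(algebraMap ℂ A z⁻¹ * s)) * C, ?_⟩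
    have h1 : s - algebraMap ℂ A z⁻¹ = (m - algebraMap ℂ A z) * (-(algebraMap ℂ A z⁻¹ * s)) := by
      rw [Algebra.commutes z⁻¹ s, sub_mul, mul_neg, ← mul_assoc, hms, mul_neg,
        ← Algebra.commutes z⁻¹ s, ← mul_assoc, ← map_mul, mul_inv_cancel₀ hz, map_one]
      simp
      abel
    rw [← mul_assoc, ← h1, ← hC]
    simp
  · obtain ⟨n, hn⟩ := Int.eq_ofNat_of_zero_le (show 0 ≤ -k by lia)
    obtain rfl : k = -(n : ℤ) := by lia
    simpa using hpow m z n

lemma toe_poly_left {A : Type*} [NormedRing A] [NormedAlgebra ℂ A] [CompleteSpace A]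
    [NormOneClass A] (s m : A) (hms : m * s = 1) (w : ℂ) (hw : w ∈ spectrum ℂ s)
    (hr : (‖w‖₊ : ℝ≥0∞) = spectralRadius ℂ s) (hw0 : w ≠ 0)
    {P : Type*} (I : Finset P) (c : P → ℂ) (d : P → ℤ) :
    ‖∑ p ∈ I, c p * w ^ d p‖ ≤ ‖∑ p ∈ I, c p • toeSh s m (d p)‖ := by
  choose C hC using toe_sh_left s m hms w hw0
  refine toe_left s w hw hr hw0 _ (∑ p ∈ I, c p • C (d p)) _ ?_
  rw [map_sum, ← Finset.sum_sub_distrib, Finset.sum_mul]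
  refine Finset.sum_congr rfl fun p _ => ?_
  rw [smul_mul_assoc, ← hC, smul_sub, map_mul, Algebra.smul_def (c p) (algebraMap ℂ A _)]

lemma toe_poly_right {A : Type*} [NormedRing A] [NormedAlgebra ℂ A] [CompleteSpace A]
    [NormOneClass A] (s m : A) (hms : m * s = 1) (w : ℂ) (hw : w ∈ spectrum ℂ m)
    (hr : (‖w‖₊ : ℝ≥0∞) = spectralRadius ℂ m) (hw0 : w ≠ 0)
    {P : Type*} (I : Finset P) (c : P → ℂ) (d : P → ℤ) :
    ‖∑ p ∈ I, c p * (w⁻¹) ^ d p‖ ≤ ‖∑ p ∈ I, c p • toeSh s m (d p)‖ := by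
  choose C hC using toe_sh_right s m hms w hw0
  refine toe_right m w hw hr hw0 _ (∑ p ∈ I, c p • C (d p)) _ ?_
  rw [map_sum, ← Finset.sum_sub_distrib, Finset.mul_sum]
  refine Finset.sum_congr rfl fun p _ => ?_
  rw [mul_smul_comm, ← hC, smul_sub, map_mul, Algebra.smul_def (c p) (algebraMap ℂ A _)]

lemma toe_orth (n : ℤ) :
    ∫ t in (0 : ℝ)..(2 * Real.pi), Complex.exp (n * (t * Complex.I)) =
      if n = 0 then (2 * Real.pi : ℂ) else 0 := by
  split_ifs with h
  · subst h
    simp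
  · have hc : (n : ℂ) * Complex.I ≠ 0 := mul_ne_zero (by exact_mod_cast h) Complex.I_ne_zero
    have := integral_exp_mul_complex (a := 0) (b := 2 * Real.pi) hc
    have e : ∀ t : ℝ, Complex.exp (n * (t * Complex.I)) = Complex.exp (n * Complex.I * t) := by
      intro t; congr 1; ring
    simp only [e]
    rw [this]
    have h1 : Complex.exp (n * Complex.I * ((2 * Real.pi : ℝ) : ℂ)) = 1 := by
      rw [Complex.exp_eq_one_iff]
      exact ⟨n, by push_cast; ring⟩
    rw [h1]
    simp

/-- Main averaging lemma. -/
lemma toe_avg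
    {E : Type*} [NormedAddCommGroup E] [NormedSpace ℂ E] [CompleteSpace E]
    (ι : E →ₗ[ℂ] (ℕ → ℂ)) (hι : Function.Injective ι)
    (e : ℕ → E) (he : ∀ k : ℕ, ι (e k) = Pi.single k 1)
    (hdense : Dense (Submodule.span ℂ (Set.range e) : Set E))
    (hcoord : ∀ n : ℕ, Continuous fun x : E => ι x n)
    (Γ : ℂ → E → E)
    (hΓ : ∀ z : ℂ, ‖z‖ = 1 → ∀ x : E, ∀ n : ℕ, ι (Γ z x) n = z ^ n * ι x n)
    (hΓiso : ∀ z : ℂ, ‖z‖ = 1 → ∀ x : E, ‖Γ z x‖ = ‖x‖)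
    (T R : E →L[ℂ] E) (g : ℝ → ℂ) (hg : Continuous g)
    (hR : ∀ k n : ℕ, 2 * Real.pi * ι (R (e k)) n =
      (∫ t in (0 : ℝ)..(2 * Real.pi), g t * Complex.exp (((n : ℤ) - (k : ℤ) : ℤ) * (t * Complex.I)))
        * ι (T (e k)) n) :
    2 * Real.pi * ‖R‖ ≤ (∫ t in (0 : ℝ)..(2 * Real.pi), ‖g t‖) * ‖T‖ := by
  have hadd : ∀ z : ℂ, ‖z‖ = 1 → ∀ x y, Γ z (x + y) = Γ z x + Γ z y := by
    intro z hz x y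
    apply hι
    funext n
    simp [hΓ z hz, mul_add]
  have hsmul : ∀ z : ℂ, ‖z‖ = 1 → ∀ (c : ℂ) x, Γ z (c • x) = c • Γ z x := by
    intro z hz c x
    apply hι
    funext n
    simp [hΓ z hz]
    ring
  have hzero : ∀ z : ℂ, ‖z‖ = 1 → Γ z 0 = 0 := by
    intro z hz
    simpa using hsmul z hz 0 0
  have hsub : ∀ z : ℂ, ‖z‖ = 1 → ∀ x y, Γ z (x - y) = Γ z x - Γ z y := by
    intro z hz x y
    apply hι
    funext n
    simp [hΓ z hz, mul_sub]
  have hbasis : ∀ z : ℂ, ‖z‖ = 1 → ∀ k, Γ z (e k) = z ^ k • e k := by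
    intro z hz k
    apply hι
    funext n
    simp only [hΓ z hz, he, map_smul, Pi.smul_apply, smul_eq_mul]
    by_cases h : n = k
    · subst h; simp
    · simp [h]
  let q : ℝ → ℂ := fun t => Complex.exp (t * Complex.I)
  have hq : ∀ t, ‖q t‖ = 1 := fun t => Complex.norm_exp_ofReal_mul_I t
  have hqc : Continuous q := by fun_prop
  -- strong continuity
  have hspan : ∀ y ∈ Submodule.span ℂ (Set.range e), Continuous fun t => Γ (q t) y := by
    intro y hy
    induction hy using Submodule.span_induction with
    | mem x hx =>
      obtain ⟨k, rfl⟩ := hx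
      simp only [hbasis _ (hq _)]
      fun_prop
    | zero =>
      simp only [hzero _ (hq _)]
      fun_prop
    | add x y _ _ hx hy =>
      simp only [hadd _ (hq _)]
      exact hx.add hy
    | smul c x _ hx =>
      simp only [hsmul _ (hq _)]
      exact hx.const_smul c
  have hcont : ∀ y, Continuous fun t => Γ (q t) y := by
    intro y
    rw [continuous_iff_continuousAt]
    intro t₀
    rw [Metric.continuousAt_iff']
    intro ε hε
    obtain ⟨x, hx, hxy⟩ := Metric.dense_iff.mp hdense y (ε / 3) (by positivity)
    have h1 := (Metric.continuousAt_iff'.mp ((hspan x hxy).continuousAt (x := t₀))) (ε / 3) (by positivity)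
    filter_upwards [h1] with t ht
    rw [dist_eq_norm] at ht ⊢
    have h2 : ∀ s, ‖Γ (q s) y - Γ (q s) x‖ < ε / 3 := by
      intro s
      rw [← hsub _ (hq s), hΓiso _ (hq s), ← dist_eq_norm, dist_comm]
      exact hx
    have e1 : Γ (q t) y - Γ (q t₀) y = (Γ (q t) y - Γ (q t) x) + (Γ (q t) x - Γ (q t₀) x)
        - (Γ (q t₀) y - Γ (q t₀) x) := by abel
    rw [e1]
    have h3 := norm_sub_le ((Γ (q t) y - Γ (q t) x) + (Γ (q t) x - Γ (q t₀) x)) (Γ (q t₀) y - Γ (q t₀) x)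
    have h4 := norm_add_le (Γ (q t) y - Γ (q t) x) (Γ (q t) x - Γ (q t₀) x)
    linarith [h2 t, h2 t₀]
  let V : ℝ → E → E := fun t x => Γ (q t) (T (Γ (q (-t)) x))
  have hVn : ∀ t x, ‖V t x‖ ≤ ‖T‖ * ‖x‖ := by
    intro t x
    simp only [V]
    rw [hΓiso _ (hq _)]
    refine (T.le_opNorm _).trans ?_
    rw [hΓiso _ (hq _)]
  have hVe : ∀ t k, V t (e k) = q (-t) ^ k • Γ (q t) (T (e k)) := by
    intro t k
    simp only [V]
    rw [hbasis _ (hq _), map_smul, hsmul _ (hq _)]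
  have hII : ∀ F : ℝ → E, Continuous F → IntervalIntegrable (fun t => g t • F t)
      MeasureTheory.volume 0 (2 * Real.pi) :=
    fun F hF => (hg.smul hF).intervalIntegrable _ _
  have hmain : ∀ x ∈ Submodule.span ℂ (Set.range e), Continuous (fun t => V t x) ∧
      ((2 * Real.pi : ℝ) : ℂ) • R x = ∫ t in (0 : ℝ)..(2 * Real.pi), g t • V t x := by
    intro x hx
    induction hx using Submodule.span_induction with
    | mem x hx =>
      obtain ⟨k, rfl⟩ := hx
      have hc : Continuous fun t => V t (e k) := by
        simp only [hVe]
        exact ((hqc.comp continuous_neg).pow k).smul (hcont (T (e k)))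
      refine ⟨hc, ?_⟩
      apply hι
      funext n
      let L : E →L[ℂ] ℂ := ⟨(LinearMap.proj n).comp ι, hcoord n⟩
      have hL : ∀ x, L x = ι x n := fun x => rfl
      rw [← hL, ← hL, ← ContinuousLinearMap.intervalIntegral_comp_comm L
        (hII _ hc)]
      simp only [map_smul, hL, hVe, Pi.smul_apply, smul_eq_mul, hΓ _ (hq _)]
      push_cast
      rw [hR, ← intervalIntegral.integral_mul_const]
      congr 1
      funext t
      have : q (-t) ^ k * q t ^ n = Complex.exp (((n : ℤ) - (k : ℤ) : ℤ) * (t * Complex.I)) := by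
        simp only [q]
        rw [← Complex.exp_nat_mul, ← Complex.exp_nat_mul, ← Complex.exp_add]
        congr 1
        push_cast
        ring
      rw [← this]
      ring
    | zero =>
      have : ∀ t, V t 0 = 0 := by
        intro t
        simp [V, hzero _ (hq _)]
      simp only [this]
      refine ⟨by fun_prop, by simp⟩
    | add x y _ _ hx hy =>
      have : ∀ t, V t (x + y) = V t x + V t y := by
        intro t
        simp only [V]
        rw [hadd _ (hq _), map_add, hadd _ (hq _)]
      simp only [this]
      refine ⟨hx.1.add hy.1, ?_⟩
      simp only [smul_add]
      rw [map_add, smul_add, hx.2, hy.2, intervalIntegral.integral_add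
        (hII _ hx.1) (hII _ hy.1)]
    | smul c x _ hx =>
      have : ∀ t, V t (c • x) = c • V t x := by
        intro t
        simp only [V]
        rw [hsmul _ (hq _), map_smul, hsmul _ (hq _)]
      simp only [this]
      refine ⟨hx.1.const_smul c, ?_⟩
      simp only [smul_comm _ c]
      rw [map_smul, intervalIntegral.integral_smul, ← hx.2, smul_comm]
  have hpi := Real.pi_pos
  set G := ∫ t in (0 : ℝ)..(2 * Real.pi), ‖g t‖ with hG
  have hG0 : 0 ≤ G := intervalIntegral.integral_nonneg (by positivity) fun t _ => norm_nonneg _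
  have hbound : ∀ x ∈ Submodule.span ℂ (Set.range e),
      2 * Real.pi * ‖R x‖ ≤ G * ‖T‖ * ‖x‖ := by
    intro x hx
    obtain ⟨hc, hi⟩ := hmain x hx
    have e1 : 2 * Real.pi * ‖R x‖ = ‖((2 * Real.pi : ℝ) : ℂ) • R x‖ := by
      rw [norm_smul, Complex.norm_real, Real.norm_eq_abs, abs_of_pos (by positivity)]
    rw [e1, hi, mul_assoc, hG, ← intervalIntegral.integral_mul_const]
    refine intervalIntegral.norm_integral_le_of_norm_le (by positivity) ?_ ?_
    · refine Filter.Eventually.of_forall fun t _ => ?_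
      rw [norm_smul]
      gcongr
      exact hVn t x
    · exact (hg.norm.mul continuous_const).intervalIntegrable _ _
  have hall : ∀ x, 2 * Real.pi * ‖R x‖ ≤ G * ‖T‖ * ‖x‖ := by
    intro x
    have hcl : IsClosed {x : E | 2 * Real.pi * ‖R x‖ ≤ G * ‖T‖ * ‖x‖} :=
      isClosed_le (by fun_prop) (by fun_prop)
    have := hcl.closure_subset_iff.mpr (fun x hx => hbound x hx)
    exact this (hdense x)
  have : ‖R‖ ≤ G * ‖T‖ / (2 * Real.pi) := by
    refine R.opNorm_le_bound (by positivity) fun x => ?_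
    rw [div_mul_eq_mul_div, le_div_iff₀ (by positivity)]
    linarith [hall x]
  rw [le_div_iff₀ (by positivity)] at this
  linarith

lemma toe_polyT
    {E : Type*} [NormedAddCommGroup E] [NormedSpace ℂ E] [CompleteSpace E]
    (ι : E →ₗ[ℂ] (ℕ → ℂ)) (hι : Function.Injective ι)
    (e : ℕ → E) (he : ∀ k : ℕ, ι (e k) = Pi.single k 1)
    (hdense : Dense (Submodule.span ℂ (Set.range e) : Set E))
    (hcoord : ∀ n : ℕ, Continuous fun x : E => ι x n)
    (Γ : ℂ → E → E)
    (hΓ : ∀ z : ℂ, ‖z‖ = 1 → ∀ x : E, ∀ n : ℕ, ι (Γ z x) n = z ^ n * ι x n)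
    (hΓiso : ∀ z : ℂ, ‖z‖ = 1 → ∀ x : E, ‖Γ z x‖ = ‖x‖)
    (Sop Mop : E →L[ℂ] E)
    (hSop : ∀ x : E, ι (Sop x) 0 = 0 ∧ ∀ n : ℕ, ι (Sop x) (n + 1) = ι x n)
    (hMop : ∀ x : E, ∀ n : ℕ, ι (Mop x) n = ι x (n + 1))
    (T : E →L[ℂ] E)
    (hT : ∀ k n : ℕ, ι (T (e (k + 1))) (n + 1) = ι (T (e k)) n)
    (Th : ℤ → ℂ)
    (hTh₁ : ∀ n : ℕ, Th n = ι (T (e 0)) n)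
    (hTh₂ : ∀ n : ℕ, Th (-(n : ℤ)) = ι (T (e n)) 0)
    {P : Type} (I : Finset P) (c : P → ℂ) (d : P → ℤ) :
    2 * Real.pi * ‖∑ p ∈ I, (c p * Th (d p)) • toeSh Sop Mop (d p)‖ ≤
      (∫ t in (0 : ℝ)..(2 * Real.pi),
        ‖∑ p ∈ I, c p * Complex.exp ((-d p : ℤ) * (t * Complex.I))‖) * ‖T‖ := by
  have hmat : ∀ k n : ℕ, ι (T (e k)) n = Th ((n : ℤ) - k) := by
    intro k
    induction k with
    | zero => intro n; simp [hTh₁]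
    | succ k ih =>
      intro n
      cases n with
      | zero => rw [← hTh₂]; simp
      | succ n => rw [hT, ih]; congr 1; push_cast; ring
  have hS : ∀ (j k : ℕ), (Sop ^ j) (e k) = e (k + j) := by
    intro j
    induction j with
    | zero => intro k; simp
    | succ j ih =>
      intro k
      rw [pow_succ', mul_apply_eq_comp, ih]
      apply hι
      funext n
      cases n with
      | zero => rw [(hSop _).1, he]; simp [Pi.single_apply]
      | succ n =>
        rw [(hSop _).2, he, he]
        simp only [Pi.single_apply]
        congr 1
        simp only [eq_iff_iff]
        lia
  have hM : ∀ (j : ℕ) (x : E) (n : ℕ), ι ((Mop ^ j) x) n = ι x (n + j) := by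
    intro j
    induction j with
    | zero => intro x n; simp
    | succ j ih =>
      intro x n
      rw [pow_succ, mul_apply_eq_comp, ih, hMop]
      congr 1
  have hsh : ∀ (m : ℤ) (k n : ℕ), ι (toeSh Sop Mop m (e k)) n = if m = (n : ℤ) - k then 1 else 0 := by
    intro m k n
    unfold toeSh
    split_ifs with h h' h'
    · rw [hS, he, Pi.single_apply, if_pos (by lia)]
    · rw [hS, he, Pi.single_apply, if_neg (by lia)]
    · rw [hM, he, Pi.single_apply, if_pos (by lia)]
    · rw [hM, he, Pi.single_apply, if_neg (by lia)]
  refine toe_avg ι hι e he hdense hcoord Γ hΓ hΓiso T _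
    (fun t => ∑ p ∈ I, c p * Complex.exp ((-d p : ℤ) * (t * Complex.I))) (by fun_prop) ?_
  intro k n
  simp only [sum_apply, map_sum, Finset.sum_apply, smul_apply,
    map_smul, Pi.smul_apply, hsh, smul_eq_mul, Finset.sum_mul]
  rw [intervalIntegral.integral_finsetSum
    (fun p _ => Continuous.intervalIntegrable (by fun_prop) _ _), Finset.sum_mul, Finset.mul_sum]
  refine Finset.sum_congr rfl fun p _ => ?_
  have e1 : ∀ t : ℝ, c p * Complex.exp ((-d p : ℤ) * (t * Complex.I)) *
      Complex.exp (((n : ℤ) - (k : ℤ) : ℤ) * (t * Complex.I)) =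
      c p * Complex.exp (((n : ℤ) - (k : ℤ) - d p : ℤ) * (t * Complex.I)) := by
    intro t
    rw [mul_assoc, ← Complex.exp_add]
    congr 2
    push_cast
    ring
  simp only [e1]
  rw [intervalIntegral.integral_const_mul, toe_orth, hmat]
  by_cases h : d p = (n : ℤ) - k
  · rw [if_pos h, if_pos (by lia), h]; ring
  · rw [if_neg h, if_neg (by lia)]; ring

/-- Consequences: coefficient bound and Fejer bound. -/
lemma toe_bounds {A : Type*} [NormedRing A] [NormedAlgebra ℂ A] (s m : A) (Th : ℤ → ℂ) (τ : ℝ)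
    (h : ∀ (I : Finset (ℕ × ℕ)) (c : ℕ × ℕ → ℂ) (d : ℕ × ℕ → ℤ),
      2 * Real.pi * ‖∑ p ∈ I, (c p * Th (d p)) • toeSh s m (d p)‖ ≤
      (∫ t in (0 : ℝ)..(2 * Real.pi),
        ‖∑ p ∈ I, c p * Complex.exp ((-d p : ℤ) * (t * Complex.I))‖) * τ) :
    (∀ k : ℤ, ‖Th k‖ * ‖toeSh s m k‖ ≤ τ) ∧
    (∀ (N : ℕ) (u : ℂ), ‖u‖ = 1 →
      ‖∑ p ∈ Finset.range N ×ˢ Finset.range N,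
        (u ^ ((p.1 : ℤ) - p.2) * Th ((p.1 : ℤ) - p.2)) • toeSh s m ((p.1 : ℤ) - p.2)‖ ≤ N * τ) := by
  have hpi := Real.pi_pos
  constructor
  · intro k
    have := h {(0, 0)} (fun _ => 1) (fun _ => k)
    simp only [Finset.sum_singleton, one_mul, norm_smul] at this
    have e1 : ∀ t : ℝ, ‖Complex.exp ((-k : ℤ) * (t * Complex.I))‖ = 1 := by
      intro t
      rw [show ((-k : ℤ) : ℂ) * (t * Complex.I) = ((-k * t : ℝ) : ℂ) * Complex.I by push_cast; ring]
      exact Complex.norm_exp_ofReal_mul_I _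
    simp only [e1] at this
    simp only [intervalIntegral.integral_const, sub_zero, smul_eq_mul, mul_one] at this
    exact le_of_mul_le_mul_left this (by positivity)
  · intro N u hu
    have hu0 : u ≠ 0 := by rintro rfl; simp at hu
    have h1 := h (Finset.range N ×ˢ Finset.range N) (fun p => u ^ ((p.1 : ℤ) - p.2))
      (fun p => (p.1 : ℤ) - p.2)
    have e1 : ∀ t : ℝ, ∑ p ∈ Finset.range N ×ˢ Finset.range N, u ^ ((p.1 : ℤ) - p.2) *
        Complex.exp ((-((p.1 : ℤ) - p.2) : ℤ) * (t * Complex.I)) =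
        ((‖∑ j ∈ Finset.range N, (u * Complex.exp (-(t * Complex.I))) ^ j‖ ^ 2 : ℝ) : ℂ) := by
      intro t
      set v := u * Complex.exp (-(t * Complex.I)) with hv
      have hv1 : ‖v‖ = 1 := by
        rw [hv, norm_mul, hu, one_mul,
          show -((t : ℂ) * Complex.I) = ((-t : ℝ) : ℂ) * Complex.I by push_cast; ring]
        exact Complex.norm_exp_ofReal_mul_I _
      have hv0 : v ≠ 0 := by intro h0; simp [h0] at hv1
      have hconj : (starRingEnd ℂ) v = v⁻¹ := (Complex.inv_eq_conj hv1).symm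
      push_cast
      rw [← Complex.mul_conj', map_sum, Finset.sum_mul_sum, ← Finset.sum_product']
      refine Finset.sum_congr rfl fun p _ => ?_
      rw [map_pow, hconj, inv_pow, ← zpow_natCast, ← zpow_natCast, ← zpow_neg, ← zpow_add₀ hv0,
        ← sub_eq_add_neg, hv, mul_zpow, ← Complex.exp_int_mul]
      congr 2
      push_cast
      ring
    have e2 : (∫ t in (0 : ℝ)..(2 * Real.pi), ‖∑ p ∈ Finset.range N ×ˢ Finset.range N,
        u ^ ((p.1 : ℤ) - p.2) *
        Complex.exp ((-((p.1 : ℤ) - p.2) : ℤ) * (t * Complex.I))‖) = 2 * Real.pi * N := by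
      have e3 : ∀ t : ℝ, ‖∑ p ∈ Finset.range N ×ˢ Finset.range N, u ^ ((p.1 : ℤ) - p.2) *
        Complex.exp ((-((p.1 : ℤ) - p.2) : ℤ) * (t * Complex.I))‖ =
        ‖∑ j ∈ Finset.range N, (u * Complex.exp (-(t * Complex.I))) ^ j‖ ^ 2 := by
        intro t
        rw [e1, Complex.norm_real, Real.norm_eq_abs, abs_of_nonneg (by positivity)]
      simp only [e3]
      apply Complex.ofReal_injective
      rw [← intervalIntegral.integral_ofReal]
      simp only [← e1]
      rw [intervalIntegral.integral_finsetSum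
        (fun p _ => Continuous.intervalIntegrable (by fun_prop) _ _)]
      simp only [intervalIntegral.integral_const_mul, toe_orth]
      rw [Finset.sum_product]
      have : ∀ i ∈ Finset.range N, (∑ j ∈ Finset.range N, u ^ ((i : ℤ) - j) *
          (if -((i : ℤ) - j) = 0 then (2 * Real.pi : ℂ) else 0)) = 2 * Real.pi := by
        intro i hi
        rw [Finset.sum_eq_single_of_mem i hi]
        · simp
        · intro j _ hj
          rw [if_neg (by lia), mul_zero]
      rw [Finset.sum_congr rfl this]
      simp
      ring
    rw [e2] at h1
    refine le_of_mul_le_mul_left (h1.trans (le_of_eq ?_)) (show 0 < 2 * Real.pi by positivity)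
    ring

lemma toe_cesaro (a : ℤ → ℂ) (ha : Summable a) (τ : ℝ)
    (h : ∀ N : ℕ, ‖∑ p ∈ Finset.range N ×ˢ Finset.range N, a ((p.1 : ℤ) - p.2)‖ ≤ N * τ) :
    ‖∑' k, a k‖ ≤ τ := by
  have s1 : Summable fun n : ℕ => a n := ha.comp_injective Nat.cast_injective
  have s2 : Summable fun n : ℕ => a (-((n : ℤ) + 1)) :=
    ha.comp_injective (i := fun n : ℕ => (-((n : ℤ) + 1))) (by intro x y hxy; simp at hxy; lia)
  have hsum := (HasSum.of_nat_of_neg_add_one s1.hasSum s2.hasSum).tsum_eq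
  let P : ℕ → ℂ := fun N => ∑ k ∈ Finset.range (N + 1), a k + ∑ k ∈ Finset.range N, a (-((k : ℤ) + 1))
  have hP : Filter.Tendsto P Filter.atTop (nhds (∑' k, a k)) := by
    rw [hsum]
    exact ((Filter.tendsto_add_atTop_iff_nat 1).mpr s1.hasSum.tendsto_sum_nat).add
      s2.hasSum.tendsto_sum_nat
  have hA : ∀ N : ℕ, ∑ p ∈ Finset.range N ×ˢ Finset.range N, a ((p.1 : ℤ) - p.2) =
      ∑ n ∈ Finset.range N, P n := by
    intro N
    induction N with
    | zero => simp
    | succ N ih =>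
      rw [Finset.sum_range_succ, ← ih, Finset.sum_product, Finset.sum_product,
        Finset.sum_range_succ]
      simp only [Finset.sum_range_succ _ N, Finset.sum_add_distrib]
      simp only [P]
      have r1 : ∑ k ∈ Finset.range N, a (-((k : ℤ) + 1)) = ∑ i ∈ Finset.range N, a ((i : ℤ) - N) := by
        rw [← Finset.sum_range_reflect]
        refine Finset.sum_congr rfl fun i hi => ?_
        rw [Finset.mem_range] at hi
        congr 1
        lia
      have r2 : ∑ k ∈ Finset.range (N + 1), a k = ∑ j ∈ Finset.range (N + 1), a ((N : ℤ) - j) := by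
        rw [← Finset.sum_range_reflect]
        refine Finset.sum_congr rfl fun i hi => ?_
        rw [Finset.mem_range] at hi
        congr 1
        lia
      rw [r1, r2, Finset.sum_range_succ]
      ring
  have hc := hP.cesaro_smul
  refine le_of_tendsto hc.norm ?_
  filter_upwards [Filter.eventually_gt_atTop 0] with N hN
  rw [← hA, norm_smul, norm_inv, Real.norm_natCast]
  have hN' : (0 : ℝ) < N := by exact_mod_cast hN
  rw [inv_mul_le_iff₀ hN']
  exact h N

lemma toe_final (Th : ℤ → ℂ) (r1 r2 τ : ℝ) (h1 : 0 < r1) (h12 : r1 < r2)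
    (hp : ∀ k : ℕ, ‖Th k‖ * r2 ^ k ≤ τ) (hm : ∀ k : ℕ, ‖Th (-(k : ℤ))‖ * (r1⁻¹) ^ k ≤ τ)
    (hf : ∀ (N : ℕ) (z : ℂ), ‖z‖ = r1 ∨ ‖z‖ = r2 →
      ‖∑ p ∈ Finset.range N ×ˢ Finset.range N,
        Th ((p.1 : ℤ) - p.2) * z ^ ((p.1 : ℤ) - p.2)‖ ≤ N * τ) :
    ∃ f : ℂ → ℂ, (∀ z ∈ {z : ℂ | r1 < ‖z‖ ∧ ‖z‖ < r2}, HasSum (fun n : ℤ => Th n * z ^ n) (f z)) ∧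
      DifferentiableOn ℂ f {z : ℂ | r1 < ‖z‖ ∧ ‖z‖ < r2} ∧
      ∀ z ∈ {z : ℂ | r1 < ‖z‖ ∧ ‖z‖ < r2}, ‖f z‖ ≤ τ := by
  have h2 : 0 < r2 := h1.trans h12
  have hτ : 0 ≤ τ := le_trans (by positivity) (hp 0)
  let b : ℝ → ℝ → ℤ → ℝ := fun s1 s2 k => τ * ((s2 / r2) ^ k.natAbs + (r1 / s1) ^ k.natAbs)
  have hb : ∀ s1 s2, r1 < s1 → 0 < s2 → s2 < r2 → Summable (b s1 s2) := by
    intro s1 s2 hs1 hs20 hs2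
    have hs10 := h1.trans hs1
    have g1 : Summable fun n : ℕ => τ * ((s2 / r2) ^ n + (r1 / s1) ^ n) := by
      refine Summable.mul_left _ (Summable.add ?_ ?_)
      · exact summable_geometric_of_lt_one (by positivity) ((div_lt_one h2).mpr hs2)
      · exact summable_geometric_of_lt_one (by positivity) ((div_lt_one hs10).mpr hs1)
    refine Summable.of_nat_of_neg ?_ ?_
    · simpa [b] using g1
    · simpa [b] using g1
  have hbd : ∀ s1 s2, r1 < s1 → 0 < s2 → s2 < r2 → ∀ z : ℂ, s1 ≤ ‖z‖ → ‖z‖ ≤ s2 → ∀ k,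
      ‖Th k * z ^ k‖ ≤ b s1 s2 k := by
    intro s1 s2 hs1 hs20 hs2 z hz1 hz2 k
    have hs10 := h1.trans hs1
    have hz0 := hs10.trans_le hz1
    rw [norm_mul, norm_zpow]
    simp only [b]
    obtain ⟨n, rfl | rfl⟩ := k.eq_nat_or_neg
    · rw [zpow_natCast, Int.natAbs_natCast]
      have e1 : ‖Th n‖ * ‖z‖ ^ n ≤ ‖Th n‖ * s2 ^ n := by gcongr
      have e2 : ‖Th n‖ * s2 ^ n = ‖Th n‖ * r2 ^ n * (s2 / r2) ^ n := by
        rw [div_pow]; field_simp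
      have e3 : ‖Th n‖ * r2 ^ n * (s2 / r2) ^ n ≤ τ * (s2 / r2) ^ n := by
        gcongr; exact hp n
      have e4 : 0 ≤ τ * (r1 / s1) ^ n := by positivity
      linarith
    · rw [zpow_neg, zpow_natCast, Int.natAbs_neg, Int.natAbs_natCast]
      have e1 : ‖Th (-(n : ℤ))‖ * (‖z‖ ^ n)⁻¹ ≤ ‖Th (-(n : ℤ))‖ * (s1 ^ n)⁻¹ := by gcongr
      have e2 : ‖Th (-(n : ℤ))‖ * (s1 ^ n)⁻¹ = ‖Th (-(n : ℤ))‖ * (r1⁻¹) ^ n * (r1 / s1) ^ n := by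
        rw [div_pow, inv_pow]; field_simp
      have e3 : ‖Th (-(n : ℤ))‖ * (r1⁻¹) ^ n * (r1 / s1) ^ n ≤ τ * (r1 / s1) ^ n := by
        gcongr; exact hm n
      have e4 : 0 ≤ τ * (s2 / r2) ^ n := by positivity
      linarith
  have hsm : ∀ z ∈ {z : ℂ | r1 < ‖z‖ ∧ ‖z‖ < r2}, Summable (fun n : ℤ => Th n * z ^ n) := by
    rintro z ⟨hz1, hz2⟩
    exact Summable.of_norm_bounded (hb ‖z‖ ‖z‖ hz1 (h1.trans hz1) hz2)
      (hbd ‖z‖ ‖z‖ hz1 (h1.trans hz1) hz2 z le_rfl le_rfl)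
  refine ⟨fun z => ∑' n : ℤ, Th n * z ^ n, fun z hz => (hsm z hz).hasSum, ?_, ?_⟩
  · rintro z ⟨hz1, hz2⟩
    obtain ⟨s1, hs1, hs1z⟩ := exists_between hz1
    obtain ⟨s2, hs2z, hs2⟩ := exists_between hz2
    have hs20 : 0 < s2 := (h1.trans hz1).trans hs2z
    have hopen : IsOpen {z : ℂ | s1 < ‖z‖ ∧ ‖z‖ < s2} :=
      (isOpen_lt continuous_const continuous_norm).inter (isOpen_lt continuous_norm continuous_const)
    have hd : DifferentiableOn ℂ (fun z => ∑' n : ℤ, Th n * z ^ n) {z : ℂ | s1 < ‖z‖ ∧ ‖z‖ < s2} := by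
      refine Complex.differentiableOn_tsum_of_summable_norm (hb s1 s2 hs1 hs20 hs2) ?_ hopen ?_
      · intro i w hw
        have hw0 : w ≠ 0 := norm_pos_iff.mp ((h1.trans hs1).trans hw.1)
        exact ((differentiableAt_zpow.mpr (Or.inl hw0)).const_mul _).differentiableWithinAt
      · intro i w hw
        exact hbd s1 s2 hs1 hs20 hs2 w hw.1.le hw.2.le i
    exact (hd.differentiableAt (hopen.mem_nhds ⟨hs1z, hs2z⟩)).differentiableWithinAt
  · intro z hz
    refine toe_cesaro _ (hsm z hz) τ fun N => ?_
    set U : Set ℂ := {z : ℂ | r1 < ‖z‖ ∧ ‖z‖ < r2} with hU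
    have hopen : IsOpen U :=
      (isOpen_lt continuous_const continuous_norm).inter (isOpen_lt continuous_norm continuous_const)
    have hcl : closure U ⊆ {z : ℂ | r1 ≤ ‖z‖ ∧ ‖z‖ ≤ r2} := by
      refine closure_minimal (fun w hw => ⟨hw.1.le, hw.2.le⟩) ?_
      exact (isClosed_le continuous_const continuous_norm).inter
        (isClosed_le continuous_norm continuous_const)
    refine Complex.norm_le_of_forall_mem_frontier_norm_le (U := U)
      (f := fun z => ∑ p ∈ Finset.range N ×ˢ Finset.range N,
        Th ((p.1 : ℤ) - p.2) * z ^ ((p.1 : ℤ) - p.2)) ?_ ?_ ?_ (subset_closure hz)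
    · refine (Metric.isBounded_closedBall (x := (0 : ℂ)) (r := r2)).subset fun w hw => ?_
      simpa using hw.2.le
    · apply DifferentiableOn.diffContOnCl
      intro w hw
      have hw0 : w ≠ 0 := norm_pos_iff.mp (h1.trans_le (hcl hw).1)
      apply DifferentiableAt.differentiableWithinAt
      apply DifferentiableAt.fun_sum
      intro p _
      exact (differentiableAt_zpow.mpr (Or.inl hw0)).const_mul _
    · intro w hw
      rw [hopen.frontier_eq] at hw
      have h3 := hcl hw.1
      apply hf
      by_contra hne
      push Not at hne
      exact hw.2 ⟨lt_of_le_of_ne h3.1 (Ne.symm hne.1), lt_of_le_of_ne h3.2 hne.2⟩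

end Toe


/-- If `𝐒` and `𝐒₋₁` are bounded and `1/ρ(𝐒₋₁) < ρ(𝐒)`, then for every Toeplitz
operator `T` the series `T̃(z) = Σ_{n∈ℤ} T̂(n) zⁿ` converges on the open annulus
`{ 1/ρ(𝐒₋₁) < |z| < ρ(𝐒) }`, and `T̃` is holomorphic there with `|T̃(z)| ≤ ‖T‖`. -/
theorem stmt5
    {E : Type*} [NormedAddCommGroup E] [NormedSpace ℂ E] [CompleteSpace E]
    (ι : E →ₗ[ℂ] (ℕ → ℂ)) (hι : Function.Injective ι)
    (e : ℕ → E) (he : ∀ k : ℕ, ι (e k) = Pi.single k 1)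
    (hdense : Dense (Submodule.span ℂ (Set.range e) : Set E))
    (hcoord : ∀ n : ℕ, Continuous fun x : E => ι x n)
    -- (ℋ3), strengthened so that each `γ_z` is an isometry of `𝐄`:
    (Γ : ℂ → E → E)
    (hΓ : ∀ z : ℂ, ‖z‖ = 1 → ∀ x : E, ∀ n : ℕ, ι (Γ z x) n = z ^ n * ι x n)
    (hΓiso : ∀ z : ℂ, ‖z‖ = 1 → ∀ x : E, ‖Γ z x‖ = ‖x‖)
    -- `𝐒` and `𝐒₋₁` are both bounded, with restrictions `Sop` and `Mop` to `𝐄`: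
    (Sop Mop : E →L[ℂ] E)
    (hSop : ∀ x : E, ι (Sop x) 0 = 0 ∧ ∀ n : ℕ, ι (Sop x) (n + 1) = ι x n)
    (hMop : ∀ x : E, ∀ n : ℕ, ι (Mop x) n = ι x (n + 1))
    -- `1/ρ(𝐒₋₁) < ρ(𝐒)`:
    (hρ : (spectralRadius ℂ Mop)⁻¹ < spectralRadius ℂ Sop)
    -- `T` is a Toeplitz operator on `𝐄`:
    (T : E →L[ℂ] E)
    (hT : ∀ k n : ℕ, ι (T (e (k + 1))) (n + 1) = ι (T (e k)) n)
    -- `Th` is the symbol sequence `T̂`: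
    (Th : ℤ → ℂ)
    (hTh₁ : ∀ n : ℕ, Th n = ι (T (e 0)) n)
    (hTh₂ : ∀ n : ℕ, Th (-(n : ℤ)) = ι (T (e n)) 0) :
    ∃ f : ℂ → ℂ,
      (∀ z ∈ {z : ℂ | (spectralRadius ℂ Mop)⁻¹ < (‖z‖₊ : ℝ≥0∞) ∧
          (‖z‖₊ : ℝ≥0∞) < spectralRadius ℂ Sop},
        HasSum (fun n : ℤ => Th n * z ^ n) (f z)) ∧
      DifferentiableOn ℂ f
        {z : ℂ | (spectralRadius ℂ Mop)⁻¹ < (‖z‖₊ : ℝ≥0∞) ∧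
          (‖z‖₊ : ℝ≥0∞) < spectralRadius ℂ Sop} ∧
      ∀ z ∈ {z : ℂ | (spectralRadius ℂ Mop)⁻¹ < (‖z‖₊ : ℝ≥0∞) ∧
          (‖z‖₊ : ℝ≥0∞) < spectralRadius ℂ Sop},
        ‖f z‖ ≤ ‖T‖ := by
  have hnt : Nontrivial E := by
    refine ⟨e 0, 0, fun h => ?_⟩
    have := congrFun (he 0) 0
    simp [h] at this
  have hms : Mop * Sop = 1 := by
    ext x
    apply hι
    funext n
    rw [mul_apply_eq_comp, hMop, (hSop x).2]
    rfl
  obtain ⟨h3, h4⟩ := toe_bounds Sop Mop Th ‖T‖ (fun I c d => toe_polyT ι hι e he hdense hcoord Γ hΓ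
    hΓiso Sop Mop hSop hMop T hT Th hTh₁ hTh₂ I c d)
  obtain ⟨w, hw, hwr⟩ := spectrum.exists_nnnorm_eq_spectralRadius Sop
  obtain ⟨v, hv, hvr⟩ := spectrum.exists_nnnorm_eq_spectralRadius Mop
  have hv0 : v ≠ 0 := by
    rintro rfl
    rw [← hvr] at hρ
    simp at hρ
  have hw0 : w ≠ 0 := by
    rintro rfl
    rw [← hwr] at hρ
    simp at hρ
  have hvn : 0 < ‖v‖ := norm_pos_iff.mpr hv0
  have hwn : 0 < ‖w‖ := norm_pos_iff.mpr hw0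
  have hinv : (spectralRadius ℂ Mop)⁻¹ = ((‖v‖₊⁻¹ : NNReal) : ℝ≥0∞) := by
    rw [← hvr, ENNReal.coe_inv (nnnorm_ne_zero_iff.mpr hv0)]
  have hset : {z : ℂ | (spectralRadius ℂ Mop)⁻¹ < (‖z‖₊ : ℝ≥0∞) ∧
          (‖z‖₊ : ℝ≥0∞) < spectralRadius ℂ Sop} = {z : ℂ | ‖v‖⁻¹ < ‖z‖ ∧ ‖z‖ < ‖w‖} := by
    ext z
    simp only [Set.mem_setOf_eq]
    rw [hinv, ← hwr, ENNReal.coe_lt_coe, ENNReal.coe_lt_coe, ← NNReal.coe_lt_coe,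
      ← NNReal.coe_lt_coe]
    simp
  have h12 : ‖v‖⁻¹ < ‖w‖ := by
    rw [hinv, ← hwr, ENNReal.coe_lt_coe, ← NNReal.coe_lt_coe] at hρ
    simpa using hρ
  rw [hset]
  have hpw : ∀ (X : E →L[ℂ] E) (y : ℂ), y ∈ spectrum ℂ X → ∀ k : ℕ, ‖y‖ ^ k ≤ ‖X ^ k‖ := by
    intro X y hy k
    rw [← norm_pow]
    exact spectrum.norm_le_norm_of_mem (spectrum.pow_mem_pow X k hy)
  refine toe_final Th ‖v‖⁻¹ ‖w‖ ‖T‖ (by positivity) h12 ?_ ?_ ?_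
  · intro k
    refine le_trans ?_ (h3 k)
    gcongr
    simpa [toeSh] using hpw Sop w hw k
  · intro k
    refine le_trans ?_ (h3 (-(k : ℤ)))
    gcongr
    rw [inv_inv]
    have : toeSh Sop Mop (-(k : ℤ)) = Mop ^ k := by
      unfold toeSh
      split_ifs with h
      · obtain rfl : k = 0 := by lia
        simp
      · simp
    rw [this]
    exact hpw Mop v hv k
  · rintro N z (hz | hz)
    · have hu : ‖z * v‖ = 1 := by rw [norm_mul, hz, inv_mul_cancel₀ hvn.ne']
      refine le_trans (le_of_eq ?_) ((toe_poly_right Sop Mop hms v hv hvr hv0 _ _ _).trans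
        (h4 N (z * v) hu))
      congr 1
      refine Finset.sum_congr rfl fun p _ => ?_
      rw [mul_comm (_ ^ _) (Th _), mul_assoc, ← mul_zpow, mul_assoc, mul_inv_cancel₀ hv0, mul_one]
    · have hu : ‖z * w⁻¹‖ = 1 := by rw [norm_mul, norm_inv, hz, mul_inv_cancel₀ hwn.ne']
      refine le_trans (le_of_eq ?_) ((toe_poly_left Sop Mop hms w hw hwr hw0 _ _ _).trans
        (h4 N (z * w⁻¹) hu))
      congr 1
      refine Finset.sum_congr rfl fun p _ => ?_
      rw [mul_comm (_ ^ _) (Th _), mul_assoc, ← mul_zpow, mul_assoc, inv_mul_cancel₀ hw0, mul_one]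
end
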